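/- arXiv:math/0402030 — 4 statements merged into one kernel-verified Lean document; each statement's English description precedes it below -/
import Mathlib

section
/- Let n ≥ 1 and let f : H^n → ℂ be a smooth bounded function on the Heisenberg group H^n such that ℒ_n f = 0. Then f satisfies the boundary Cauchy–Riemann equations, that is, Z̄_k f = 0 for every k = 1, …, n. -/
noncomputable section
open MeasureTheory Filter Set
open scoped Topology BigOperators

/-- The Heisenberg group `H^n = ℂ^n × ℝ` as a set. -/
abbrev Hn (n : ℕ) : Type := (Fin n → ℂ) × ℝ

/-- The extension `S = H^n × (0,∞)`; we use `H^n × ℝ` and restrict to `a > 0`. -/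
abbrev Sg (n : ℕ) : Type := Hn n × ℝ

/-- Directional derivative of a complex valued function in direction `v`. -/
def dirD {E : Type} [NormedAddCommGroup E] [NormedSpace ℝ E]
    (v : E) (f : E → ℂ) (p : E) : ℂ := fderiv ℝ f p v

def eX (n : ℕ) (j : Fin n) : Hn n := (fun i => if i = j then (1 : ℂ) else 0, 0)
def eY (n : ℕ) (j : Fin n) : Hn n := (fun i => if i = j then Complex.I else 0, 0)
def eT (n : ℕ) : Hn n := (0, 1)

/-- `X_j = ∂_{x_j} + 2 y_j ∂_t` on `H^n`. -/
def XH (n : ℕ) (j : Fin n) (f : Hn n → ℂ) (p : Hn n) : ℂ :=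
  dirD (eX n j) f p + 2 * ((p.1 j).im : ℂ) * dirD (eT n) f p

/-- `Y_j = ∂_{y_j} - 2 x_j ∂_t` on `H^n`. -/
def YH (n : ℕ) (j : Fin n) (f : Hn n → ℂ) (p : Hn n) : ℂ :=
  dirD (eY n j) f p - 2 * ((p.1 j).re : ℂ) * dirD (eT n) f p

/-- `T = ∂_t` on `H^n`. -/
def TH (n : ℕ) (f : Hn n → ℂ) (p : Hn n) : ℂ := dirD (eT n) f p

/-- `ℒ_α = -(1/4) Σ (X_j² + Y_j²) + i α T` on `H^n`. -/
def LH (n : ℕ) (α : ℝ) (f : Hn n → ℂ) (p : Hn n) : ℂ :=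
  -(1/4) * ∑ j, (XH n j (XH n j f) p + YH n j (YH n j f) p) + Complex.I * (α : ℂ) * TH n f p

/-- `Z̄_j = (1/2)(X_j + i Y_j)` on `H^n`. -/
def ZbarH (n : ℕ) (j : Fin n) (f : Hn n → ℂ) (p : Hn n) : ℂ :=
  (1/2) * (XH n j f p + Complex.I * YH n j f p)

/-- A function is bounded. -/
def BddFun {X : Type} (f : X → ℂ) : Prop := ∃ C, ∀ p, ‖f p‖ ≤ C

def vf {n : ℕ} (v : Hn n) (c : Hn n → ℂ) (f : Hn n → ℂ) (p : Hn n) : ℂ :=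
  fderiv ℝ f p v + c p * fderiv ℝ f p (eT n)

def cX {n : ℕ} (j : Fin n) (p : Hn n) : ℂ := 2 * ((p.1 j).im : ℂ)
def cY {n : ℕ} (j : Fin n) (p : Hn n) : ℂ := -(2 * ((p.1 j).re : ℂ))

lemma XH_eq_vf {n : ℕ} (j : Fin n) (f : Hn n → ℂ) : XH n j f = vf (eX n j) (cX j) f := rfl
lemma YH_eq_vf {n : ℕ} (j : Fin n) (f : Hn n → ℂ) : YH n j f = vf (eY n j) (cY j) f := by
  funext p; simp only [YH, vf, cY, dirD]; ring

lemma cd_comp {n : ℕ} (j : Fin n) : ContDiff ℝ (⊤ : ℕ∞) (fun p : Hn n => p.1 j) :=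
  (contDiff_apply ℝ ℂ j).comp contDiff_fst

lemma cd_re {n : ℕ} (j : Fin n) : ContDiff ℝ (⊤ : ℕ∞) (fun p : Hn n => (((p.1 j).re : ℝ) : ℂ)) :=
  Complex.ofRealCLM.contDiff.comp (Complex.reCLM.contDiff.comp (cd_comp j))

lemma cd_im {n : ℕ} (j : Fin n) : ContDiff ℝ (⊤ : ℕ∞) (fun p : Hn n => (((p.1 j).im : ℝ) : ℂ)) :=
  Complex.ofRealCLM.contDiff.comp (Complex.imCLM.contDiff.comp (cd_comp j))

lemma cd_cX {n : ℕ} (j : Fin n) : ContDiff ℝ (⊤ : ℕ∞) (cX j : Hn n → ℂ) :=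
  contDiff_const.mul (cd_im j)
lemma cd_cY {n : ℕ} (j : Fin n) : ContDiff ℝ (⊤ : ℕ∞) (cY j : Hn n → ℂ) :=
  (contDiff_const.mul (cd_re j)).neg

lemma cd_dir {n : ℕ} (v : Hn n) {f : Hn n → ℂ} (hf : ContDiff ℝ (⊤ : ℕ∞) f) :
    ContDiff ℝ (⊤ : ℕ∞) (fun p => fderiv ℝ f p v) :=
  (hf.fderiv_right (m := ((⊤ : ℕ∞) : WithTop ℕ∞)) (by simp)).clm_apply contDiff_const

lemma cd_vf {n : ℕ} (v : Hn n) {c f : Hn n → ℂ} (hc : ContDiff ℝ (⊤ : ℕ∞) c)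
    (hf : ContDiff ℝ (⊤ : ℕ∞) f) : ContDiff ℝ (⊤ : ℕ∞) (vf v c f) :=
  (cd_dir v hf).add (hc.mul (cd_dir _ hf))

lemma ofReal_fderiv_lin {n : ℕ} (l : Hn n →L[ℝ] ℝ) (p v : Hn n) :
    fderiv ℝ (fun q => ((l q : ℝ) : ℂ)) p v = ((l v : ℝ) : ℂ) := by
  have : HasFDerivAt (fun q => ((l q : ℝ) : ℂ)) (Complex.ofRealCLM.comp l) p :=
    (Complex.ofRealCLM.comp l).hasFDerivAt
  rw [this.fderiv]; rfl

def reL {n : ℕ} (j : Fin n) : Hn n →L[ℝ] ℝ :=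
  Complex.reCLM.comp ((ContinuousLinearMap.proj (R := ℝ) (φ := fun _ : Fin n => ℂ) j).comp
    (ContinuousLinearMap.fst ℝ _ _))
def imL {n : ℕ} (j : Fin n) : Hn n →L[ℝ] ℝ :=
  Complex.imCLM.comp ((ContinuousLinearMap.proj (R := ℝ) (φ := fun _ : Fin n => ℂ) j).comp
    (ContinuousLinearMap.fst ℝ _ _))
def tL {n : ℕ} : Hn n →L[ℝ] ℝ := ContinuousLinearMap.snd ℝ _ _

lemma fd_re {n : ℕ} (j : Fin n) (p v : Hn n) :
    fderiv ℝ (fun q : Hn n => (((q.1 j).re : ℝ) : ℂ)) p v = ((v.1 j).re : ℂ) :=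
  ofReal_fderiv_lin (reL j) p v
lemma fd_im {n : ℕ} (j : Fin n) (p v : Hn n) :
    fderiv ℝ (fun q : Hn n => (((q.1 j).im : ℝ) : ℂ)) p v = ((v.1 j).im : ℂ) :=
  ofReal_fderiv_lin (imL j) p v
lemma fd_t {n : ℕ} (p v : Hn n) :
    fderiv ℝ (fun q : Hn n => ((q.2 : ℝ) : ℂ)) p v = (v.2 : ℂ) :=
  ofReal_fderiv_lin tL p v

lemma fd_cX {n : ℕ} (j : Fin n) (p v : Hn n) :
    fderiv ℝ (cX j : Hn n → ℂ) p v = 2 * ((v.1 j).im : ℂ) := by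
  have : (cX j : Hn n → ℂ) = fun q => 2 * (((q.1 j).im : ℝ) : ℂ) := rfl
  rw [this, fderiv_const_mul ((cd_im j).differentiable (by simp) p)]
  simp [fd_im]
lemma fd_cY {n : ℕ} (j : Fin n) (p v : Hn n) :
    fderiv ℝ (cY j : Hn n → ℂ) p v = -(2 * ((v.1 j).re : ℂ)) := by
  have : (cY j : Hn n → ℂ) = fun q => -(2 * (((q.1 j).re : ℝ) : ℂ)) := rfl
  rw [this, fderiv_fun_neg, fderiv_const_mul ((cd_re j).differentiable (by simp) p)]
  simp [fd_re]

lemma hcs_dir {n : ℕ} (v : Hn n) {f : Hn n → ℂ} (hf : HasCompactSupport f) :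
    HasCompactSupport (fun p => fderiv ℝ f p v) :=
  (hf.fderiv (𝕜 := ℝ)).comp_left (g := fun L : Hn n →L[ℝ] ℂ => L v) (by simp)

lemma hcs_vf {n : ℕ} (v : Hn n) (c : Hn n → ℂ) {f : Hn n → ℂ} (hf : HasCompactSupport f) :
    HasCompactSupport (vf v c f) :=
  (hcs_dir v hf).add ((hcs_dir (eT n) hf).mul_left)

instance haarHn (n : ℕ) : (volume : Measure (Hn n)).IsAddHaarMeasure := by
  have h : (volume : Measure (Fin n → ℂ)).IsAddHaarMeasure := by
    rw [volume_pi]; infer_instance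
  rw [Measure.volume_eq_prod]; exact Measure.prod.instIsAddHaarMeasure _ _

lemma ibp_dir {n : ℕ} (v : Hn n) {f g : Hn n → ℂ} (hf : ContDiff ℝ (⊤ : ℕ∞) f)
    (hg : ContDiff ℝ (⊤ : ℕ∞) g) (hgc : HasCompactSupport g) :
    ∫ x, f x * fderiv ℝ g x v = - ∫ x, fderiv ℝ f x v * g x := by
  apply integral_mul_fderiv_eq_neg_fderiv_mul_of_integrable
  · exact ((cd_dir v hf).continuous.mul hg.continuous).integrable_of_hasCompactSupport hgc.mul_left
  · exact (hf.continuous.mul (cd_dir v hg).continuous).integrable_of_hasCompactSupport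
      (hcs_dir v hgc).mul_left
  · exact (hf.continuous.mul hg.continuous).integrable_of_hasCompactSupport hgc.mul_left
  · exact fun x _ => hf.differentiable (by simp) x
  · exact fun x _ => hg.differentiable (by simp) x

lemma ibp_vf {n : ℕ} (v : Hn n) {c f g : Hn n → ℂ} (hc : ContDiff ℝ (⊤ : ℕ∞) c)
    (hct : ∀ p, fderiv ℝ c p (eT n) = 0) (hf : ContDiff ℝ (⊤ : ℕ∞) f)
    (hg : ContDiff ℝ (⊤ : ℕ∞) g) (hgc : HasCompactSupport g) :
    ∫ x, f x * vf v c g x = - ∫ x, vf v c f x * g x := by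
  have h1 := ibp_dir v hf hg hgc
  have h2 := ibp_dir (eT n) (hc.mul hf) hg hgc
  have e1 : ∀ x, f x * vf v c g x = f x * fderiv ℝ g x v + (c * f) x * fderiv ℝ g x (eT n) := by
    intro x; simp only [vf, Pi.mul_apply]; ring
  have e2 : ∀ x, vf v c f x * g x = fderiv ℝ f x v * g x + fderiv ℝ (c * f) x (eT n) * g x := by
    intro x
    rw [fderiv_mul (hc.differentiable (by simp) x) (hf.differentiable (by simp) x)]
    simp [vf, hct]; ring
  simp_rw [e1, e2]
  rw [integral_add, integral_add, h1]
  · have h2' : ∫ x, (c * f) x * fderiv ℝ g x (eT n) = -∫ x, fderiv ℝ (c * f) x (eT n) * g x := h2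
    rw [h2']; ring
  · exact ((cd_dir v hf).continuous.mul hg.continuous).integrable_of_hasCompactSupport hgc.mul_left
  · exact ((cd_dir _ (hc.mul hf)).continuous.mul hg.continuous).integrable_of_hasCompactSupport
      hgc.mul_left
  · exact (hf.continuous.mul (cd_dir v hg).continuous).integrable_of_hasCompactSupport
      (hcs_dir v hgc).mul_left
  · exact ((hc.mul hf).continuous.mul (cd_dir _ hg).continuous).integrable_of_hasCompactSupport
      (hcs_dir _ hgc).mul_left

lemma ibp_vf2 {n : ℕ} (v : Hn n) {c f g : Hn n → ℂ} (hc : ContDiff ℝ (⊤ : ℕ∞) c)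
    (hct : ∀ p, fderiv ℝ c p (eT n) = 0) (hf : ContDiff ℝ (⊤ : ℕ∞) f)
    (hg : ContDiff ℝ (⊤ : ℕ∞) g) (hgc : HasCompactSupport g) :
    ∫ x, f x * vf v c (vf v c g) x = ∫ x, vf v c (vf v c f) x * g x := by
  rw [ibp_vf v hc hct hf (cd_vf v hc hg) (hcs_vf v c hgc),
    ibp_vf v hc hct (cd_vf v hc hf) hg hgc, neg_neg]

lemma fd_cX_T {n : ℕ} (j : Fin n) (p : Hn n) : fderiv ℝ (cX j : Hn n → ℂ) p (eT n) = 0 := by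
  simp [fd_cX, eT]
lemma fd_cY_T {n : ℕ} (j : Fin n) (p : Hn n) : fderiv ℝ (cY j : Hn n → ℂ) p (eT n) = 0 := by
  simp [fd_cY, eT]

lemma ibp_LH {n : ℕ} (α : ℝ) {f g : Hn n → ℂ} (hf : ContDiff ℝ (⊤ : ℕ∞) f)
    (hg : ContDiff ℝ (⊤ : ℕ∞) g) (hgc : HasCompactSupport g) :
    ∫ x, f x * LH n (-α) g x = ∫ x, LH n α f x * g x := by
  have hX := fun j => ibp_vf2 (eX n j) (cd_cX j) (fd_cX_T j) hf hg hgc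
  have hY := fun j => ibp_vf2 (eY n j) (cd_cY j) (fd_cY_T j) hf hg hgc
  have hT := ibp_dir (eT n) hf hg hgc
  have cint : ∀ {u w : Hn n → ℂ}, ContDiff ℝ (⊤ : ℕ∞) u → ContDiff ℝ (⊤ : ℕ∞) w →
      HasCompactSupport w → Integrable (fun x => u x * w x) := fun hu hw hwc =>
    (hu.continuous.mul hw.continuous).integrable_of_hasCompactSupport hwc.mul_left
  have e1 : ∀ x, f x * LH n (-α) g x =
      (-(1/4)) * ∑ j, (f x * vf (eX n j) (cX j) (vf (eX n j) (cX j) g) x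
        + f x * vf (eY n j) (cY j) (vf (eY n j) (cY j) g) x)
      + (-(Complex.I * α)) * (f x * fderiv ℝ g x (eT n)) := by
    intro x
    simp only [LH, XH_eq_vf, YH_eq_vf, TH, dirD, ← mul_add, ← Finset.mul_sum]
    push_cast; ring
  have e2 : ∀ x, LH n α f x * g x =
      (-(1/4)) * ∑ j, (vf (eX n j) (cX j) (vf (eX n j) (cX j) f) x * g x
        + vf (eY n j) (cY j) (vf (eY n j) (cY j) f) x * g x)
      + ((Complex.I * α)) * (fderiv ℝ f x (eT n) * g x) := by
    intro x
    simp only [LH, XH_eq_vf, YH_eq_vf, TH, dirD, ← add_mul, ← Finset.sum_mul]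
    ring
  have iX : ∀ j, Integrable (fun x => f x * vf (eX n j) (cX j) (vf (eX n j) (cX j) g) x) :=
    fun j => cint hf (cd_vf _ (cd_cX j) (cd_vf _ (cd_cX j) hg)) (hcs_vf _ _ (hcs_vf _ _ hgc))
  have iY : ∀ j, Integrable (fun x => f x * vf (eY n j) (cY j) (vf (eY n j) (cY j) g) x) :=
    fun j => cint hf (cd_vf _ (cd_cY j) (cd_vf _ (cd_cY j) hg)) (hcs_vf _ _ (hcs_vf _ _ hgc))
  have iX' : ∀ j, Integrable (fun x => vf (eX n j) (cX j) (vf (eX n j) (cX j) f) x * g x) :=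
    fun j => cint (cd_vf _ (cd_cX j) (cd_vf _ (cd_cX j) hf)) hg hgc
  have iY' : ∀ j, Integrable (fun x => vf (eY n j) (cY j) (vf (eY n j) (cY j) f) x * g x) :=
    fun j => cint (cd_vf _ (cd_cY j) (cd_vf _ (cd_cY j) hf)) hg hgc
  simp_rw [e1, e2]
  rw [integral_add, integral_add, integral_const_mul, integral_const_mul, integral_const_mul,
    integral_const_mul, integral_finsetSum, integral_finsetSum, hT]
  · congr 1
    · congr 1
      refine Finset.sum_congr rfl fun j _ => ?_
      rw [integral_add (iX j) (iY j), integral_add (iX' j) (iY' j), hX, hY]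
    · ring
  · exact fun j _ => (iX' j).add (iY' j)
  · exact fun j _ => (iX j).add (iY j)
  · exact (integrable_finsetSum _ fun j _ => (iX' j).add (iY' j)).const_mul _
  · exact (cint (cd_dir _ hf) hg hgc).const_mul _
  · exact (integrable_finsetSum _ fun j _ => (iX j).add (iY j)).const_mul _
  · exact (cint hf (cd_dir _ hg) (hcs_dir _ hgc)).const_mul _

def ZH (n : ℕ) (j : Fin n) (f : Hn n → ℂ) (p : Hn n) : ℂ :=
  (1/2) * (XH n j f p - Complex.I * YH n j f p)

lemma fd_fd {n : ℕ} {f : Hn n → ℂ} (hf : ContDiff ℝ (⊤ : ℕ∞) f) (v w p : Hn n) :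
    fderiv ℝ (fun q => fderiv ℝ f q v) p w = fderiv ℝ (fderiv ℝ f) p w v := by
  rw [fderiv_clm_apply
    ((hf.fderiv_right (m := ((⊤ : ℕ∞) : WithTop ℕ∞)) (by simp)).differentiable (by simp) p)
    (differentiableAt_const _)]
  simp

lemma fd_symm {n : ℕ} {f : Hn n → ℂ} (hf : ContDiff ℝ (⊤ : ℕ∞) f) (v w p : Hn n) :
    fderiv ℝ (fderiv ℝ f) p w v = fderiv ℝ (fderiv ℝ f) p v w :=
  (hf.contDiffAt.isSymmSndFDerivAt (by simp; exact WithTop.coe_le_coe.2 (le_top : (2 : ℕ∞) ≤ ⊤))) w v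

lemma fd_vf {n : ℕ} (v : Hn n) {c f : Hn n → ℂ} (hc : ContDiff ℝ (⊤ : ℕ∞) c)
    (hf : ContDiff ℝ (⊤ : ℕ∞) f) (p w : Hn n) :
    fderiv ℝ (vf v c f) p w = fderiv ℝ (fderiv ℝ f) p w v
      + (fderiv ℝ c p w * fderiv ℝ f p (eT n) + c p * fderiv ℝ (fderiv ℝ f) p w (eT n)) := by
  have h : vf v c f = fun q => fderiv ℝ f q v + c q * fderiv ℝ f q (eT n) := rfl
  rw [h, fderiv_fun_add ((cd_dir v hf).differentiable (by simp) p)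
    ((hc.mul (cd_dir _ hf)).differentiable (by simp) p),
    fderiv_fun_mul (hc.differentiable (by simp) p) ((cd_dir _ hf).differentiable (by simp) p)]
  simp [fd_fd hf]
  ring

lemma comm_XY {n : ℕ} (j : Fin n) {f : Hn n → ℂ} (hf : ContDiff ℝ (⊤ : ℕ∞) f) (p : Hn n) :
    XH n j (YH n j f) p = YH n j (XH n j f) p - 4 * TH n f p := by
  simp only [XH_eq_vf, YH_eq_vf]
  conv_lhs => rw [vf, fd_vf _ (cd_cY j) hf, fd_vf _ (cd_cY j) hf]
  conv_rhs => rw [vf, fd_vf _ (cd_cX j) hf, fd_vf _ (cd_cX j) hf]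
  rw [fd_symm hf (eY n j) (eX n j), fd_symm hf (eY n j) (eT n), fd_symm hf (eX n j) (eT n)]
  simp [fd_cX, fd_cY, eX, eY, eT, TH, dirD]
  ring

lemma cd_XH {n : ℕ} (j : Fin n) {f : Hn n → ℂ} (hf : ContDiff ℝ (⊤ : ℕ∞) f) :
    ContDiff ℝ (⊤ : ℕ∞) (XH n j f) := by
  rw [XH_eq_vf]; exact cd_vf _ (cd_cX j) hf
lemma cd_YH {n : ℕ} (j : Fin n) {f : Hn n → ℂ} (hf : ContDiff ℝ (⊤ : ℕ∞) f) :
    ContDiff ℝ (⊤ : ℕ∞) (YH n j f) := by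
  rw [YH_eq_vf]; exact cd_vf _ (cd_cY j) hf

lemma fd_ZH {n : ℕ} (j : Fin n) {f : Hn n → ℂ} (hf : ContDiff ℝ (⊤ : ℕ∞) f) (p w : Hn n) :
    fderiv ℝ (ZH n j f) p w =
      (1/2) * (fderiv ℝ (XH n j f) p w - Complex.I * fderiv ℝ (YH n j f) p w) := by
  have hX := (cd_XH j hf).differentiable (by simp) p
  have hY := (cd_YH j hf).differentiable (by simp) p
  have h : ZH n j f = fun q => (1/2 : ℂ) * (XH n j f q - Complex.I * YH n j f q) := rfl
  rw [h, fderiv_const_mul (hX.fun_sub (hY.const_mul _)), fderiv_fun_sub hX (hY.const_mul _),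
    fderiv_const_mul hY]
  simp

lemma LH_eq_Z {n : ℕ} {f : Hn n → ℂ} (hf : ContDiff ℝ (⊤ : ℕ∞) f) (p : Hn n) :
    LH n (-(n : ℝ)) f p = - ∑ j, ZbarH n j (ZH n j f) p := by
  have h : ∀ j, ZbarH n j (ZH n j f) p =
      (1/4) * (XH n j (XH n j f) p + YH n j (YH n j f) p) + Complex.I * TH n f p := by
    intro j
    have hX : XH n j (ZH n j f) p =
        (1/2) * (XH n j (XH n j f) p - Complex.I * XH n j (YH n j f) p) := by
      change fderiv ℝ _ _ _ + _ * fderiv ℝ _ _ _ = (1/2) * ((fderiv ℝ _ _ _ + _ * fderiv ℝ _ _ _) - _ * (fderiv ℝ _ _ _ + _ * fderiv ℝ _ _ _))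
      rw [fd_ZH j hf, fd_ZH j hf]; ring
    have hY : YH n j (ZH n j f) p =
        (1/2) * (YH n j (XH n j f) p - Complex.I * YH n j (YH n j f) p) := by
      change fderiv ℝ _ _ _ - _ * fderiv ℝ _ _ _ = (1/2) * ((fderiv ℝ _ _ _ - _ * fderiv ℝ _ _ _) - _ * (fderiv ℝ _ _ _ - _ * fderiv ℝ _ _ _))
      rw [fd_ZH j hf, fd_ZH j hf]; ring
    rw [ZbarH, hX, hY, comm_XY j hf]
    linear_combination (-(1/4) * YH n j (YH n j f) p) * Complex.I_sq
  simp_rw [h]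
  rw [Finset.sum_add_distrib, ← Finset.mul_sum]
  simp [LH]
  ring

def HZ {n : ℕ} (j : Fin n) (u : Hn n → ℂ) (p : Hn n) (a b : ℂ) : Prop :=
  DifferentiableAt ℝ u p ∧ ZH n j u p = a ∧ ZbarH n j u p = b

lemma HZ.mul {n : ℕ} {j : Fin n} {u v : Hn n → ℂ} {p : Hn n} {a b a' b' : ℂ}
    (hu : HZ j u p a b) (hv : HZ j v p a' b') :
    HZ j (fun q => u q * v q) p (a * v p + u p * a') (b * v p + u p * b') := by
  obtain ⟨du, rfl, rfl⟩ := hu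
  obtain ⟨dv, rfl, rfl⟩ := hv
  refine ⟨du.mul dv, ?_, ?_⟩
  · simp only [ZH, XH, YH, dirD, fderiv_fun_mul du dv]; simp; ring
  · simp only [ZbarH, XH, YH, dirD, fderiv_fun_mul du dv]; simp; ring

lemma HZ.add {n : ℕ} {j : Fin n} {u v : Hn n → ℂ} {p : Hn n} {a b a' b' : ℂ}
    (hu : HZ j u p a b) (hv : HZ j v p a' b') :
    HZ j (fun q => u q + v q) p (a + a') (b + b') := by
  obtain ⟨du, rfl, rfl⟩ := hu
  obtain ⟨dv, rfl, rfl⟩ := hv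
  refine ⟨du.add dv, ?_, ?_⟩
  · simp only [ZH, XH, YH, dirD, fderiv_fun_add du dv]; simp; ring
  · simp only [ZbarH, XH, YH, dirD, fderiv_fun_add du dv]; simp; ring

lemma HZ.const {n : ℕ} (j : Fin n) (c : ℂ) (p : Hn n) : HZ j (fun _ => c) p 0 0 := by
  refine ⟨differentiableAt_const _, ?_, ?_⟩
  · simp [ZH, XH, YH, dirD]
  · simp [ZbarH, XH, YH, dirD]

lemma HZ.cong {n : ℕ} {j : Fin n} {u v : Hn n → ℂ} {p : Hn n} {a b a' b' : ℂ}
    (hu : HZ j u p a b) (h : v = u) (ha : a = a') (hb : b = b') : HZ j v p a' b' := by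
  subst h ha hb; exact hu

lemma HZ.pow {n : ℕ} {j : Fin n} {u : Hn n → ℂ} {p : Hn n} {a b : ℂ}
    (hu : HZ j u p a b) (m : ℕ) :
    HZ j (fun q => u q ^ (m + 1)) p ((m + 1) * u p ^ m * a) ((m + 1) * u p ^ m * b) := by
  induction m with
  | zero => exact hu.cong (by funext; simp) (by simp) (by simp)
  | succ m ih =>
    refine (ih.mul hu).cong (by funext; ring) ?_ ?_ <;> (push_cast; ring)

/-- chain rule with a scalar function whose real derivative acts by complex multiplication -/
lemma HZ.chain {n : ℕ} {j : Fin n} {u w : Hn n → ℂ} {p : Hn n} {a b d : ℂ}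
    (hu : HZ j u p a b) (hw : DifferentiableAt ℝ w p)
    (h : ∀ v, fderiv ℝ w p v = d * fderiv ℝ u p v) : HZ j w p (d * a) (d * b) := by
  obtain ⟨du, rfl, rfl⟩ := hu
  refine ⟨hw, ?_, ?_⟩
  · simp only [ZH, XH, YH, dirD, h]; ring
  · simp only [ZbarH, XH, YH, dirD, h]; ring

lemma HZ.inv {n : ℕ} {j : Fin n} {u : Hn n → ℂ} {p : Hn n} {a b : ℂ}
    (hu : HZ j u p a b) (h0 : u p ≠ 0) :
    HZ j (fun q => (u q)⁻¹) p (-((u p)⁻¹ ^ 2) * a) (-((u p)⁻¹ ^ 2) * b) := by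
  have h := (hasDerivAt_inv h0).hasFDerivAt.restrictScalars ℝ |>.comp p hu.1.hasFDerivAt
  refine hu.chain h.differentiableAt fun v => ?_
  have h' : fderiv ℝ (fun q => (u q)⁻¹) p = _ := h.fderiv
  rw [h']
  simp; ring

lemma HZ.hcomp {n : ℕ} {j : Fin n} {N : Hn n → ℝ} {h : ℝ → ℂ} {p : Hn n} {a b : ℂ}
    (hN : DifferentiableAt ℝ N p) (hu : HZ j (fun q => ((N q : ℝ) : ℂ)) p a b)
    (hh : DifferentiableAt ℝ h (N p)) :
    HZ j (fun q => h (N q)) p (deriv h (N p) * a) (deriv h (N p) * b) := by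
  have h1 := hh.hasDerivAt.hasFDerivAt.comp p hN.hasFDerivAt
  have h2 : HasFDerivAt (fun q => ((N q : ℝ) : ℂ)) (Complex.ofRealCLM.comp (fderiv ℝ N p)) p :=
    Complex.ofRealCLM.hasFDerivAt.comp p hN.hasFDerivAt
  refine hu.chain h1.differentiableAt fun v => ?_
  have h' : fderiv ℝ (fun q => h (N q)) p = _ := h1.fderiv
  rw [h', h2.fderiv]
  simp; ring

lemma HZ.sum {n : ℕ} {j : Fin n} {ι : Type} (s : Finset ι) {u : ι → Hn n → ℂ} {p : Hn n}
    {a b : ι → ℂ} (hu : ∀ i, HZ j (u i) p (a i) (b i)) :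
    HZ j (fun q => ∑ i ∈ s, u i q) p (∑ i ∈ s, a i) (∑ i ∈ s, b i) := by
  classical
  induction s using Finset.induction_on with
  | empty => simpa using HZ.const j 0 p
  | insert i s hi ih =>
    refine ((hu i).add ih).cong ?_ ?_ ?_
    · funext q; rw [Finset.sum_insert hi]
    · rw [Finset.sum_insert hi]
    · rw [Finset.sum_insert hi]

lemma HZ.lin {n : ℕ} (j : Fin n) (l : Hn n →L[ℝ] ℂ) (p : Hn n) :
    HZ j l p ((1/2) * (l (eX n j) + cX j p * l (eT n)
        - Complex.I * (l (eY n j) + cY j p * l (eT n))))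
      ((1/2) * (l (eX n j) + cX j p * l (eT n)
        + Complex.I * (l (eY n j) + cY j p * l (eT n)))) := by
  refine ⟨l.differentiableAt, ?_, ?_⟩
  · simp only [ZH, XH_eq_vf, YH_eq_vf, vf, l.fderiv]
  · simp only [ZbarH, XH_eq_vf, YH_eq_vf, vf, l.fderiv]

def zL {n : ℕ} (k : Fin n) : Hn n →L[ℝ] ℂ :=
  (ContinuousLinearMap.proj (R := ℝ) (φ := fun _ : Fin n => ℂ) k).comp
    (ContinuousLinearMap.fst ℝ _ _)

lemma HZ.z {n : ℕ} (j k : Fin n) (p : Hn n) :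
    HZ j (fun q => q.1 k) p (if k = j then 1 else 0) 0 := by
  refine (HZ.lin j (zL k) p).cong rfl ?_ ?_
  · simp only [zL, eX, eY, eT, cX, cY]
    by_cases h : k = j
    · simp [h]; norm_num
    · simp [h]
  · simp only [zL, eX, eY, eT, cX, cY]
    by_cases h : k = j <;> simp [h]

lemma HZ.zb {n : ℕ} (j k : Fin n) (p : Hn n) :
    HZ j (fun q => (starRingEnd ℂ) (q.1 k)) p 0 (if k = j then 1 else 0) := by
  refine (HZ.lin j ((Complex.conjCLE : ℂ →L[ℝ] ℂ).comp (zL k)) p).cong rfl ?_ ?_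
  · simp only [zL, eX, eY, eT, cX, cY]
    by_cases h : k = j <;> simp [h]
  · simp only [zL, eX, eY, eT, cX, cY]
    by_cases h : k = j
    · simp [h]; norm_num
    · simp [h]

lemma HZ.t {n : ℕ} (j : Fin n) (p : Hn n) :
    HZ j (fun q => ((q.2 : ℝ) : ℂ)) p (Complex.I * (starRingEnd ℂ) (p.1 j))
      (-(Complex.I * p.1 j)) := by
  have e1 : (starRingEnd ℂ) (p.1 j) = (p.1 j).re - Complex.I * (p.1 j).im := by
    apply Complex.ext <;> simp
  have e2 : (p.1 j) = (p.1 j).re + Complex.I * (p.1 j).im := by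
    apply Complex.ext <;> simp
  refine (HZ.lin j (Complex.ofRealCLM.comp tL) p).cong rfl ?_ ?_
  · rw [e1]
    simp [tL, eX, eY, eT, cX, cY]
    linear_combination ((p.1 j).im : ℂ) * Complex.I_sq
  · conv_rhs => rw [e2]
    simp [tL, eX, eY, eT, cX, cY]
    linear_combination ((p.1 j).im : ℂ) * Complex.I_sq

def SS {n : ℕ} (p : Hn n) : ℂ := ∑ i, p.1 i * (starRingEnd ℂ) (p.1 i)
def AA {n : ℕ} (p : Hn n) : ℂ := 1 + SS p + -Complex.I * ((p.2 : ℝ) : ℂ)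
def BB {n : ℕ} (p : Hn n) : ℂ := 1 + SS p + Complex.I * ((p.2 : ℝ) : ℂ)
def NN {n : ℕ} (p : Hn n) : ℝ := (1 + ∑ i, Complex.normSq (p.1 i)) ^ 2 + p.2 ^ 2

lemma HZ.S {n : ℕ} (j : Fin n) (p : Hn n) : HZ j SS p ((starRingEnd ℂ) (p.1 j)) (p.1 j) := by
  refine (HZ.sum Finset.univ (fun i => (HZ.z j i p).mul (HZ.zb j i p))).cong rfl ?_ ?_
  · simp
  · simp

lemma HZ.A {n : ℕ} (j : Fin n) (p : Hn n) : HZ j AA p (2 * (starRingEnd ℂ) (p.1 j)) 0 := by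
  refine (((HZ.const j 1 p).add (HZ.S j p)).add
    ((HZ.const j (-Complex.I) p).mul (HZ.t j p))).cong rfl ?_ ?_
  · linear_combination (-(starRingEnd ℂ) (p.1 j)) * Complex.I_sq
  · linear_combination (p.1 j) * Complex.I_sq

lemma HZ.B {n : ℕ} (j : Fin n) (p : Hn n) : HZ j BB p 0 (2 * (p.1 j)) := by
  refine (((HZ.const j 1 p).add (HZ.S j p)).add
    ((HZ.const j (Complex.I) p).mul (HZ.t j p))).cong rfl ?_ ?_
  · linear_combination ((starRingEnd ℂ) (p.1 j)) * Complex.I_sq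
  · linear_combination (-p.1 j) * Complex.I_sq

lemma SS_eq {n : ℕ} (p : Hn n) : SS p = ((∑ i, Complex.normSq (p.1 i) : ℝ) : ℂ) := by
  simp [SS, Complex.mul_conj]

lemma NN_eq {n : ℕ} (p : Hn n) : ((NN p : ℝ) : ℂ) = AA p * BB p := by
  rw [AA, BB, SS_eq, NN]; push_cast
  linear_combination ((p.2 : ℂ) ^ 2) * Complex.I_sq

lemma NN_ge {n : ℕ} (p : Hn n) : 1 ≤ NN p := by
  have : 0 ≤ ∑ i, Complex.normSq (p.1 i) := Finset.sum_nonneg fun i _ => Complex.normSq_nonneg _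
  rw [NN]; nlinarith [sq_nonneg p.2]

lemma AA_ne {n : ℕ} (p : Hn n) : AA p ≠ 0 := by
  intro h
  have := NN_eq p
  rw [h, zero_mul] at this
  have h1 := NN_ge p
  have : NN p = 0 := by exact_mod_cast this
  linarith
lemma BB_ne {n : ℕ} (p : Hn n) : BB p ≠ 0 := by
  intro h
  have := NN_eq p
  rw [h, mul_zero] at this
  have h1 := NN_ge p
  have : NN p = 0 := by exact_mod_cast this
  linarith

lemma cd_normSq {n : ℕ} (i : Fin n) :
    ContDiff ℝ (⊤ : ℕ∞) (fun p : Hn n => Complex.normSq (p.1 i)) := by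
  simp only [Complex.normSq_apply]
  have h1 : ContDiff ℝ (⊤ : ℕ∞) (fun p : Hn n => (p.1 i).re) := (reL i).contDiff
  have h2 : ContDiff ℝ (⊤ : ℕ∞) (fun p : Hn n => (p.1 i).im) := (imL i).contDiff
  exact (h1.mul h1).add (h2.mul h2)
lemma cd_NN {n : ℕ} : ContDiff ℝ (⊤ : ℕ∞) (NN : Hn n → ℝ) :=
  ((contDiff_const.add (ContDiff.sum fun i _ => cd_normSq i)).pow 2).add (contDiff_snd.pow 2)
lemma cd_SS {n : ℕ} : ContDiff ℝ (⊤ : ℕ∞) (SS : Hn n → ℂ) := by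
  have : (SS : Hn n → ℂ) = fun p => ((∑ i, Complex.normSq (p.1 i) : ℝ) : ℂ) := funext SS_eq
  rw [this]
  have h : ContDiff ℝ (⊤ : ℕ∞) (fun p : Hn n => ∑ i, Complex.normSq (p.1 i)) :=
    ContDiff.sum fun i _ => cd_normSq i
  exact Complex.ofRealCLM.contDiff.comp h
lemma cd_T {n : ℕ} : ContDiff ℝ (⊤ : ℕ∞) (fun p : Hn n => ((p.2 : ℝ) : ℂ)) :=
  Complex.ofRealCLM.contDiff.comp contDiff_snd
lemma cd_AA {n : ℕ} : ContDiff ℝ (⊤ : ℕ∞) (AA : Hn n → ℂ) :=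
  (contDiff_const.add cd_SS).add (contDiff_const.mul cd_T)
lemma cd_BB {n : ℕ} : ContDiff ℝ (⊤ : ℕ∞) (BB : Hn n → ℂ) :=
  (contDiff_const.add cd_SS).add (contDiff_const.mul cd_T)

lemma HZ.Ai {n : ℕ} (j : Fin n) (p : Hn n) :
    HZ j (fun q => (AA q)⁻¹) p (-(2 * (starRingEnd ℂ) (p.1 j) * (AA p)⁻¹ ^ 2)) 0 :=
  ((HZ.A j p).inv (AA_ne p)).cong rfl (by ring) (by ring)

lemma HZ.Bi {n : ℕ} (j : Fin n) (p : Hn n) (m : ℕ) :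
    HZ j (fun q => (BB q)⁻¹ ^ m) p 0 (-(2 * m * p.1 j * (BB p)⁻¹ ^ (m + 1))) := by
  cases m with
  | zero => exact (HZ.const j 1 p).cong (by funext; simp) rfl (by simp)
  | succ m =>
    exact (((HZ.B j p).inv (BB_ne p)).pow m).cong rfl (by ring) (by push_cast; ring)

lemma HZ.g {n : ℕ} (j : Fin n) (p : Hn n) {g : ℝ → ℂ} (hg : ContDiff ℝ (⊤ : ℕ∞) g) :
    HZ j (fun q => g (NN q)) p (deriv g (NN p) * (2 * (starRingEnd ℂ) (p.1 j) * BB p))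
      (deriv g (NN p) * (2 * p.1 j * AA p)) := by
  have h : HZ j (fun q => ((NN q : ℝ) : ℂ)) p (2 * (starRingEnd ℂ) (p.1 j) * BB p)
      (2 * p.1 j * AA p) :=
    ((HZ.A j p).mul (HZ.B j p)).cong (funext NN_eq) (by ring) (by ring)
  exact HZ.hcomp (cd_NN.differentiable (by simp) p) h (hg.differentiable (by simp) _)

def phi {n : ℕ} (k : Fin n) (g : ℝ → ℂ) (p : Hn n) : ℂ :=
  p.1 k * ((AA p)⁻¹ * ((BB p)⁻¹ ^ n * g (NN p)))

lemma cd_phi {n : ℕ} (k : Fin n) {g : ℝ → ℂ} (hg : ContDiff ℝ (⊤ : ℕ∞) g) :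
    ContDiff ℝ (⊤ : ℕ∞) (phi k g : Hn n → ℂ) :=
  (cd_comp k).mul ((cd_AA.inv AA_ne).mul (((cd_BB.inv BB_ne).pow n).mul (hg.comp cd_NN)))

lemma Z_phi {n : ℕ} (j k : Fin n) {g : ℝ → ℂ} (hg : ContDiff ℝ (⊤ : ℕ∞) g) :
    ZH n j (phi k g) = fun p =>
      (if k = j then 1 else 0) * ((AA p)⁻¹ * ((BB p)⁻¹ ^ n * g (NN p)))
      + ((-2) * ((starRingEnd ℂ) (p.1 j) * (p.1 k * ((AA p)⁻¹ ^ (1 + 1) * ((BB p)⁻¹ ^ n * g (NN p)))))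
      + 2 * ((starRingEnd ℂ) (p.1 j) * (p.1 k * ((AA p)⁻¹ * (BB p * ((BB p)⁻¹ ^ n * deriv g (NN p))))))) := by
  funext p
  have h := ((HZ.z j k p).mul ((HZ.Ai j p).mul ((HZ.Bi j p n).mul (HZ.g j p hg)))).2.1
  refine Eq.trans h ?_
  ring

lemma ZZ_phi {n : ℕ} (j k : Fin n) {g : ℝ → ℂ} (hg : ContDiff ℝ (⊤ : ℕ∞) g) (p : Hn n) :
    ZbarH n j (ZH n j (phi k g)) p =
      (if k = j then 1 else 0) * (p.1 j * (-(2 * n) * (AA p)⁻¹ * (BB p)⁻¹ ^ (n + 1) * g (NN p)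
          + 2 * (BB p)⁻¹ ^ n * deriv g (NN p)))
      + p.1 k * (-2 * (AA p)⁻¹ ^ 2 * (BB p)⁻¹ ^ n * g (NN p)
          + 2 * (AA p)⁻¹ * BB p * (BB p)⁻¹ ^ n * deriv g (NN p))
      + (p.1 j * (starRingEnd ℂ) (p.1 j)) * (p.1 k * (
          4 * n * (AA p)⁻¹ ^ 2 * (BB p)⁻¹ ^ (n + 1) * g (NN p)
          + (-4 * n) * (AA p)⁻¹ * (BB p)⁻¹ ^ n * deriv g (NN p)
          + 4 * BB p * (BB p)⁻¹ ^ n * deriv (deriv g) (NN p))) := by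
  have hg' : ContDiff ℝ (⊤ : ℕ∞) (deriv g) := by
    have := hg.iterate_deriv 1
    simpa using this
  rw [Z_phi j k hg]
  have h := (((HZ.const j (if k = j then 1 else 0) p).mul
      ((HZ.Ai j p).mul ((HZ.Bi j p n).mul (HZ.g j p hg)))).add
    (((HZ.const j (-2) p).mul ((HZ.zb j j p).mul ((HZ.z j k p).mul
      (((HZ.Ai j p).pow 1).mul ((HZ.Bi j p n).mul (HZ.g j p hg)))))).add
     ((HZ.const j 2 p).mul ((HZ.zb j j p).mul ((HZ.z j k p).mul
      ((HZ.Ai j p).mul ((HZ.B j p).mul ((HZ.Bi j p n).mul (HZ.g j p hg'))))))))).2.2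
  refine Eq.trans h ?_
  have hA := AA_ne p
  have hB := BB_ne p
  have hA' : (AA p)⁻¹ * AA p = 1 := inv_mul_cancel₀ hA
  have hB' : (BB p)⁻¹ * BB p = 1 := inv_mul_cancel₀ hB
  simp only [if_true]
  generalize (AA p)⁻¹ = a at *
  generalize (BB p)⁻¹ = b at *
  generalize (if k = j then (1:ℂ) else 0) = d
  generalize g (NN p) = g0
  generalize deriv g (NN p) = g1
  generalize deriv (deriv g) (NN p) = g2
  generalize (starRingEnd ℂ) (p.1 j) = zb
  generalize p.1 j = z
  generalize p.1 k = zk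
  generalize AA p = A at *
  generalize BB p = B at *
  linear_combination (d * 2 * z * b ^ n * g1 - 4 * z * zb * zk * a * b ^ n * g1
    + 4 * z * zb * zk * B * b ^ n * g2) * hA' + (-4 * n * zb * z * zk * a * b ^ n * g1) * hB'

lemma LH_phi {n : ℕ} (k : Fin n) {g : ℝ → ℂ} (hg : ContDiff ℝ (⊤ : ℕ∞) g) (p : Hn n) :
    LH n (-(n : ℝ)) (phi k g) p =
      p.1 k * (4 * n * (AA p)⁻¹ ^ 2 * (BB p)⁻¹ ^ (n + 1) * g (NN p)
        + (-2 * (BB p)⁻¹ ^ n - 2 * n * (AA p)⁻¹ * BB p * (BB p)⁻¹ ^ n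
            + 4 * n * SS p * (AA p)⁻¹ * (BB p)⁻¹ ^ n) * deriv g (NN p)
        - 4 * SS p * BB p * (BB p)⁻¹ ^ n * deriv (deriv g) (NN p)) := by
  rw [LH_eq_Z (cd_phi k hg)]
  simp_rw [ZZ_phi _ k hg]
  rw [Finset.sum_add_distrib, Finset.sum_add_distrib,
    ← Finset.sum_mul Finset.univ (fun i => p.1 i * (starRingEnd ℂ) (p.1 i))]
  have hS : ∑ i, p.1 i * (starRingEnd ℂ) (p.1 i) = SS p := rfl
  rw [hS]
  have hA' : (AA p)⁻¹ * AA p = 1 := inv_mul_cancel₀ (AA_ne p)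
  have hB' : (BB p)⁻¹ * BB p = 1 := inv_mul_cancel₀ (BB_ne p)
  have hAB : AA p + BB p = 2 + 2 * SS p := by simp only [AA, BB]; ring
  simp only [ite_mul, one_mul, zero_mul, Finset.sum_ite_eq, Finset.mem_univ, if_true,
    Finset.sum_const, Finset.card_univ, Fintype.card_fin, nsmul_eq_mul]
  have hS2 : SS p = (AA p + BB p - 2) / 2 := by rw [hAB]; ring
  rw [hS2]
  generalize (AA p)⁻¹ = a at *
  generalize (BB p)⁻¹ = b at *
  generalize g (NN p) = g0
  generalize deriv g (NN p) = g1
  generalize deriv (deriv g) (NN p) = g2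
  generalize p.1 k = zk
  generalize AA p = A at *
  generalize BB p = B at *
  linear_combination (zk * b ^ n * a * (-2 * n) * b * g0) * hA' + (zk * b ^ n * a ^2 * (-2 * n) * g0) * hB'

lemma BB_conj {n : ℕ} (p : Hn n) : BB p = (starRingEnd ℂ) (AA p) := by
  rw [AA, BB, SS_eq]; simp
lemma norm_BB {n : ℕ} (p : Hn n) : ‖BB p‖ = ‖AA p‖ := by
  rw [BB_conj, Complex.norm_conj]
lemma W_sq {n : ℕ} (p : Hn n) : ‖AA p‖ ^ 2 = NN p := by
  have h := congrArg norm (NN_eq p)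
  rw [norm_mul, norm_BB, Complex.norm_real, Real.norm_of_nonneg (by linarith [NN_ge p])] at h
  rw [h]; ring
lemma W_re {n : ℕ} (p : Hn n) : (AA p).re = 1 + ∑ i, ‖p.1 i‖ ^ 2 := by
  rw [AA, SS_eq]; simp only [Complex.normSq_eq_norm_sq, Complex.sub_re, Complex.add_re, Complex.one_re, Complex.ofReal_re]; simp
lemma W_ge_sum {n : ℕ} (p : Hn n) : 1 + ∑ i, ‖p.1 i‖ ^ 2 ≤ ‖AA p‖ := by
  rw [← W_re]; exact Complex.re_le_norm _
lemma W_ge {n : ℕ} (p : Hn n) (i : Fin n) : 1 + ‖p.1 i‖ ^ 2 ≤ ‖AA p‖ := by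
  have := Finset.single_le_sum (f := fun i => ‖p.1 i‖ ^ 2) (fun i _ => sq_nonneg _)
    (Finset.mem_univ i)
  have h2 := W_ge_sum p
  linarith
lemma W_ge_one {n : ℕ} (p : Hn n) : 1 ≤ ‖AA p‖ := by
  have : 0 ≤ ∑ i, ‖p.1 i‖ ^ 2 := Finset.sum_nonneg fun i _ => sq_nonneg _
  linarith [W_ge_sum p]
lemma W_ge_t {n : ℕ} (p : Hn n) : |p.2| ≤ ‖AA p‖ := by
  have h : (AA p).im = - p.2 := by rw [AA, SS_eq]; simp
  have := Complex.abs_im_le_norm (AA p)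
  rwa [h, abs_neg] at this
lemma W_ge_S {n : ℕ} (p : Hn n) : ‖SS p‖ ≤ ‖AA p‖ := by
  have h0 : 0 ≤ ∑ i, ‖p.1 i‖ ^ 2 := Finset.sum_nonneg fun i _ => sq_nonneg _
  rw [SS_eq, Complex.norm_real]
  simp only [Complex.normSq_eq_norm_sq]
  rw [Real.norm_of_nonneg h0]
  linarith [W_ge_sum p]
lemma W_ge_norm1 {n : ℕ} (p : Hn n) : 1 + ‖p.1‖ ^ 2 ≤ ‖AA p‖ := by
  have h1 := W_ge_one p
  have : ‖p.1‖ ≤ Real.sqrt (‖AA p‖ - 1) := by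
    rw [pi_norm_le_iff_of_nonneg (Real.sqrt_nonneg _)]
    intro i
    apply Real.le_sqrt_of_sq_le
    linarith [W_ge p i]
  have h2 : ‖p.1‖ ^ 2 ≤ Real.sqrt (‖AA p‖ - 1) ^ 2 := by gcongr
  rw [Real.sq_sqrt (by linarith)] at h2
  linarith
lemma W_ge_norm {n : ℕ} (p : Hn n) : ‖p‖ ≤ ‖AA p‖ := by
  rw [Prod.norm_def]
  refine max_le ?_ (W_ge_t p)
  nlinarith [W_ge_norm1 p, sq_nonneg (‖p.1‖ - 1/2)]

def G0 {n : ℕ} (k : Fin n) (p : Hn n) : ℝ := ‖p.1 k‖ * ‖AA p‖⁻¹ ^ (n + 2)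

lemma cont_AA {n : ℕ} : Continuous (AA : Hn n → ℂ) := cd_AA.continuous
lemma cont_BB {n : ℕ} : Continuous (BB : Hn n → ℂ) := cd_BB.continuous
lemma cont_z {n : ℕ} (k : Fin n) : Continuous (fun p : Hn n => p.1 k) := (cd_comp k).continuous

lemma cont_G0 {n : ℕ} (k : Fin n) : Continuous (G0 k : Hn n → ℝ) :=
  (cont_z k).norm.mul ((cont_AA.norm.inv₀ fun p => by simpa using AA_ne p).pow _)

lemma int_G0 {n : ℕ} (k : Fin n) : Integrable (G0 k : Hn n → ℝ) := by
  have h : (volume : Measure (Fin n → ℂ)).IsAddHaarMeasure := by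
    rw [volume_pi]; infer_instance
  have i1 : Integrable (fun z : Fin n → ℂ => ((1 : ℝ) + ‖z‖ ^ 2) ^ (-(2 * n + 1/2 : ℝ) / 2)) := by
    apply integrable_rpow_neg_one_add_norm_sq
    simp [Module.finrank_pi_fintype]
    linarith
  have i2 : Integrable (fun t : ℝ => (1 + ‖t‖) ^ (-(5/4 : ℝ))) := by
    apply integrable_one_add_norm
    simp; norm_num
  have i3 := (i1.mul_prod i2).const_mul ((2 : ℝ) ^ (5/4 : ℝ))
  rw [← Measure.volume_eq_prod] at i3
  refine i3.mono' (cont_G0 k).aestronglyMeasurable (Eventually.of_forall fun p => ?_)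
  have hW := W_ge_one p
  have hW0 : 0 < ‖AA p‖ := by linarith
  have hnn : 0 ≤ G0 k p := by unfold G0; positivity
  rw [Real.norm_of_nonneg hnn]
  have b1 : ‖AA p‖ ^ (-(2 * n + 1/2 : ℝ) / 2) ≤ ((1 : ℝ) + ‖p.1‖ ^ 2) ^ (-(2 * n + 1/2 : ℝ) / 2) := by
    apply Real.rpow_le_rpow_of_nonpos (by positivity) (W_ge_norm1 p)
    have : (0 : ℝ) ≤ n := by positivity
    linarith
  have b2 : (2 * ‖AA p‖) ^ (-(5/4 : ℝ)) ≤ (1 + ‖p.2‖) ^ (-(5/4 : ℝ)) := by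
    apply Real.rpow_le_rpow_of_nonpos (by positivity) _ (by norm_num)
    rw [Real.norm_eq_abs]; linarith [W_ge_t p]
  have b3 : ‖p.1 k‖ ≤ ‖AA p‖ ^ (1/2 : ℝ) := by
    rw [← Real.sqrt_eq_rpow]
    apply Real.le_sqrt_of_sq_le
    linarith [W_ge p k]
  calc G0 k p ≤ ‖AA p‖ ^ (1/2 : ℝ) * ‖AA p‖ ^ (-((n + 2 : ℕ) : ℝ)) := by
        rw [Real.rpow_neg hW0.le, Real.rpow_natCast, ← inv_pow]
        unfold G0; gcongr
    _ = 2 ^ (5/4 : ℝ) * (‖AA p‖ ^ (-(2 * n + 1/2 : ℝ) / 2) * (2 * ‖AA p‖) ^ (-(5/4 : ℝ))) := by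
        rw [Real.mul_rpow (by norm_num) hW0.le, Real.rpow_neg (by norm_num : (0 : ℝ) ≤ 2)]
        have : (2 : ℝ) ^ (5/4 : ℝ) ≠ 0 := by positivity
        field_simp
        rw [← Real.rpow_add hW0, ← Real.rpow_add hW0]
        congr 1
        push_cast; ring
    _ ≤ _ := by gcongr

lemma cutoff_exists : ∃ h : ℝ → ℂ, ContDiff ℝ (⊤ : ℕ∞) h ∧ HasCompactSupport h ∧ h 0 = 1 := by
  let b : ContDiffBump (0 : ℝ) := ⟨1, 2, by norm_num, by norm_num⟩
  refine ⟨fun s => ((b s : ℝ) : ℂ), Complex.ofRealCLM.contDiff.comp b.contDiff, ?_, ?_⟩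
  · exact b.hasCompactSupport.comp_left (g := fun x : ℝ => (x : ℂ)) (by simp)
  · have : b 0 = 1 := b.one_of_mem_closedBall (by simp [b])
    simp [this]

lemma cd_deriv {g : ℝ → ℂ} (hg : ContDiff ℝ (⊤ : ℕ∞) g) : ContDiff ℝ (⊤ : ℕ∞) (deriv g) := by
  simpa using hg.iterate_deriv 1

lemma cd_LH {n : ℕ} (α : ℝ) {f : Hn n → ℂ} (hf : ContDiff ℝ (⊤ : ℕ∞) f) :
    ContDiff ℝ (⊤ : ℕ∞) (LH n α f) := by
  have : LH n α f = fun p => -(1/4) * ∑ j, (XH n j (XH n j f) p + YH n j (YH n j f) p)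
    + Complex.I * (α : ℂ) * TH n f p := rfl
  rw [this]
  exact (contDiff_const.mul (ContDiff.sum fun j _ =>
    (cd_XH j (cd_XH j hf)).add (cd_YH j (cd_YH j hf)))).add (contDiff_const.mul (cd_dir _ hf))

def hR (h : ℝ → ℂ) (r : ℝ) (s : ℝ) : ℂ := h (r * s)

lemma deriv_hR {h : ℝ → ℂ} (hh : ContDiff ℝ (⊤ : ℕ∞) h) (r : ℝ) :
    deriv (hR h r) = fun s => (r : ℂ) * hR (deriv h) r s := by
  funext s
  have h1 : HasDerivAt h (deriv h (r * s)) (r * s) :=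
    (hh.differentiable (by simp) _).hasDerivAt
  have h2 : HasDerivAt (fun s : ℝ => r * s) r s := by simpa using (hasDerivAt_id s).const_mul r
  have := h1.scomp s h2
  have e : deriv (hR h r) s = _ := this.deriv
  rw [e]; simp [hR]

lemma cd_hR {h : ℝ → ℂ} (hh : ContDiff ℝ (⊤ : ℕ∞) h) (r : ℝ) : ContDiff ℝ (⊤ : ℕ∞) (hR h r) :=
  hh.comp (contDiff_const.mul contDiff_id)

lemma deriv2_hR {h : ℝ → ℂ} (hh : ContDiff ℝ (⊤ : ℕ∞) h) (r : ℝ) :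
    deriv (deriv (hR h r)) = fun s => (r : ℂ) ^ 2 * hR (deriv (deriv h)) r s := by
  rw [deriv_hR hh]
  funext s
  rw [deriv_const_mul _ ((cd_hR (cd_deriv hh) r).differentiable (by simp) s),
    deriv_hR (cd_deriv hh)]
  ring

lemma hcs_phi {n : ℕ} (k : Fin n) {h : ℝ → ℂ} (hc : HasCompactSupport h) {r : ℝ} (hr : 0 < r) :
    HasCompactSupport (phi k (hR h r) : Hn n → ℂ) := by
  obtain ⟨M, hM⟩ := hc.isBounded.subset_closedBall 0
  apply HasCompactSupport.intro (isCompact_closedBall (0 : Hn n) (M / r))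
  intro p hp
  have hp' : M / r < ‖p‖ := by simpa using hp
  have h1 := W_ge_norm p
  have h2 := W_ge_one p
  have h3 := W_sq p
  have h4 : M < r * NN p := by
    rw [div_lt_iff₀ hr] at hp'
    have h5 : ‖p‖ ≤ NN p := by nlinarith
    nlinarith [mul_le_mul_of_nonneg_right h5 hr.le]
  have : h (r * NN p) = 0 := by
    by_contra hne
    have := hM (subset_tsupport _ hne)
    rw [mem_closedBall_zero_iff] at this
    have := le_trans (le_abs_self _) this
    linarith
  simp [phi, hR, this]

lemma bound_LH {n : ℕ} (k : Fin n) {h : ℝ → ℂ} (hh : ContDiff ℝ (⊤ : ℕ∞) h)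
    (hc : HasCompactSupport h) :
    ∃ C : ℝ, 0 ≤ C ∧ ∀ r : ℝ, 0 < r → ∀ p : Hn n,
      ‖LH n (-(n : ℝ)) (phi k (hR h r)) p‖ ≤ C * G0 k p := by
  obtain ⟨C0, hC0⟩ := hh.continuous.bounded_above_of_compact_support hc
  have hh1 := cd_deriv hh
  have hh2 := cd_deriv hh1
  have hc1 : HasCompactSupport (deriv h) := hc.deriv
  have hc2 : HasCompactSupport (deriv (deriv h)) := hc1.deriv
  obtain ⟨C1, hC1⟩ := (Complex.continuous_ofReal.mul hh1.continuous).bounded_above_of_compact_support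
    (hc1.mul_left)
  obtain ⟨C2, hC2⟩ := ((Complex.continuous_ofReal.pow 2).mul
    hh2.continuous).bounded_above_of_compact_support (hc2.mul_left)
  have n0 : 0 ≤ C0 := le_trans (norm_nonneg _) (hC0 0)
  have n1 : 0 ≤ C1 := le_trans (norm_nonneg _) (hC1 0)
  have n2 : 0 ≤ C2 := le_trans (norm_nonneg _) (hC2 0)
  refine ⟨4 * n * C0 + (2 + 6 * n) * C1 + 4 * C2, by positivity, fun r hr p => ?_⟩
  rw [LH_phi k (cd_hR hh r), deriv2_hR hh, deriv_hR hh]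
  beta_reduce
  have hW := W_ge_one p
  have hW0 : 0 < ‖AA p‖ := by linarith
  have g0 : ‖hR h r (NN p)‖ ≤ C0 := hC0 _
  have g1 : ‖(r : ℂ) * hR (deriv h) r (NN p)‖ ≤ C1 * ‖AA p‖⁻¹ ^ 2 := by
    have : ‖((r * NN p : ℝ) : ℂ) * deriv h (r * NN p)‖ ≤ C1 := hC1 _
    simp only [Complex.ofReal_mul, norm_mul, Complex.norm_real] at this
    rw [Real.norm_of_nonneg (by linarith [NN_ge p] : 0 ≤ NN p), ← W_sq] at this
    rw [inv_pow, ← div_eq_mul_inv, le_div_iff₀ (by positivity), norm_mul, Complex.norm_real]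
    calc _ = _ := by simp only [hR, ← W_sq]; ring
      _ ≤ _ := this
  have g2 : ‖(r : ℂ) ^ 2 * hR (deriv (deriv h)) r (NN p)‖ ≤ C2 * ‖AA p‖⁻¹ ^ 4 := by
    have : ‖((r * NN p : ℝ) : ℂ) ^ 2 * deriv (deriv h) (r * NN p)‖ ≤ C2 := hC2 _
    simp only [Complex.ofReal_mul, norm_mul, norm_pow, Complex.norm_real] at this
    rw [Real.norm_of_nonneg (by linarith [NN_ge p] : 0 ≤ NN p), ← W_sq] at this
    rw [inv_pow, ← div_eq_mul_inv, le_div_iff₀ (by positivity), norm_mul, norm_pow,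
      Complex.norm_real]
    calc _ = _ := by simp only [hR, ← W_sq]; ring
      _ ≤ _ := this
  generalize hR h r (NN p) = x0 at *
  generalize (r : ℂ) * hR (deriv h) r (NN p) = x1 at *
  generalize (r : ℂ) ^ 2 * hR (deriv (deriv h)) r (NN p) = x2 at *
  have hS := W_ge_S p
  have t0 : ‖4 * n * (AA p)⁻¹ ^ 2 * (BB p)⁻¹ ^ (n + 1) * x0‖ ≤ 4 * n * C0 * ‖AA p‖⁻¹ ^ (n + 2) := by
    simp only [norm_mul, norm_pow, norm_inv, norm_BB, Complex.norm_natCast]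
    rw [show ‖(4 : ℂ)‖ = 4 by simp]
    have hi : ‖AA p‖⁻¹ ≤ 1 := inv_le_one_of_one_le₀ hW
    calc 4 * (n : ℝ) * ‖AA p‖⁻¹ ^ 2 * ‖AA p‖⁻¹ ^ (n + 1) * ‖x0‖
        ≤ 4 * (n : ℝ) * (‖AA p‖⁻¹ * 1) * ‖AA p‖⁻¹ ^ (n + 1) * C0 := by
          rw [pow_two]; gcongr
      _ = _ := by ring
  have hcan : ‖AA p‖ * ‖AA p‖⁻¹ = 1 := mul_inv_cancel₀ hW0.ne'
  have t1 : ‖(-2 * (BB p)⁻¹ ^ n - 2 * n * (AA p)⁻¹ * BB p * (BB p)⁻¹ ^ n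
            + 4 * n * SS p * (AA p)⁻¹ * (BB p)⁻¹ ^ n) * x1‖
      ≤ (2 + 6 * n) * C1 * ‖AA p‖⁻¹ ^ (n + 2) := by
    rw [norm_mul]
    have : ‖-2 * (BB p)⁻¹ ^ n - 2 * n * (AA p)⁻¹ * BB p * (BB p)⁻¹ ^ n
            + 4 * n * SS p * (AA p)⁻¹ * (BB p)⁻¹ ^ n‖ ≤ (2 + 6 * n) * ‖AA p‖⁻¹ ^ n := by
      refine (norm_add_le _ _).trans ((add_le_add_left (norm_sub_le _ _) _).trans ?_)
      simp only [norm_mul, norm_pow, norm_inv, norm_BB, Complex.norm_natCast, norm_neg]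
      rw [show ‖(4 : ℂ)‖ = 4 by simp, show ‖(2 : ℂ)‖ = 2 by simp]
      calc _ ≤ 2 * ‖AA p‖⁻¹ ^ n + 2 * ↑n * ‖AA p‖⁻¹ * ‖AA p‖ * ‖AA p‖⁻¹ ^ n
            + 4 * ↑n * ‖AA p‖ * ‖AA p‖⁻¹ * ‖AA p‖⁻¹ ^ n := by gcongr
        _ = _ := by linear_combination (6 * n * ‖AA p‖⁻¹ ^ n) * hcan
    calc _ ≤ ((2 + 6 * n) * ‖AA p‖⁻¹ ^ n) * (C1 * ‖AA p‖⁻¹ ^ 2) := by gcongr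
      _ = _ := by ring
  have t2 : ‖4 * SS p * BB p * (BB p)⁻¹ ^ n * x2‖ ≤ 4 * C2 * ‖AA p‖⁻¹ ^ (n + 2) := by
    simp only [norm_mul, norm_pow, norm_inv, norm_BB]
    rw [show ‖(4 : ℂ)‖ = 4 by simp]
    calc _ ≤ 4 * ‖AA p‖ * ‖AA p‖ * ‖AA p‖⁻¹ ^ n * (C2 * ‖AA p‖⁻¹ ^ 4) := by gcongr
      _ = (‖AA p‖ * ‖AA p‖⁻¹) ^ 2 * (4 * C2 * ‖AA p‖⁻¹ ^ (n + 2)) := by ring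
      _ = _ := by rw [hcan]; ring
  rw [norm_mul]
  have := (norm_sub_le _ _).trans (add_le_add ((norm_add_le _ _).trans (add_le_add t0 t1)) t2)
  calc _ ≤ _ := mul_le_mul_of_nonneg_left this (norm_nonneg _)
    _ = _ := by unfold G0; ring

def KK {n : ℕ} (k : Fin n) (p : Hn n) : ℂ := p.1 k * ((AA p)⁻¹ ^ 2 * (BB p)⁻¹ ^ (n + 1))

lemma key {n : ℕ} (hn : 1 ≤ n) (k : Fin n) {f : Hn n → ℂ} (hf : ContDiff ℝ (⊤ : ℕ∞) f)
    {M : ℝ} (hM : ∀ p, ‖f p‖ ≤ M) (hL : ∀ p : Hn n, LH n (n : ℝ) f p = 0) :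
    ∫ p, f p * KK k p = 0 := by
  obtain ⟨h, hh, hc, h0⟩ := cutoff_exists
  obtain ⟨C, hC0, hC⟩ := bound_LH k hh hc
  let r : ℕ → ℝ := fun m => 1 / ((m : ℝ) + 1)
  have hr : ∀ m, 0 < r m := fun m => by positivity
  have hrt : Tendsto r atTop (𝓝 0) := tendsto_one_div_add_atTop_nhds_zero_nat
  have hz : ∀ m, ∫ p, f p * LH n (-(n : ℝ)) (phi k (hR h (r m))) p = 0 := by
    intro m
    rw [ibp_LH (n : ℝ) hf (cd_phi k (cd_hR hh _)) (hcs_phi k hc (hr m))]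
    simp [hL]
  have hM0 : 0 ≤ M := le_trans (norm_nonneg _) (hM 0)
  have hlim : Tendsto (fun m => ∫ p, f p * LH n (-(n : ℝ)) (phi k (hR h (r m))) p) atTop
      (𝓝 (∫ p, (4 * n : ℂ) * (f p * KK k p))) := by
    apply tendsto_integral_of_dominated_convergence (fun p => M * (C * G0 k p))
    · intro m
      exact (hf.continuous.mul (cd_LH _ (cd_phi k (cd_hR hh _))).continuous).aestronglyMeasurable
    · exact ((int_G0 k).const_mul C).const_mul M
    · intro m
      refine Eventually.of_forall fun p => ?_
      rw [norm_mul]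
      exact mul_le_mul (hM p) (hC _ (hr m) p) (norm_nonneg _) hM0
    · refine Eventually.of_forall fun p => ?_
      simp_rw [LH_phi k (cd_hR hh _), deriv2_hR hh, deriv_hR hh]
      have tt : ∀ {u : ℝ → ℂ}, Continuous u →
          Tendsto (fun m => hR u (r m) (NN p)) atTop (𝓝 (u 0)) := by
        intro u hu
        have : Tendsto (fun m => r m * NN p) atTop (𝓝 0) := by simpa using hrt.mul_const (NN p)
        exact (hu.tendsto 0).comp this
      have hrc : Tendsto (fun m => (r m : ℂ)) atTop (𝓝 0) := by
        have := (Complex.continuous_ofReal.tendsto 0).comp hrt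
        rw [Complex.ofReal_zero] at this; exact this
      have T0 := tt hh.continuous
      have T1 := hrc.mul (tt (cd_deriv hh).continuous)
      have T2 := (hrc.pow 2).mul (tt (cd_deriv (cd_deriv hh)).continuous)
      have := (((T0.const_mul (4 * n * (AA p)⁻¹ ^ 2 * (BB p)⁻¹ ^ (n + 1))).add
        (T1.const_mul (-2 * (BB p)⁻¹ ^ n - 2 * n * (AA p)⁻¹ * BB p * (BB p)⁻¹ ^ n
            + 4 * n * SS p * (AA p)⁻¹ * (BB p)⁻¹ ^ n))).sub
        (T2.const_mul (4 * SS p * BB p * (BB p)⁻¹ ^ n))).const_mul (p.1 k) |>.const_mul (f p)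
      convert this using 2
      rw [h0, KK]; ring
  simp_rw [hz] at hlim
  have h1 := tendsto_nhds_unique hlim tendsto_const_nhds
  rw [integral_const_mul] at h1
  have : (4 * n : ℂ) ≠ 0 := by
    have : (n : ℂ) ≠ 0 := by exact_mod_cast (by omega : n ≠ 0)
    simp [this]
  exact (mul_eq_zero.1 h1).resolve_left this

def wL {n : ℕ} (p : Hn n) : Hn n →L[ℝ] ℝ :=
  ∑ j, ((2 * (p.1 j).im) • reL j - (2 * (p.1 j).re) • imL j)

lemma wL_apply {n : ℕ} (p q : Hn n) :
    wL p q = ∑ j, (2 * (p.1 j).im * (q.1 j).re - 2 * (p.1 j).re * (q.1 j).im) := by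
  simp [wL, reL, imL]

def lS {n : ℕ} (p : Hn n) (s : ℝ) : Hn n →L[ℝ] Hn n :=
  (s • ContinuousLinearMap.fst ℝ _ _).prod
    (s ^ 2 • ContinuousLinearMap.snd ℝ _ _ + s • wL p)

lemma lS_apply {n : ℕ} (p : Hn n) (s : ℝ) (q : Hn n) :
    lS p s q = (s • q.1, s ^ 2 * q.2 + s * wL p q) := rfl

def tau {n : ℕ} (p : Hn n) (s : ℝ) (q : Hn n) : Hn n := p + lS p s q

lemma fd_tau {n : ℕ} {f : Hn n → ℂ} (hf : Differentiable ℝ f) (p : Hn n) (s : ℝ) (q v : Hn n) :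
    fderiv ℝ (fun q => f (tau p s q)) q v = fderiv ℝ f (tau p s q) (lS p s v) := by
  have h1 : HasFDerivAt (tau p s) (lS p s) q := (lS p s).hasFDerivAt.const_add p
  have := (hf (tau p s q)).hasFDerivAt.comp q h1
  have e : fderiv ℝ (fun q => f (tau p s q)) q = _ := this.fderiv
  rw [e]; rfl

lemma lS_T {n : ℕ} (p : Hn n) (s : ℝ) : lS p s (eT n) = (s ^ 2) • eT n := by
  rw [lS_apply, wL_apply]; simp [eT]

lemma wL_X {n : ℕ} (p : Hn n) (j : Fin n) : wL p (eX n j) = 2 * (p.1 j).im := by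
  rw [wL_apply, Finset.sum_eq_single j]
  · simp [eX]
  · intro i _ hi; simp [eX, hi]
  · simp
lemma wL_Y {n : ℕ} (p : Hn n) (j : Fin n) : wL p (eY n j) = -(2 * (p.1 j).re) := by
  rw [wL_apply, Finset.sum_eq_single j]
  · simp [eY]
  · intro i _ hi; simp [eY, hi]
  · simp

lemma lS_X {n : ℕ} (p : Hn n) (s : ℝ) (j : Fin n) :
    lS p s (eX n j) = s • eX n j + (s * (2 * (p.1 j).im)) • eT n := by
  rw [lS_apply, wL_X]; simp [eX, eT]
lemma lS_Y {n : ℕ} (p : Hn n) (s : ℝ) (j : Fin n) :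
    lS p s (eY n j) = s • eY n j + (s * (-(2 * (p.1 j).re))) • eT n := by
  rw [lS_apply, wL_Y]; simp [eY, eT]

lemma X_tau {n : ℕ} {f : Hn n → ℂ} (hf : Differentiable ℝ f) (p : Hn n) (s : ℝ) (j : Fin n)
    (q : Hn n) : XH n j (fun q => f (tau p s q)) q = s * XH n j f (tau p s q) := by
  simp only [XH, dirD, fd_tau hf, lS_X, lS_T, map_add, map_smul]
  simp [tau, lS_apply]; ring
lemma Y_tau {n : ℕ} {f : Hn n → ℂ} (hf : Differentiable ℝ f) (p : Hn n) (s : ℝ) (j : Fin n)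
    (q : Hn n) : YH n j (fun q => f (tau p s q)) q = s * YH n j f (tau p s q) := by
  simp only [YH, dirD, fd_tau hf, lS_Y, lS_T, map_add, map_smul]
  simp [tau, lS_apply]; ring
lemma T_tau {n : ℕ} {f : Hn n → ℂ} (hf : Differentiable ℝ f) (p : Hn n) (s : ℝ)
    (q : Hn n) : TH n (fun q => f (tau p s q)) q = s ^ 2 * TH n f (tau p s q) := by
  simp only [TH, dirD, fd_tau hf, lS_T, map_smul]
  simp

lemma cd_tau {n : ℕ} {f : Hn n → ℂ} (hf : ContDiff ℝ (⊤ : ℕ∞) f) (p : Hn n) (s : ℝ) :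
    ContDiff ℝ (⊤ : ℕ∞) (fun q => f (tau p s q)) :=
  hf.comp (contDiff_const.add (lS p s).contDiff)

lemma X_cmul {n : ℕ} (c : ℂ) {f : Hn n → ℂ} (hf : Differentiable ℝ f) (j : Fin n) (q : Hn n) :
    XH n j (fun q => c * f q) q = c * XH n j f q := by
  simp only [XH, dirD, fderiv_const_mul (hf q)]; simp; ring
lemma Y_cmul {n : ℕ} (c : ℂ) {f : Hn n → ℂ} (hf : Differentiable ℝ f) (j : Fin n) (q : Hn n) :
    YH n j (fun q => c * f q) q = c * YH n j f q := by
  simp only [YH, dirD, fderiv_const_mul (hf q)]; simp; ring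

lemma LH_tau {n : ℕ} {f : Hn n → ℂ} (hf : ContDiff ℝ (⊤ : ℕ∞) f) (α : ℝ) (p : Hn n) (s : ℝ)
    (q : Hn n) : LH n α (fun q => f (tau p s q)) q = s ^ 2 * LH n α f (tau p s q) := by
  have hd := hf.differentiable (by simp)
  have hX : ∀ j, XH n j (XH n j (fun q => f (tau p s q))) q = s ^ 2 * XH n j (XH n j f) (tau p s q) := by
    intro j
    have e : XH n j (fun q => f (tau p s q)) = fun q => (s : ℂ) * XH n j f (tau p s q) :=
      funext fun q => X_tau hd p s j q
    rw [e, X_cmul _ ((cd_tau (cd_XH j hf) p s).differentiable (by simp)),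
      X_tau ((cd_XH j hf).differentiable (by simp))]
    ring
  have hY : ∀ j, YH n j (YH n j (fun q => f (tau p s q))) q = s ^ 2 * YH n j (YH n j f) (tau p s q) := by
    intro j
    have e : YH n j (fun q => f (tau p s q)) = fun q => (s : ℂ) * YH n j f (tau p s q) :=
      funext fun q => Y_tau hd p s j q
    rw [e, Y_cmul _ ((cd_tau (cd_YH j hf) p s).differentiable (by simp)),
      Y_tau ((cd_YH j hf).differentiable (by simp))]
    ring
  simp only [LH, hX, hY, T_tau hd, ← mul_add, ← Finset.mul_sum]
  ring

lemma key2 {n : ℕ} (hn : 1 ≤ n) (k : Fin n) {f : Hn n → ℂ} (hf : ContDiff ℝ (⊤ : ℕ∞) f)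
    {M : ℝ} (hM : ∀ p, ‖f p‖ ≤ M) (hL : ∀ p : Hn n, LH n (n : ℝ) f p = 0) (p : Hn n) (s : ℝ) :
    ∫ q, (f (tau p s q) - f p) * KK k q = 0 := by
  have h := key hn k (f := fun q => f (tau p s q) - f p) ((cd_tau hf p s).sub contDiff_const)
    (M := M + M) (fun q => (norm_sub_le _ _).trans (add_le_add (hM _) (hM _)))
  apply h
  intro q
  have e : ∀ c : ℂ, (fun q => f (tau p s q) - c) = fun q => (fun r => f r - c) (tau p s q) := fun c => rfl
  have hz : ∀ r, LH n n (fun r => f r - f p) r = LH n n f r := by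
    intro r
    have hX : ∀ j, XH n j (fun r => f r - f p) = XH n j f := fun j => by
      funext x; simp only [XH, dirD, fderiv_sub_const]
    have hY : ∀ j, YH n j (fun r => f r - f p) = YH n j f := fun j => by
      funext x; simp only [YH, dirD, fderiv_sub_const]
    simp only [LH, hX, hY, TH, dirD, fderiv_sub_const]
  rw [e, LH_tau (hf.sub contDiff_const), hz, hL, mul_zero]

lemma norm_KK {n : ℕ} (k : Fin n) (q : Hn n) : ‖AA q‖ * ‖KK k q‖ = G0 k q := by
  have hW := W_ge_one q
  have hcan : ‖AA q‖ * ‖AA q‖⁻¹ = 1 := mul_inv_cancel₀ (by linarith)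
  simp only [KK, G0, norm_mul, norm_pow, norm_inv, norm_BB]
  calc _ = (‖AA q‖ * ‖AA q‖⁻¹) * (‖q.1 k‖ * ‖AA q‖⁻¹ ^ (n + 2)) := by ring
    _ = _ := by rw [hcan, one_mul]

lemma cont_KK {n : ℕ} (k : Fin n) : Continuous (KK k : Hn n → ℂ) :=
  (cont_z k).mul (((cont_AA.inv₀ AA_ne).pow _).mul ((cont_BB.inv₀ BB_ne).pow _))

lemma glob_lip {n : ℕ} {f : Hn n → ℂ} {p : Hn n} (hf : DifferentiableAt ℝ f p)
    {M : ℝ} (hM : ∀ p, ‖f p‖ ≤ M) : ∃ L : ℝ, 0 ≤ L ∧ ∀ v, ‖f (p + v) - f p‖ ≤ L * ‖v‖ := by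
  obtain ⟨C, hC0, hC⟩ := hf.hasFDerivAt.isBigO_sub.exists_nonneg
  have hC := hC.bound
  rw [Metric.eventually_nhds_iff] at hC
  obtain ⟨δ, hδ, hC⟩ := hC
  have hM0 : 0 ≤ M := le_trans (norm_nonneg _) (hM 0)
  refine ⟨C + 2 * M / δ, by positivity, fun v => ?_⟩
  have h2 : 0 ≤ 2 * M / δ := by positivity
  rcases lt_or_ge ‖v‖ δ with h | h
  · have := hC (y := p + v) (by simpa using h)
    rw [add_sub_cancel_left] at this
    nlinarith [norm_nonneg v, mul_nonneg h2 (norm_nonneg v)]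
  · have h1 : ‖f (p + v) - f p‖ ≤ M + M := (norm_sub_le _ _).trans (add_le_add (hM _) (hM _))
    have h3 : 2 * M / δ * δ = 2 * M := by field_simp
    nlinarith [mul_nonneg hC0 (norm_nonneg v), mul_le_mul_of_nonneg_left h h2]

lemma lS_bound {n : ℕ} (p q : Hn n) {s : ℝ} (h0 : 0 < s) (h1 : s ≤ 1) :
    ‖lS p s q‖ ≤ s * ((1 + ‖wL p‖) * ‖q‖) := by
  rw [lS_apply, Prod.norm_def]
  have hw := (wL p).le_opNorm q
  have hw0 : 0 ≤ ‖wL p‖ * ‖q‖ := by positivity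
  refine max_le ?_ ?_
  · simp only [norm_smul, Real.norm_of_nonneg h0.le]
    have : ‖q.1‖ ≤ ‖q‖ := norm_fst_le q
    gcongr
    linarith
  · simp only
    have h2 : ‖q.2‖ ≤ ‖q‖ := norm_snd_le q
    calc ‖s ^ 2 * q.2 + s * wL p q‖ ≤ ‖s ^ 2 * q.2‖ + ‖s * wL p q‖ := norm_add_le _ _
      _ = s * (s * ‖q.2‖ + ‖wL p q‖) := by
        rw [norm_mul, norm_mul, norm_pow, Real.norm_of_nonneg h0.le]; ring
      _ ≤ s * (1 * ‖q‖ + ‖wL p‖ * ‖q‖) := by gcongr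
      _ = _ := by ring

def LamL {n : ℕ} (f : Hn n → ℂ) (p : Hn n) : Hn n →L[ℝ] ℂ :=
  (fderiv ℝ f p).comp ((ContinuousLinearMap.fst ℝ _ _).prod (wL p))

lemma LamL_apply {n : ℕ} (f : Hn n → ℂ) (p q : Hn n) :
    LamL f p q = fderiv ℝ f p (q.1, wL p q) := rfl

lemma key3 {n : ℕ} (hn : 1 ≤ n) (k : Fin n) {f : Hn n → ℂ} (hf : ContDiff ℝ (⊤ : ℕ∞) f)
    {M : ℝ} (hM : ∀ p, ‖f p‖ ≤ M) (hL : ∀ p : Hn n, LH n (n : ℝ) f p = 0) (p : Hn n) :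
    ∫ q, LamL f p q * KK k q = 0 := by
  have hd := hf.differentiable (by simp) p
  obtain ⟨L, hL0, hLip⟩ := glob_lip hd hM
  let r : ℕ → ℝ := fun m => 1 / ((m : ℝ) + 1)
  have hr : ∀ m, 0 < r m := fun m => by positivity
  have hr1 : ∀ m, r m ≤ 1 := fun m => by
    simp only [r]; rw [div_le_one (by positivity)]; linarith [(Nat.cast_nonneg m : (0 : ℝ) ≤ m)]
  have hrt : Tendsto r atTop (𝓝 0) := tendsto_one_div_add_atTop_nhds_zero_nat
  have hlim : Tendsto (fun m => ∫ q, ((r m)⁻¹ : ℂ) * ((f (tau p (r m) q) - f p) * KK k q)) atTop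
      (𝓝 (∫ q, LamL f p q * KK k q)) := by
    apply tendsto_integral_of_dominated_convergence (fun q => (L * (1 + ‖wL p‖)) * G0 k q)
    · intro m
      exact (continuous_const.mul (((cd_tau hf p (r m)).continuous.sub continuous_const).mul
        (cont_KK k))).aestronglyMeasurable
    · exact (int_G0 k).const_mul _
    · intro m
      refine Eventually.of_forall fun q => ?_
      have b1 := (hLip (lS p (r m) q)).trans
        (mul_le_mul_of_nonneg_left (lS_bound p q (hr m) (hr1 m)) hL0)
      have b2 := W_ge_norm q
      have hri : (r m)⁻¹ * r m = 1 := inv_mul_cancel₀ (hr m).ne'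
      have hrp : 0 < (r m)⁻¹ := inv_pos.2 (hr m)
      rw [norm_mul, norm_mul, norm_inv, Complex.norm_real, Real.norm_of_nonneg (hr m).le, tau,
        ← norm_KK]
      calc (r m)⁻¹ * (‖f (p + lS p (r m) q) - f p‖ * ‖KK k q‖)
          ≤ (r m)⁻¹ * ((L * (r m * ((1 + ‖wL p‖) * ‖AA q‖))) * ‖KK k q‖) := by
            gcongr
            exact b1.trans (by have := (hr m).le; gcongr)
        _ = ((r m)⁻¹ * r m) * (L * (1 + ‖wL p‖) * (‖AA q‖ * ‖KK k q‖)) := by ring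
        _ = _ := by rw [hri, one_mul]
    · refine Eventually.of_forall fun q => ?_
      have hc : HasDerivAt (fun s : ℝ => tau p s q) (q.1, wL p q) 0 := by
        have h1 : HasDerivAt (fun s : ℝ => s • q.1) q.1 0 := by
          simpa using (hasDerivAt_id (0 : ℝ)).smul_const q.1
        have h2 : HasDerivAt (fun s : ℝ => s ^ 2 * q.2 + s * wL p q) (wL p q) 0 := by
          have := (((hasDerivAt_id' (0 : ℝ)).fun_pow 2).mul_const q.2).fun_add
            ((hasDerivAt_id' (0 : ℝ)).mul_const (wL p q))
          exact this.congr_deriv (by simp)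
        exact (h1.prodMk h2).const_add p
      have ht0 : tau p 0 q = p := by simp [tau, lS_apply]
      have hfd : HasFDerivAt f (fderiv ℝ f p) (tau p 0 q) := by rw [ht0]; exact hd.hasFDerivAt
      have hcomp := (hfd.comp_hasDerivAt (0 : ℝ) hc).tendsto_slope_zero
      have hr' : Tendsto r atTop (𝓝[≠] 0) :=
        tendsto_nhdsWithin_iff.2 ⟨hrt, Eventually.of_forall fun m => (hr m).ne'⟩
      have := (hcomp.comp hr').mul_const (KK k q)
      rw [← LamL_apply] at this
      refine this.congr fun m => ?_
      simp [ht0]; ring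
  have hz : ∀ m, ∫ q, ((r m)⁻¹ : ℂ) * ((f (tau p (r m) q) - f p) * KK k q) = 0 := by
    intro m
    rw [integral_const_mul, key2 hn k hf hM hL, mul_zero]
  simp_rw [hz] at hlim
  exact tendsto_nhds_unique hlim tendsto_const_nhds

def rotf {n : ℕ} (k : Fin n) (a : Circle) (i : Fin n) (z : ℂ) : ℂ :=
  rotation (if i = k then a else 1) z

def rot {n : ℕ} (k : Fin n) (a : Circle) (q : Hn n) : Hn n :=
  (fun i => rotf k a i (q.1 i), q.2)

lemma mp_rot {n : ℕ} (k : Fin n) (a : Circle) :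
    MeasurePreserving (rot k a : Hn n → Hn n) volume volume := by
  have h1 : MeasurePreserving (fun (z : Fin n → ℂ) i => rotf k a i (z i)) volume volume :=
    volume_preserving_pi fun i => (rotation (if i = k then a else 1)).measurePreserving
  exact h1.prod (MeasurePreserving.id volume)

lemma rot_norm {n : ℕ} (k : Fin n) (a : Circle) (q : Hn n) (i : Fin n) :
    Complex.normSq ((rot k a q).1 i) = Complex.normSq (q.1 i) := by
  simp only [rot, rotf, Complex.normSq_eq_norm_sq, LinearIsometryEquiv.norm_map]

lemma rot_SS {n : ℕ} (k : Fin n) (a : Circle) (q : Hn n) : SS (rot k a q) = SS q := by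
  rw [SS_eq, SS_eq]; simp only [rot_norm]

lemma rot_z {n : ℕ} (k : Fin n) (a : Circle) (q : Hn n) : (rot k a q).1 k = a * q.1 k := by
  simp [rot, rotf, rotation_apply]

lemma rot_KK {n : ℕ} (k : Fin n) (a : Circle) (q : Hn n) : KK k (rot k a q) = a * KK k q := by
  have hA : AA (rot k a q) = AA q := by rw [AA, AA, rot_SS]; rfl
  have hB : BB (rot k a q) = BB q := by rw [BB, BB, rot_SS]; rfl
  rw [KK, KK, hA, hB, rot_z, mul_assoc]

lemma rot_eq {n : ℕ} (k : Fin n) (a : Circle) (q : Hn n) :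
    rot k a q = q + ((a - 1) * q.1 k).re • eX n k + ((a - 1) * q.1 k).im • eY n k := by
  refine Prod.ext ?_ ?_
  · funext i
    by_cases h : i = k
    · subst h
      rw [rot_z]
      simp only [eX, eY, Prod.fst_add, Prod.smul_fst, Pi.add_apply, Pi.smul_apply, if_true,
        Complex.real_smul, mul_one, add_assoc, Complex.re_add_im]
      ring
    · simp [rot, rotf, h, eX, eY, rotation_apply]
  · simp [rot, eX, eY]

lemma LamL_X {n : ℕ} (f : Hn n → ℂ) (p : Hn n) (k : Fin n) : LamL f p (eX n k) = XH n k f p := by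
  have : ((eX n k).1, (2 * (p.1 k).im : ℝ)) = eX n k + (2 * (p.1 k).im : ℝ) • eT n := by
    simp [eX, eT]
  rw [LamL_apply, wL_X, this, map_add, map_smul]
  simp [XH, dirD]
lemma LamL_Y {n : ℕ} (f : Hn n → ℂ) (p : Hn n) (k : Fin n) : LamL f p (eY n k) = YH n k f p := by
  have : ((eY n k).1, (-(2 * (p.1 k).re) : ℝ)) = eY n k + (-(2 * (p.1 k).re) : ℝ) • eT n := by
    simp [eY, eT]
  rw [LamL_apply, wL_Y, this, map_add, map_smul]
  simp [YH, dirD]; ring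

def cI : Circle := ⟨Complex.I, by simp [Submonoid.unitSphere]⟩
lemma cI_coe : (cI : ℂ) = Complex.I := rfl

lemma rot_int {n : ℕ} (k : Fin n) (a : Circle) {F : Hn n → ℂ} (hF : Continuous F) :
    ∫ q, F (rot k a q) = ∫ q, F q := by
  have h := mp_rot k a
  conv_rhs => rw [← h.map_eq]
  rw [integral_map h.measurable.aemeasurable hF.aestronglyMeasurable]

lemma lin_int {n : ℕ} (k : Fin n) (l : Hn n →L[ℝ] ℂ) : Integrable (fun q => l q * KK k q) := by
  refine ((int_G0 k).const_mul ‖l‖).mono' (l.continuous.mul (cont_KK k)).aestronglyMeasurable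
    (Eventually.of_forall fun q => ?_)
  rw [norm_mul, ← norm_KK]
  calc _ ≤ (‖l‖ * ‖AA q‖) * ‖KK k q‖ := by
        gcongr; exact (l.le_opNorm q).trans (by gcongr; exact W_ge_norm q)
    _ = _ := by ring

lemma rot_integrable {n : ℕ} (k : Fin n) (a : Circle) {F : Hn n → ℂ} (hF : Integrable F) :
    Integrable (fun q => F (rot k a q)) := (mp_rot k a).integrable_comp_of_integrable hF

lemma key4 {n : ℕ} (k : Fin n) (f : Hn n → ℂ) (p : Hn n)
    (h : ∫ q, LamL f p q * KK k q = 0) :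
    ZbarH n k f p * ∫ q, (starRingEnd ℂ) (q.1 k) * KK k q = 0 := by
  have hc : Continuous (fun q => LamL f p q * KK k q) := (LamL f p).continuous.mul (cont_KK k)
  have hi := lin_int k (LamL f p)
  have hR := fun a => rot_int k a hc
  have hI := fun a => rot_integrable k a hi
  have e : ∫ q, (4 * ZbarH n k f p) * ((starRingEnd ℂ) (q.1 k) * KK k q) =
      ∫ q, ((LamL f p (rot k 1 q) * KK k (rot k 1 q) + LamL f p (rot k cI q) * KK k (rot k cI q))
        + LamL f p (rot k (cI ^ 2) q) * KK k (rot k (cI ^ 2) q))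
        + LamL f p (rot k (cI ^ 3) q) * KK k (rot k (cI ^ 3) q) := by
    congr 1
    funext q
    simp only [rot_KK]
    simp only [rot_eq, map_add, map_smul, LamL_X, LamL_Y, Circle.coe_one, Circle.coe_pow, cI_coe,
      Complex.I_sq, Complex.I_pow_three, ZbarH, Complex.real_smul]
    have hz : (starRingEnd ℂ) (q.1 k) = (q.1 k).re - (q.1 k).im * Complex.I := by
      apply Complex.ext <;> simp
    rw [hz]
    simp
    ring_nf
    simp only [Complex.I_sq]
    ring
  have i2 := (hI 1).fun_add (hI cI)
  have i3 := i2.fun_add (hI (cI ^ 2))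
  rw [integral_add i3 (hI (cI ^ 3)), integral_add i2 (hI (cI ^ 2)), integral_add (hI 1) (hI cI),
    hR, hR, hR, hR, h, integral_const_mul] at e
  linear_combination e / 4

def uu (r t : ℝ) : ℂ := ((r : ℂ) + -Complex.I * t)⁻¹
def vv (r t : ℝ) : ℂ := ((r : ℂ) + Complex.I * t)⁻¹

lemma uu_ne {r : ℝ} (hr : 1 ≤ r) (t : ℝ) : (r : ℂ) + -Complex.I * t ≠ 0 := by
  intro h; have := congrArg Complex.re h; simp at this; linarith
lemma vv_ne {r : ℝ} (hr : 1 ≤ r) (t : ℝ) : (r : ℂ) + Complex.I * t ≠ 0 := by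
  intro h; have := congrArg Complex.re h; simp at this; linarith

lemma uv {r : ℝ} (hr : 1 ≤ r) (t : ℝ) : uu r t * vv r t = (2 * r : ℂ)⁻¹ * (uu r t + vv r t) := by
  have h1 := uu_ne hr t
  have h2 := vv_ne hr t
  have h3 : (r : ℂ) ≠ 0 := by exact_mod_cast (by linarith : r ≠ 0)
  unfold uu vv
  have e : (2 * r : ℂ) = (r + -Complex.I * t) + (r + Complex.I * t) := by ring
  have h4 : (2 * r : ℂ) ≠ 0 := mul_ne_zero two_ne_zero h3
  rw [e] at h4 ⊢
  generalize (r : ℂ) + -Complex.I * t = x at *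
  generalize (r : ℂ) + Complex.I * t = y at *
  field_simp
  ring

lemma uv' {r : ℝ} (hr : 1 ≤ r) (t : ℝ) : uu r t * vv r t = (((r ^ 2 + t ^ 2)⁻¹ : ℝ) : ℂ) := by
  unfold uu vv
  rw [← mul_inv]
  push_cast
  congr 1
  ring_nf
  simp only [Complex.I_sq]
  ring

lemma norm_uu {r : ℝ} (t : ℝ) : ‖uu r t‖ = (Real.sqrt (r ^ 2 + t ^ 2))⁻¹ := by
  rw [uu, norm_inv]; congr 1
  rw [show (r : ℂ) + -Complex.I * t = (r : ℂ) + ((-t : ℝ) : ℂ) * Complex.I by push_cast; ring,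
    Complex.norm_add_mul_I]
  simp
lemma norm_vv {r : ℝ} (t : ℝ) : ‖vv r t‖ = (Real.sqrt (r ^ 2 + t ^ 2))⁻¹ := by
  rw [vv, norm_inv]; congr 1
  rw [show (r : ℂ) + Complex.I * t = (r : ℂ) + (t : ℂ) * Complex.I by ring,
    Complex.norm_add_mul_I]

lemma cont_uu {r : ℝ} (hr : 1 ≤ r) : Continuous (uu r) :=
  (continuous_const.add (continuous_const.mul Complex.continuous_ofReal)).inv₀ (uu_ne hr)
lemma cont_vv {r : ℝ} (hr : 1 ≤ r) : Continuous (vv r) :=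
  (continuous_const.add (continuous_const.mul Complex.continuous_ofReal)).inv₀ (vv_ne hr)

lemma int_uv {r : ℝ} (hr : 1 ≤ r) (a b : ℕ) (hab : 2 ≤ a + b) :
    Integrable (fun t => uu r t ^ a * vv r t ^ b) := by
  refine integrable_inv_one_add_sq.mono' (((cont_uu hr).pow a).mul
    ((cont_vv hr).pow b)).aestronglyMeasurable (Eventually.of_forall fun t => ?_)
  rw [norm_mul, norm_pow, norm_pow, norm_uu, norm_vv, ← pow_add]
  have h1 : 1 + t ^ 2 ≤ r ^ 2 + t ^ 2 := by nlinarith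
  have h2 : 1 ≤ Real.sqrt (r ^ 2 + t ^ 2) := by
    rw [Real.one_le_sqrt]; nlinarith [sq_nonneg t]
  calc (Real.sqrt (r ^ 2 + t ^ 2))⁻¹ ^ (a + b) ≤ (Real.sqrt (r ^ 2 + t ^ 2))⁻¹ ^ 2 :=
        pow_le_pow_of_le_one (by positivity) (inv_le_one_of_one_le₀ h2) hab
    _ = (r ^ 2 + t ^ 2)⁻¹ := by rw [inv_pow, Real.sq_sqrt (by positivity)]
    _ ≤ _ := by gcongr

lemma lim_aux (r : ℝ) {l : Filter ℝ} (hl : Tendsto (fun t : ℝ => |t|) l atTop) :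
    Tendsto (fun t : ℝ => (Real.sqrt (r ^ 2 + t ^ 2))⁻¹) l (𝓝 0) := by
  apply tendsto_inv_atTop_zero.comp
  refine tendsto_atTop_mono (fun t => ?_) hl
  apply Real.le_sqrt_of_sq_le
  rw [sq_abs]; nlinarith [sq_nonneg r]

lemma lim_pow (r : ℝ) {w : ℝ → ℂ} (hw : ∀ t, ‖w t‖ = (Real.sqrt (r ^ 2 + t ^ 2))⁻¹) (b : ℕ)
    {l : Filter ℝ} (hl : Tendsto (fun t : ℝ => |t|) l atTop) :
    Tendsto (fun t => w t ^ (b + 1)) l (𝓝 0) := by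
  have h : Tendsto w l (𝓝 0) := by
    rw [tendsto_zero_iff_norm_tendsto_zero]
    simp_rw [hw]; exact lim_aux r hl
  simpa using h.pow (b + 1)

lemma J0 {w : ℝ → ℂ} {r : ℝ} (hw : ∀ t, ‖w t‖ = (Real.sqrt (r ^ 2 + t ^ 2))⁻¹) {c : ℂ} (hc : c ≠ 0)
    (hd : ∀ t, HasDerivAt w (c * w t ^ 2) t) (b : ℕ)
    (hi : Integrable (fun t => w t ^ (b + 2))) : ∫ t, w t ^ (b + 2) = 0 := by
  have h := integral_of_hasDerivAt_of_tendsto (f := fun t => w t ^ (b + 1))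
    (f' := fun t => ((b + 1 : ℕ) * c) * w t ^ (b + 2)) (m := 0) (n := 0)
    (fun t => by
      have := (hd t).fun_pow (b + 1)
      refine this.congr_deriv ?_
      simp; ring)
    (hi.const_mul _) (lim_pow r hw b tendsto_abs_atBot_atTop)
    (lim_pow r hw b tendsto_abs_atTop_atTop)
  rw [integral_const_mul, sub_zero] at h
  refine (mul_eq_zero.1 h).resolve_left (mul_ne_zero ?_ hc)
  exact Nat.cast_ne_zero.2 (by omega)

lemma d_uu {r : ℝ} (hr : 1 ≤ r) (t : ℝ) : HasDerivAt (uu r) (Complex.I * uu r t ^ 2) t := by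
  have h0 : HasDerivAt (fun t : ℝ => (t : ℂ)) 1 t := Complex.ofRealCLM.hasDerivAt
  have := ((h0.const_mul (-Complex.I)).const_add (r : ℂ)).fun_inv (uu_ne hr t)
  refine this.congr_deriv ?_
  simp [uu, div_eq_mul_inv]
lemma d_vv {r : ℝ} (hr : 1 ≤ r) (t : ℝ) : HasDerivAt (vv r) (-Complex.I * vv r t ^ 2) t := by
  have h0 : HasDerivAt (fun t : ℝ => (t : ℂ)) 1 t := Complex.ofRealCLM.hasDerivAt
  have := ((h0.const_mul Complex.I).const_add (r : ℂ)).fun_inv (vv_ne hr t)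
  refine this.congr_deriv ?_
  simp [vv, div_eq_mul_inv]

lemma J11 {r : ℝ} (hr : 1 ≤ r) : ∃ c : ℝ, 0 < c ∧ ∫ t, uu r t ^ 1 * vv r t ^ 1 = (c : ℂ) := by
  have hi := int_uv hr 1 1 (by norm_num)
  refine ⟨∫ t, (r ^ 2 + t ^ 2)⁻¹, ?_, ?_⟩
  · have hi2 : Integrable (fun t : ℝ => (r ^ 2 + t ^ 2)⁻¹) := by
      have := hi.re
      refine this.congr (Eventually.of_forall fun t => ?_)
      simp only [pow_one, uv' hr]; exact Complex.ofReal_re _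
    have hp : ∀ t : ℝ, 0 < (r ^ 2 + t ^ 2)⁻¹ := fun t => by positivity
    rw [integral_pos_iff_support_of_nonneg (fun t => (hp t).le) hi2]
    have : Function.support (fun t : ℝ => (r ^ 2 + t ^ 2)⁻¹) = univ := by
      ext t; simp only [Function.mem_support, mem_univ, iff_true]; exact (hp t).ne'
    rw [this]; simp
  · simp only [pow_one, uv' hr]
    exact integral_ofReal

lemma J1 {r : ℝ} (hr : 1 ≤ r) (b : ℕ) :
    ∃ c : ℝ, 0 < c ∧ ∫ t, uu r t ^ 1 * vv r t ^ (b + 1) = (c : ℂ) := by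
  induction b with
  | zero => exact J11 hr
  | succ b ih =>
    obtain ⟨c, hc, h⟩ := ih
    refine ⟨(2 * r)⁻¹ * c, by positivity, ?_⟩
    have e : ∀ t, uu r t ^ 1 * vv r t ^ (b + 1 + 1) =
        (2 * r : ℂ)⁻¹ * (uu r t ^ 1 * vv r t ^ (b + 1) + uu r t ^ 0 * vv r t ^ (b + 2)) := fun t => by
      linear_combination (vv r t ^ (b + 1)) * uv hr t
    simp_rw [e]
    have z : ∫ t, uu r t ^ 0 * vv r t ^ (b + 2) = 0 := by
      have hi := int_uv hr 0 (b + 2) (by omega)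
      simp only [pow_zero, one_mul] at hi ⊢
      exact J0 norm_vv (by simp) (d_vv hr) b hi
    rw [integral_const_mul, integral_add (int_uv hr _ _ (by omega)) (int_uv hr _ _ (by omega)), h, z]
    push_cast; ring

lemma J2 {r : ℝ} (hr : 1 ≤ r) (b : ℕ) :
    ∃ c : ℝ, 0 < c ∧ ∫ t, uu r t ^ 2 * vv r t ^ (b + 1) = (c : ℂ) := by
  induction b with
  | zero =>
    obtain ⟨c, hc, h⟩ := J11 hr
    refine ⟨(2 * r)⁻¹ * c, by positivity, ?_⟩
    have e : ∀ t, uu r t ^ 2 * vv r t ^ (0 + 1) =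
        (2 * r : ℂ)⁻¹ * (uu r t ^ 1 * vv r t ^ 1 + uu r t ^ 2 * vv r t ^ 0) := fun t => by
      linear_combination (uu r t) * uv hr t
    simp_rw [e]
    have z : ∫ t, uu r t ^ 2 * vv r t ^ 0 = 0 := by
      have hi := int_uv hr 2 0 (by omega)
      simp only [pow_zero, mul_one] at hi ⊢
      exact J0 norm_uu (by simp) (d_uu hr) 0 hi
    rw [integral_const_mul, integral_add (int_uv hr _ _ (by omega)) (int_uv hr _ _ (by omega)), h, z]
    push_cast; ring
  | succ b ih =>
    obtain ⟨c, hc, h⟩ := ih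
    obtain ⟨d, hd, h'⟩ := J1 hr (b + 1)
    refine ⟨(2 * r)⁻¹ * (c + d), by positivity, ?_⟩
    have e : ∀ t, uu r t ^ 2 * vv r t ^ (b + 1 + 1) =
        (2 * r : ℂ)⁻¹ * (uu r t ^ 2 * vv r t ^ (b + 1) + uu r t ^ 1 * vv r t ^ (b + 1 + 1)) := fun t => by
      linear_combination (uu r t * vv r t ^ (b + 1)) * uv hr t
    simp_rw [e]
    rw [integral_const_mul, integral_add (int_uv hr _ _ (by omega)) (int_uv hr _ _ (by omega)), h, h']
    push_cast; ring

lemma nonvan {n : ℕ} (k : Fin n) : ∫ q : Hn n, (starRingEnd ℂ) (q.1 k) * KK k q ≠ 0 := by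
  have hi : Integrable (fun q : Hn n => (starRingEnd ℂ) (q.1 k) * KK k q) :=
    lin_int k ((Complex.conjCLE : ℂ →L[ℝ] ℂ).comp (zL k))
  rw [Measure.volume_eq_prod] at hi ⊢
  rw [integral_prod _ hi]
  have hi1 := hi.integral_prod_left
  have hin : ∀ z : Fin n → ℂ, ∃ c : ℝ, 0 < c ∧
      ∫ t : ℝ, (starRingEnd ℂ) (z k) * KK k ((z, t) : Hn n) = ((‖z k‖ ^ 2 * c : ℝ) : ℂ) := by
    intro z
    have hr : 1 ≤ 1 + ∑ i, Complex.normSq (z i) := by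
      have : 0 ≤ ∑ i, Complex.normSq (z i) := Finset.sum_nonneg fun i _ => Complex.normSq_nonneg _
      linarith
    obtain ⟨c, hc, h⟩ := J2 hr n
    refine ⟨c, hc, ?_⟩
    have e : ∀ t : ℝ, (starRingEnd ℂ) (z k) * KK k ((z, t) : Hn n) =
        ((‖z k‖ ^ 2 : ℝ) : ℂ) * (uu (1 + ∑ i, Complex.normSq (z i)) t ^ 2 *
          vv (1 + ∑ i, Complex.normSq (z i)) t ^ (n + 1)) := by
      intro t
      rw [KK, AA, BB, SS_eq, uu, vv, ← Complex.normSq_eq_norm_sq, Complex.normSq_eq_conj_mul_self]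
      push_cast
      ring
    simp_rw [e]
    rw [integral_const_mul, h]
    push_cast; ring
  choose c hc h using hin
  simp_rw [h] at hi1 ⊢
  have hi2 : Integrable (fun z : Fin n → ℂ => ‖z k‖ ^ 2 * c z) := by
    have := hi1.re
    refine this.congr (Eventually.of_forall fun t => ?_)
    exact Complex.ofReal_re _
  have e : ∫ z : Fin n → ℂ, ((‖z k‖ ^ 2 * c z : ℝ) : ℂ) = ((∫ z, ‖z k‖ ^ 2 * c z : ℝ) : ℂ) :=
    integral_ofReal
  rw [e]
  have hpos : 0 < ∫ z : Fin n → ℂ, ‖z k‖ ^ 2 * c z := by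
    have hH : (volume : Measure (Fin n → ℂ)).IsAddHaarMeasure := by
      rw [volume_pi]; infer_instance
    rw [integral_pos_iff_support_of_nonneg (fun z => by have := hc z; positivity) hi2]
    have : Function.support (fun z : Fin n → ℂ => ‖z k‖ ^ 2 * c z) = {z | z k ≠ 0} := by
      ext z; simp [(hc z).ne']
    rw [this]
    apply IsOpen.measure_pos
    · exact isOpen_ne_fun (continuous_apply k) continuous_const
    · exact ⟨fun _ => 1, by simp⟩
  exact_mod_cast hpos.ne'

/-- A smooth bounded function `f` on the Heisenberg group `H^n` with
`ℒ_n f = 0` satisfies the boundary Cauchy-Riemann equations `Z̄_k f = 0`, `k = 1, …, n`. -/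
theorem stmt0 (n : ℕ) (hn : 1 ≤ n) (f : Hn n → ℂ)
    (hsmooth : ContDiff ℝ (⊤ : ℕ∞) f) (hbdd : BddFun f)
    (hL : ∀ p : Hn n, LH n (n : ℝ) f p = 0) :
    ∀ (k : Fin n) (p : Hn n), ZbarH n k f p = 0 := by
  intro k p
  obtain ⟨M, hM⟩ := hbdd
  exact (mul_eq_zero.1 (key4 k f p (key3 hn k hsmooth hM hL p))).resolve_right (nonvan k)
end
end

section
/- Let n ≥ 1, α > 0, and let k be the smallest integer bigger than nα. Let F be a bounded smooth function on ℂ^n × (0,∞) with Λ_α F = 0, and assume that for every p = 0, …, k+1 and every Schwartz function φ on ℂ^n ≅ ℝ^{2n}, sup_{0 < a ≤ 1} |∫_{ℂ^n} ∂_a^p F(ζ,a) φ(ζ) dζ| < ∞. Then F is constant. -/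
noncomputable section
open MeasureTheory Filter Set
open scoped Topology BigOperators

/-- The standard Euclidean Laplacian `Δ = Σ_j (∂_{x_j}² + ∂_{y_j}²)` in the variable
`ζ ∈ ℂ^n ≅ ℝ^{2n}` for functions on `ℂ^n × ℝ` (points `(ζ, a)`). -/
def DeltaC (n : ℕ) (f : Hn n → ℂ) (p : Hn n) : ℂ :=
  ∑ j, (dirD (eX n j) (dirD (eX n j) f) p + dirD (eY n j) (dirD (eY n j) f) p)

/-- `∂_a` on `ℂ^n × ℝ` (differentiation in the second variable). -/
def partialA (n : ℕ) (f : Hn n → ℂ) : Hn n → ℂ := fun p => dirD (eT n) f p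

/-- `Λ_α = α a (Δ - n ∂_a) + a² ∂_a²` on `ℂ^n × (0,∞)`. -/
def LamOp (n : ℕ) (α : ℝ) (f : Hn n → ℂ) (p : Hn n) : ℂ :=
  (α : ℂ) * (p.2 : ℂ) * (DeltaC n f p - (n : ℂ) * partialA n f p)
    + (p.2 : ℂ) ^ 2 * partialA n (partialA n f) p

open MeasureTheory Filter Set
open scoped Topology BigOperators

theorem s1_fence {f f' : ℝ → ℂ} {B B' : ℝ → ℝ} {a b : ℝ} (hab : a ≤ b)
    (hf : ∀ x ∈ Icc a b, HasDerivAt f (f' x) x) (hB : ∀ x ∈ Icc a b, HasDerivAt B (B' x) x)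
    (h : ∀ x ∈ Icc a b, ‖f' x‖ ≤ B' x) : ‖f b - f a‖ ≤ B b - B a := by
  have := image_norm_le_of_norm_deriv_right_le_deriv_boundary' (f := fun x => f x - f a)
    (f' := f') (B := fun x => B x - B a) (B' := B') (a := a) (b := b)
    (fun x hx => ((hf x hx).sub_const _).continuousAt.continuousWithinAt)
    (fun x hx => ((hf x (Ico_subset_Icc_self hx)).sub_const _).hasDerivWithinAt)
    (by simp)
    (fun x hx => ((hB x hx).sub_const _).continuousAt.continuousWithinAt)
    (fun x hx => ((hB x (Ico_subset_Icc_self hx)).sub_const _).hasDerivWithinAt)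
    (fun x hx => h x (Ico_subset_Icc_self hx))
  exact this (right_mem_Icc.2 hab)

theorem s2_weight {f f' r : ℝ → ℂ} {q ε K s b : ℝ} (hs : 0 < s) (hsb : s ≤ b) (hq : q - ε ≠ 0)
    (hf : ∀ a, 0 < a → HasDerivAt f (f' a) a)
    (he : ∀ a : ℝ, 0 < a → (a : ℂ) * f' a + (q : ℂ) * f a + r a = 0)
    (hr : ∀ a ∈ Icc s b, ‖r a‖ ≤ K * a ^ (-ε)) :
    ‖((b ^ q : ℝ) : ℂ) * f b - ((s ^ q : ℝ) : ℂ) * f s‖ ≤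
      K / (q - ε) * b ^ (q - ε) - K / (q - ε) * s ^ (q - ε) := by
  refine s1_fence (f := fun a => ((a ^ q : ℝ) : ℂ) * f a)
    (f' := fun a => -(((a ^ (q - 1) : ℝ) : ℂ) * r a))
    (B := fun a => K / (q - ε) * a ^ (q - ε)) (B' := fun a => K * a ^ (q - ε - 1)) hsb ?_ ?_ ?_
  · intro x hx
    have hx0 : 0 < x := lt_of_lt_of_le hs hx.1
    have h1 := ((Real.hasDerivAt_rpow_const (p := q) (Or.inl hx0.ne')).ofReal_comp).mul (hf x hx0)
    refine HasDerivAt.congr_deriv h1 ?_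
    have h2 : x ^ q = x ^ (q - 1) * x := by
      rw [Real.rpow_sub_one hx0.ne']; field_simp
    rw [h2]
    push_cast
    linear_combination (((x ^ (q - 1) : ℝ) : ℂ)) * he x hx0
  · intro x hx
    have hx0 : 0 < x := lt_of_lt_of_le hs hx.1
    have h1 := (Real.hasDerivAt_rpow_const (p := q - ε) (Or.inl hx0.ne')).const_mul (K / (q - ε))
    refine HasDerivAt.congr_deriv h1 ?_
    field_simp
  · intro x hx
    have hx0 : 0 < x := lt_of_lt_of_le hs hx.1
    rw [norm_neg, norm_mul, Complex.norm_real, Real.norm_of_nonneg (by positivity)]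
    calc x ^ (q - 1) * ‖r x‖ ≤ x ^ (q - 1) * (K * x ^ (-ε)) := by
          gcongr; exact hr x hx
      _ = K * (x ^ (q - 1) * x ^ (-ε)) := by ring
      _ = _ := by rw [← Real.rpow_add hx0]; congr 2; ring

/-- q < ε step on (0,1]. -/
theorem s3_step {f f' r : ℝ → ℂ} {q ε K : ℝ} (hq : q < ε) (hK : 0 ≤ K)
    (hf : ∀ a, 0 < a → HasDerivAt f (f' a) a)
    (he : ∀ a : ℝ, 0 < a → (a : ℂ) * f' a + (q : ℂ) * f a + r a = 0)
    (hr : ∀ a, 0 < a → a ≤ 1 → ‖r a‖ ≤ K * a ^ (-ε)) (a : ℝ) (ha : 0 < a) (ha1 : a ≤ 1) :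
    ‖f a‖ ≤ (‖f 1‖ + K / (ε - q)) * a ^ (-ε) := by
  have h := s2_weight ha ha1 (sub_ne_zero.2 hq.ne) hf he
    (fun x hx => hr x (lt_of_lt_of_le ha hx.1) hx.2)
  simp only [Real.one_rpow, Complex.ofReal_one, one_mul, mul_one] at h
  have e1 : K / (q - ε) = - (K / (ε - q)) := by
    rw [← neg_sub ε q, div_neg]
  rw [e1] at h
  have hKd : 0 ≤ K / (ε - q) := div_nonneg hK (by linarith)
  have h2 : a ^ q * ‖f a‖ ≤ ‖f 1‖ + K / (ε - q) * a ^ (q - ε) := by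
    have : ‖((a ^ q : ℝ) : ℂ) * f a‖ ≤ ‖f 1‖ + ‖f 1 - ((a ^ q : ℝ) : ℂ) * f a‖ := by
      rw [norm_sub_rev]
      have := norm_add_le (f 1) (((a ^ q : ℝ) : ℂ) * f a - f 1)
      simpa using this
    rw [norm_mul, Complex.norm_real, Real.norm_of_nonneg (by positivity)] at this
    linarith
  have h3 : ‖f a‖ = a ^ (-q) * (a ^ q * ‖f a‖) := by
    rw [← mul_assoc, ← Real.rpow_add ha]; simp
  rw [h3]
  calc a ^ (-q) * (a ^ q * ‖f a‖) ≤ a ^ (-q) * (‖f 1‖ + K / (ε - q) * a ^ (q - ε)) := by gcongr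
    _ = a ^ (-q) * ‖f 1‖ + K / (ε - q) * (a ^ (-q) * a ^ (q - ε)) := by ring
    _ = a ^ (-q) * ‖f 1‖ + K / (ε - q) * a ^ (-ε) := by
        rw [← Real.rpow_add ha]; congr 3; ring
    _ ≤ a ^ (-ε) * ‖f 1‖ + K / (ε - q) * a ^ (-ε) := by
        gcongr ?_ * _ + _
        exact Real.rpow_le_rpow_of_exponent_ge ha ha1 (by linarith)
    _ = _ := by ring

/-- q > ε step on (0,1], using boundedness. -/
theorem s4_step {f f' r : ℝ → ℂ} {q ε K C : ℝ} (hq : ε < q) (hq0 : 0 < q) (hK : 0 ≤ K)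
    (hf : ∀ a, 0 < a → HasDerivAt f (f' a) a)
    (he : ∀ a : ℝ, 0 < a → (a : ℂ) * f' a + (q : ℂ) * f a + r a = 0)
    (hr : ∀ a, 0 < a → a ≤ 1 → ‖r a‖ ≤ K * a ^ (-ε))
    (hC : ∀ a, 0 < a → a ≤ 1 → ‖f a‖ ≤ C) (a : ℝ) (ha : 0 < a) (ha1 : a ≤ 1) :
    ‖f a‖ ≤ K / (q - ε) * a ^ (-ε) := by
  have hKd : 0 ≤ K / (q - ε) := div_nonneg hK (by linarith)
  have key : ∀ s, 0 < s → s ≤ a → a ^ q * ‖f a‖ ≤ K / (q - ε) * a ^ (q - ε) + C * s ^ q := by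
    intro s hs hsa
    have h := s2_weight hs hsa (sub_ne_zero.2 hq.ne') hf he
      (fun x hx => hr x (lt_of_lt_of_le hs hx.1) (hx.2.trans ha1))
    have h1 := norm_sub_norm_le (((a ^ q : ℝ) : ℂ) * f a) (((s ^ q : ℝ) : ℂ) * f s)
    rw [norm_mul, norm_mul, Complex.norm_real, Complex.norm_real,
      Real.norm_of_nonneg (by positivity), Real.norm_of_nonneg (by positivity)] at h1
    have h2 : s ^ q * ‖f s‖ ≤ s ^ q * C := by gcongr; exact hC s hs (hsa.trans ha1)
    have h3 : 0 ≤ K / (q - ε) * s ^ (q - ε) := by positivity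
    linarith
  have lim : Tendsto (fun s : ℝ => K / (q - ε) * a ^ (q - ε) + C * s ^ q) (𝓝[>] 0)
      (𝓝 (K / (q - ε) * a ^ (q - ε) + C * 0)) := by
    have : Tendsto (fun s : ℝ => s ^ q) (𝓝 0) (𝓝 0) := by
      have := (Real.continuousAt_rpow_const 0 q (Or.inr hq0.le)).tendsto
      rwa [Real.zero_rpow hq0.ne'] at this
    exact ((this.mono_left nhdsWithin_le_nhds).const_mul C).const_add _
  have h2 := ge_of_tendsto lim (b := a ^ q * ‖f a‖) (by
    filter_upwards [Ioo_mem_nhdsGT ha] with s hs using key s hs.1 hs.2.le)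
  rw [mul_zero, add_zero] at h2
  have h3 : ‖f a‖ = a ^ (-q) * (a ^ q * ‖f a‖) := by
    rw [← mul_assoc, ← Real.rpow_add ha]; simp
  rw [h3]
  calc a ^ (-q) * (a ^ q * ‖f a‖) ≤ a ^ (-q) * (K / (q - ε) * a ^ (q - ε)) := by gcongr
    _ = K / (q - ε) * (a ^ (-q) * a ^ (q - ε)) := by ring
    _ = _ := by rw [← Real.rpow_add ha]; congr 2; ring

/-- first derivative bound. -/
theorem s5_first {f0 f f' r : ℝ → ℂ} {β K C : ℝ} (hβ : 0 < β) (hK : 0 ≤ K)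
    (hf0 : ∀ a, 0 < a → HasDerivAt f0 (f a) a)
    (hf : ∀ a, 0 < a → HasDerivAt f (f' a) a)
    (he : ∀ a : ℝ, 0 < a → (a : ℂ) * f' a + ((-β : ℝ) : ℂ) * f a + r a = 0)
    (hr : ∀ a, 0 < a → ‖r a‖ ≤ K)
    (hC : ∀ a, 0 < a → ‖f0 a‖ ≤ C) (a : ℝ) (ha : 0 < a) :
    ‖f a‖ ≤ K / β + 2 * C := by
  have hKd : 0 ≤ K / β := by positivity
  have key : ∀ b, a ≤ b → ‖f b - (((b / a) ^ β : ℝ) : ℂ) * f a‖ ≤ K / β * (b / a) ^ β := by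
    intro b hab
    have hb : 0 < b := ha.trans_le hab
    have h := s2_weight (q := -β) (ε := 0) (K := K) ha hab (by simpa using hβ.ne') hf he
      (fun x hx => by simpa using hr x (lt_of_lt_of_le ha hx.1))
    simp only [sub_zero, div_neg] at h
    have h1 : f b - (((b / a) ^ β : ℝ) : ℂ) * f a =
       ((b ^ β : ℝ) : ℂ) * (((b ^ (-β) : ℝ) : ℂ) * f b - ((a ^ (-β) : ℝ) : ℂ) * f a) := by
      have e1 : b ^ β * b ^ (-β) = 1 := by rw [← Real.rpow_add hb]; simp
      have e2 : (b / a) ^ β = b ^ β * a ^ (-β) := by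
        rw [Real.div_rpow hb.le ha.le, Real.rpow_neg ha.le]; rfl
      have e1' : ((b ^ β : ℝ) : ℂ) * ((b ^ (-β) : ℝ) : ℂ) = 1 := by exact_mod_cast e1
      rw [e2]; push_cast
      linear_combination (-f b) * e1'
    rw [h1, norm_mul, Complex.norm_real, Real.norm_of_nonneg (by positivity)]
    have e2 : (b / a) ^ β = b ^ β * a ^ (-β) := by
      rw [Real.div_rpow hb.le ha.le, Real.rpow_neg ha.le]; rfl
    rw [e2]
    calc _ ≤ b ^ β * (K / β * a ^ (-β)) := by
          gcongr
          have : 0 ≤ K / β * b ^ (-β) := by positivity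
          linarith
      _ = _ := by ring
  set G : ℝ → ℝ := fun b => a / (β + 1) * (b / a) ^ (β + 1) with hG
  have hGd : ∀ b, a ≤ b → HasDerivAt G ((b / a) ^ β) b := by
    intro b hab
    have hb : 0 < b := ha.trans_le hab
    have h1 := ((Real.hasDerivAt_rpow_const (x := b / a) (p := β + 1)
      (Or.inl (by positivity))).comp b ((hasDerivAt_id b).div_const a)).const_mul (a / (β + 1))
    refine HasDerivAt.congr_deriv h1 ?_
    simp only [add_sub_cancel_right]
    field_simp
  have h := s1_fence (f := fun b => f0 b - (G b : ℂ) * f a)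
    (f' := fun b => f b - (((b / a) ^ β : ℝ) : ℂ) * f a)
    (B := fun b => K / β * G b) (B' := fun b => K / β * (b / a) ^ β)
    (a := a) (b := a + 1) (by linarith)
    (fun x hx => (hf0 x (ha.trans_le hx.1)).sub ((hGd x hx.1).ofReal_comp.mul_const _))
    (fun x hx => (hGd x hx.1).const_mul _)
    (fun x hx => key x hx.1)
  -- S ≥ 1
  have hS : 1 ≤ G (a + 1) - G a := by
    have h2 := s1_fence (f := fun b => (b : ℂ)) (f' := fun _ => 1)
      (B := G) (B' := fun b => (b / a) ^ β) (a := a) (b := a + 1) (by linarith)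
      (fun x _ => (hasDerivAt_id x).ofReal_comp) (fun x hx => hGd x hx.1)
      (fun x hx => by
        simp only [norm_one]
        exact Real.one_le_rpow ((one_le_div ha).2 hx.1) hβ.le)
    simpa using h2
  set S := G (a + 1) - G a with hSd
  have h4 : S * ‖f a‖ ≤ K / β * S + 2 * C := by
    have e : ((S : ℂ)) * f a = (f0 (a + 1) - f0 a) -
      ((f0 (a + 1) - (G (a+1) : ℂ) * f a) - (f0 a - (G a : ℂ) * f a)) := by
      rw [hSd]; push_cast; ring
    have e2 : S * ‖f a‖ = ‖(S : ℂ) * f a‖ := by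
      rw [norm_mul, Complex.norm_real, Real.norm_of_nonneg (by linarith)]
    rw [e2, e]
    refine (norm_sub_le _ _).trans ?_
    have h5 := norm_sub_le (f0 (a + 1)) (f0 a)
    have h6 := hC (a + 1) (by linarith)
    have h7 := hC a ha
    have : K / β * G (a + 1) - K / β * G a = K / β * S := by rw [hSd]; ring
    linarith
  have hC0 : 0 ≤ C := (norm_nonneg _).trans (hC a ha)
  by_contra hcon
  push Not at hcon
  nlinarith

theorem s6_second {f f' : ℝ → ℝ} {c x : ℝ} (hf : ∀ᶠ t in 𝓝 x, HasDerivAt f (f' t) t)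
    (hf' : HasDerivAt f' c x) (hm : IsLocalMax f x) : f' x = 0 ∧ c ≤ 0 := by
  have h0 : f' x = 0 := hm.hasDerivAt_eq_zero hf.self_of_nhds
  refine ⟨h0, ?_⟩
  by_contra hc
  push Not at hc
  have hd : deriv f =ᶠ[𝓝 x] f' := hf.mono fun t ht => ht.deriv
  have hdd : deriv (deriv f) x = c := by rw [hd.deriv_eq, hf'.deriv]
  have hmin := isLocalMin_of_deriv_deriv_pos (f := f) (x₀ := x) (by rw [hdd]; exact hc)
    (by rw [hd.self_of_nhds, h0]) hf.self_of_nhds.continuousAt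
  have hconst : f =ᶠ[𝓝 x] fun _ => f x := by
    filter_upwards [hmin, hm] with t h1 h2 using le_antisymm h2 h1
  have : deriv (deriv f) x = 0 := by
    rw [hconst.deriv.deriv_eq]; simp
  linarith

structure Sys {Z X ι : Type} [NormedAddCommGroup Z] [NormedSpace ℝ Z] [Fintype ι]
    (α β : ℝ) (k : ℕ) (e : ι → Z) (d : ι → X → X) (sm : ℂ → X → X)
    (Q : Z → ℝ) (g : ℕ → X → Z → ℝ → ℂ) : Prop where
  hα : 0 < α
  hβ : 0 < β
  hk : k = Nat.floor β + 1
  H1 : ∀ p x ζ (a : ℝ), 0 < a → HasDerivAt (g p x ζ) (g (p + 1) x ζ a) a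
  H2 : ∀ p x ζ i (a : ℝ), 0 < a →
    HasDerivAt (fun t : ℝ => g p x (ζ + t • e i) a) (g p (d i x) ζ a) 0
  H3 : ∀ x ζ (a : ℝ), 0 < a →
    (a : ℂ) * g 2 x ζ a + ((-β : ℝ) : ℂ) * g 1 x ζ a + (α : ℂ) * ∑ i, g 0 (d i (d i x)) ζ a = 0
  H4 : ∀ x, ∃ C, ∀ ζ (a : ℝ), 0 < a → ‖g 0 x ζ a‖ ≤ C
  H5 : ∀ p, p ≤ k + 1 → ∀ x ζ, ∃ C, ∀ a : ℝ, 0 < a → a ≤ 1 → ‖g p x ζ a‖ ≤ C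
  H6 : ∀ p x, ContinuousOn (fun z : Z × ℝ => g p x z.1 z.2) {z | 0 < z.2}
  H7 : ∀ p c x ζ a, g p (sm c x) ζ a = c * g p x ζ a
  Qc : Continuous Q
  Qn : ∀ ζ, 0 ≤ Q ζ
  Qe : ∀ ζ i, ∃ b, ∀ t : ℝ, Q (ζ + t • e i) = Q ζ + t * b + t ^ 2
  Qk : ∀ R, IsCompact {ζ | Q ζ ≤ R}
  span : Submodule.span ℝ (range e) = ⊤

namespace Sys
variable {Z X ι : Type} [NormedAddCommGroup Z] [NormedSpace ℝ Z] [Fintype ι]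
    {α β : ℝ} {k : ℕ} {e : ι → Z} {d : ι → X → X} {sm : ℂ → X → X}
    {Q : Z → ℝ} {g : ℕ → X → Z → ℝ → ℂ}

theorem pde (S : Sys α β k e d sm Q g) (p : ℕ) : ∀ x ζ (a : ℝ), 0 < a →
    (a : ℂ) * g (p + 2) x ζ a + (((p : ℝ) - β : ℝ) : ℂ) * g (p + 1) x ζ a
      + (α : ℂ) * ∑ i, g p (d i (d i x)) ζ a = 0 := by
  induction p with
  | zero =>
    intro x ζ a ha
    simpa using S.H3 x ζ a ha
  | succ p ih =>
    intro x ζ a ha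
    have h1 : HasDerivAt (fun a : ℝ => (a : ℂ) * g (p + 2) x ζ a
        + (((p : ℝ) - β : ℝ) : ℂ) * g (p + 1) x ζ a + (α : ℂ) * ∑ i, g p (d i (d i x)) ζ a)
        ((((1 : ℝ) : ℂ) * g (p + 2) x ζ a + (a : ℂ) * g (p + 3) x ζ a)
          + (((p : ℝ) - β : ℝ) : ℂ) * g (p + 2) x ζ a
          + (α : ℂ) * ∑ i, g (p + 1) (d i (d i x)) ζ a) a := by
      refine ((HasDerivAt.mul (hasDerivAt_id a).ofReal_comp (S.H1 (p + 2) x ζ a ha)).add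
        ((S.H1 (p + 1) x ζ a ha).const_mul _)).add (HasDerivAt.const_mul _ ?_)
      exact HasDerivAt.fun_sum fun i _ => S.H1 p _ ζ a ha
    have h2 : (fun a : ℝ => (a : ℂ) * g (p + 2) x ζ a
        + (((p : ℝ) - β : ℝ) : ℂ) * g (p + 1) x ζ a + (α : ℂ) * ∑ i, g p (d i (d i x)) ζ a)
        =ᶠ[𝓝 a] fun _ => 0 := by
      filter_upwards [lt_mem_nhds ha] with b hb using ih x ζ b hb
    have h3 := h1.unique ((hasDerivAt_const a (0 : ℂ)).congr_of_eventuallyEq h2)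
    push_cast at h3 ⊢
    linear_combination h3

theorem sum_bd (x : X) (p : ℕ) {P : ℝ → Prop} {w : ℝ → ℝ} (hα : 0 ≤ α)
    (h : ∀ x, ∃ C, ∀ ζ (a : ℝ), P a → ‖g p x ζ a‖ ≤ C * w a) (hw : ∀ a, P a → 0 ≤ w a) :
    ∃ C, 0 ≤ C ∧ ∀ ζ (a : ℝ), P a → ‖(α : ℂ) * ∑ i, g p (d i (d i x)) ζ a‖ ≤ C * w a := by
  choose C hC using h
  refine ⟨α * ∑ i, |C (d i (d i x))|, by positivity, fun ζ a ha => ?_⟩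
  rw [norm_mul, Complex.norm_real, Real.norm_of_nonneg hα, mul_assoc, Finset.sum_mul]
  gcongr
  refine (norm_sum_le _ _).trans (Finset.sum_le_sum fun i _ => (hC _ ζ a ha).trans ?_)
  have := hw a ha
  gcongr
  exact le_abs_self _

theorem bd1 (S : Sys α β k e d sm Q g) (x : X) :
    ∃ C, ∀ ζ (a : ℝ), 0 < a → ‖g 1 x ζ a‖ ≤ C := by
  obtain ⟨C, hC⟩ := S.H4 x
  obtain ⟨K, hK0, hK⟩ := sum_bd (α := α) (d := d) (g := g) x 0 (P := fun a => 0 < a)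
    (w := fun _ => 1) S.hα.le (fun x => by simpa using S.H4 x) (fun _ _ => zero_le_one)
  refine ⟨K / β + 2 * C, fun ζ a ha => ?_⟩
  exact s5_first (f0 := g 0 x ζ) (f := g 1 x ζ) (f' := g 2 x ζ)
    (r := fun a => (α : ℂ) * ∑ i, g 0 (d i (d i x)) ζ a) S.hβ hK0
    (S.H1 0 x ζ) (S.H1 1 x ζ) (S.H3 x ζ) (fun a ha => by simpa using hK ζ a ha)
    (fun a ha => hC ζ a ha) a ha

theorem bdInf (S : Sys α β k e d sm Q g) (p : ℕ) :
    ∀ x, ∃ C, ∀ ζ (a : ℝ), 1 ≤ a → ‖g p x ζ a‖ ≤ C * 1 ∧ ‖(a : ℂ) * g (p + 2) x ζ a‖ ≤ C := by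
  have main : ∀ p, (∀ x, ∃ C, ∀ ζ (a : ℝ), 1 ≤ a → ‖g p x ζ a‖ ≤ C * 1) →
      (∀ x, ∃ C, ∀ ζ (a : ℝ), 1 ≤ a → ‖g (p + 1) x ζ a‖ ≤ C * 1) →
      (∀ x, ∃ C, ∀ ζ (a : ℝ), 1 ≤ a → ‖(a : ℂ) * g (p + 2) x ζ a‖ ≤ C) := by
    intro p h0 h1 x
    obtain ⟨C1, hC1⟩ := h1 x
    obtain ⟨K, hK0, hK⟩ := sum_bd (α := α) (d := d) (g := g) x p (P := fun a => 1 ≤ a)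
      (w := fun _ => 1) S.hα.le h0 (fun _ _ => zero_le_one)
    refine ⟨|(p : ℝ) - β| * C1 + K, fun ζ a ha => ?_⟩
    have e := S.pde p x ζ a (by linarith)
    have e' : (a : ℂ) * g (p + 2) x ζ a = -((((p : ℝ) - β : ℝ) : ℂ) * g (p + 1) x ζ a
      + (α : ℂ) * ∑ i, g p (d i (d i x)) ζ a) := by linear_combination e
    rw [e', norm_neg]
    refine (norm_add_le _ _).trans ?_
    have := hK ζ a ha
    have h2 := hC1 ζ a ha
    rw [norm_mul, Complex.norm_real, Real.norm_eq_abs]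
    rw [mul_one] at *
    gcongr
  have down : ∀ p, (∀ x, ∃ C, ∀ ζ (a : ℝ), 1 ≤ a → ‖(a : ℂ) * g (p + 2) x ζ a‖ ≤ C) →
      (∀ x, ∃ C, ∀ ζ (a : ℝ), 1 ≤ a → ‖g (p + 2) x ζ a‖ ≤ C * 1) := by
    intro p h x
    obtain ⟨C, hC⟩ := h x
    refine ⟨C, fun ζ a ha => ?_⟩
    have := hC ζ a ha
    rw [norm_mul, Complex.norm_real, Real.norm_of_nonneg (by linarith)] at this
    nlinarith [norm_nonneg (g (p + 2) x ζ a)]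
  have all : ∀ p, (∀ x, ∃ C, ∀ ζ (a : ℝ), 1 ≤ a → ‖g p x ζ a‖ ≤ C * 1) ∧
      (∀ x, ∃ C, ∀ ζ (a : ℝ), 1 ≤ a → ‖g (p + 1) x ζ a‖ ≤ C * 1) := by
    intro p
    induction p with
    | zero =>
      constructor
      · intro x
        obtain ⟨C, hC⟩ := S.H4 x
        exact ⟨C, fun ζ a ha => by simpa using hC ζ a (by linarith)⟩
      · intro x
        obtain ⟨C, hC⟩ := S.bd1 x
        exact ⟨C, fun ζ a ha => by simpa using hC ζ a (by linarith)⟩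
    | succ p ih => exact ⟨ih.2, down p (main p ih.1 ih.2)⟩
  intro x
  obtain ⟨C, hC⟩ := (all p).1 x
  obtain ⟨D, hD⟩ := main p (all p).1 (all p).2 x
  refine ⟨max C D, fun ζ a ha => ⟨(hC ζ a ha).trans ?_, (hD ζ a ha).trans (le_max_right _ _)⟩⟩
  simp

theorem step3 (S : Sys α β k e d sm Q g) (p : ℕ) (ε : ℝ) (hε : (p : ℝ) - β < ε)
    (h : ∀ x, ∃ C, ∀ ζ (a : ℝ), (0 < a ∧ a ≤ 1) → ‖g p x ζ a‖ ≤ C * a ^ (-ε)) :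
    ∀ x, ∃ C, ∀ ζ (a : ℝ), (0 < a ∧ a ≤ 1) → ‖g (p + 1) x ζ a‖ ≤ C * a ^ (-ε) := by
  intro x
  obtain ⟨K, hK0, hK⟩ := sum_bd (α := α) (d := d) (g := g) x p (P := fun a => 0 < a ∧ a ≤ 1)
      (w := fun a => a ^ (-ε)) S.hα.le h (fun a ha => Real.rpow_nonneg ha.1.le _)
  obtain ⟨C, hC⟩ := S.bdInf (p + 1) x
  refine ⟨C + K / (ε - (p - β)), fun ζ a ha => ?_⟩
  refine (s3_step hε hK0 (S.H1 (p + 1) x ζ) (S.pde p x ζ)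
    (fun a h1 h2 => hK ζ a ⟨h1, h2⟩) a ha.1 ha.2).trans ?_
  have h1 := (hC ζ 1 le_rfl).1
  have := Real.rpow_nonneg ha.1.le (-ε)
  rw [mul_one] at h1
  gcongr

theorem bd0 (S : Sys α β k e d sm Q g) (ε : ℝ) (hε : 0 < ε) (hε2 : ε < k - β) :
    ∀ x, ∃ C, ∀ ζ (a : ℝ), (0 < a ∧ a ≤ 1) → ‖g (k + 1) x ζ a‖ ≤ C * a ^ (-ε) := by
  set m := Nat.floor β with hm
  have hmβ : (m : ℝ) ≤ β := Nat.floor_le S.hβ.le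
  have low : ∀ p, p ≤ m → ∀ x, ∃ C, ∀ ζ (a : ℝ), (0 < a ∧ a ≤ 1) →
      ‖g p x ζ a‖ ≤ C * a ^ (-(0 : ℝ)) := by
    intro p
    induction p with
    | zero =>
      intro _ x
      obtain ⟨C, hC⟩ := S.H4 x
      exact ⟨C, fun ζ a ha => by simpa using hC ζ a ha.1⟩
    | succ p ih =>
      intro hp
      refine S.step3 p 0 ?_ (ih (by omega))
      have : ((p : ℝ) + 1) ≤ m := by exact_mod_cast hp
      linarith
  have hmk : ∀ x, ∃ C, ∀ ζ (a : ℝ), (0 < a ∧ a ≤ 1) → ‖g (m + 1) x ζ a‖ ≤ C * a ^ (-ε) := by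
    refine S.step3 m ε (by linarith) fun x => ?_
    obtain ⟨C, hC⟩ := low m le_rfl x
    refine ⟨|C|, fun ζ a ha => (hC ζ a ha).trans ?_⟩
    have h1 := Real.one_le_rpow_of_pos_of_le_one_of_nonpos ha.1 ha.2 (by linarith : -ε ≤ 0)
    simp only [neg_zero, Real.rpow_zero, mul_one]
    nlinarith [le_abs_self C, abs_nonneg C]
  have hk := S.hk
  rw [← hm] at hk
  rw [← hk] at hmk
  intro x
  obtain ⟨K, hK0, hK⟩ := sum_bd (α := α) (d := d) (g := g) x k (P := fun a => 0 < a ∧ a ≤ 1)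
      (w := fun a => a ^ (-ε)) S.hα.le hmk (fun a ha => Real.rpow_nonneg ha.1.le _)
  refine ⟨K / (k - β - ε), fun ζ a ha => ?_⟩
  obtain ⟨C, hC⟩ := S.H5 (k + 1) le_rfl x ζ
  exact s4_step hε2 (by linarith) hK0 (S.H1 (k + 1) x ζ) (S.pde k x ζ)
    (fun a h1 h2 => hK ζ a ⟨h1, h2⟩) hC a ha.1 ha.2

theorem H2' (S : Sys α β k e d sm Q g) (p x ζ i) (a : ℝ) (ha : 0 < a) (t : ℝ) :
    HasDerivAt (fun t : ℝ => g p x (ζ + t • e i) a) (g p (d i x) (ζ + t • e i) a) t := by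
  have h := S.H2 p x (ζ + t • e i) i a ha
  have h2 := HasDerivAt.comp_sub_const t t (f := fun s : ℝ => g p x ((ζ + t • e i) + s • e i) a)
    (by simpa using h)
  refine h2.congr_of_eventuallyEq (Eventually.of_forall fun s => ?_)
  simp only [add_assoc, ← add_smul]
  congr 2
  simp

end Sys

namespace Sys
variable {Z X ι : Type} [NormedAddCommGroup Z] [NormedSpace ℝ Z] [Fintype ι]
    {α β : ℝ} {k : ℕ} {e : ι → Z} {d : ι → X → X} {sm : ℂ → X → X}
    {Q : Z → ℝ} {g : ℕ → X → Z → ℝ → ℂ}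

theorem re_deriv {f : ℝ → ℂ} {f' : ℂ} {t : ℝ} (h : HasDerivAt f f' t) :
    HasDerivAt (fun t => (f t).re) f'.re t :=
  Complex.reCLM.hasFDerivAt.comp_hasDerivAt t h

theorem kβ (S : Sys α β k e d sm Q g) : 0 < (k : ℝ) - β := by
  have := Nat.lt_floor_add_one β
  rw [S.hk]; push_cast; linarith

/-- at an interior maximum of the barrier function we get a contradiction. -/
theorem noMax (S : Sys α β k e d sm Q g) (x : X) (η δ c A : ℝ) (hδ : 0 < δ)
    (hc : 2 * α * Fintype.card ι < (k - β + 1) * c) (ζ : Z) (a : ℝ) (ha : 0 < a) (haA : a < A)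
    (hmax : ∀ ζ' a', 0 < a' → a' < A →
      (g (k + 1) x ζ' a').re - η * a' ^ (-(k - β)) - δ * (Q ζ' - c * a') ≤
      (g (k + 1) x ζ a).re - η * a ^ (-(k - β)) - δ * (Q ζ - c * a)) : False := by
  have hγ := S.kβ
  set γ : ℝ := k - β with hγd
  -- a direction
  have hA := s6_second (x := a)
    (f := fun s => (g (k + 1) x ζ s).re - η * s ^ (-γ) - δ * (Q ζ - c * s))
    (f' := fun s => (g (k + 2) x ζ s).re - η * (-γ * s ^ (-γ - 1)) - δ * (-c))
    (c := (g (k + 3) x ζ a).re - η * (-γ * ((-γ - 1) * a ^ (-γ - 1 - 1))))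
    (by
      filter_upwards [lt_mem_nhds ha] with s hs
      refine ((re_deriv (S.H1 (k + 1) x ζ s hs)).sub
        ((Real.hasDerivAt_rpow_const (Or.inl hs.ne')).const_mul η)).sub (HasDerivAt.const_mul δ ?_)
      simpa using ((hasDerivAt_id s).const_mul c).const_sub (Q ζ))
    (((re_deriv (S.H1 (k + 2) x ζ a ha)).sub
        (((Real.hasDerivAt_rpow_const (Or.inl ha.ne')).const_mul (-γ)).const_mul η)).sub_const _)
    (by
      filter_upwards [lt_mem_nhds ha, gt_mem_nhds haA] with s hs hsA using hmax ζ s hs hsA)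
  obtain ⟨hA1, hA2⟩ := hA
  have hi : ∀ i, (g (k + 1) (d i (d i x)) ζ a).re - δ * 2 ≤ 0 := by
    intro i
    obtain ⟨b, hb⟩ := S.Qe ζ i
    refine (s6_second (x := 0)
      (f := fun t => (g (k + 1) x (ζ + t • e i) a).re - η * a ^ (-γ) - δ * (Q (ζ + t • e i) - c * a))
      (f' := fun t => (g (k + 1) (d i x) (ζ + t • e i) a).re - δ * (b + 2 * t))
      (c := (g (k + 1) (d i (d i x)) ζ a).re - δ * 2) ?_ ?_ ?_).2
    · refine Eventually.of_forall fun t => ?_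
      refine ((re_deriv (S.H2' (k + 1) x ζ i a ha t)).sub_const _).sub (HasDerivAt.const_mul δ ?_)
      simp only [hb]
      refine HasDerivAt.sub_const _ ?_
      refine HasDerivAt.congr_deriv ((((hasDerivAt_id t).mul_const b).const_add (Q ζ)).add
        ((hasDerivAt_id t).pow 2)) ?_
      simp
    · refine (re_deriv (S.H2 (k + 1) (d i x) ζ i a ha)).sub (HasDerivAt.const_mul δ ?_)
      simpa using ((hasDerivAt_id (0 : ℝ)).const_mul 2).const_add b
    · refine Eventually.of_forall fun t => ?_
      simpa using hmax (ζ + t • e i) a ha haA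
  have hsum : (∑ i, (g (k + 1) (d i (d i x)) ζ a).re) ≤ Fintype.card ι * (δ * 2) := by
    have := Finset.sum_le_card_nsmul Finset.univ (fun i => (g (k + 1) (d i (d i x)) ζ a).re) (δ * 2)
      (fun i _ => by have := hi i; linarith)
    simpa using this
  have hp := congrArg Complex.re (S.pde (k + 1) x ζ a ha)
  simp only [Complex.add_re, Complex.re_ofReal_mul, Complex.re_sum, Complex.zero_re] at hp
  have e1 : a * a ^ (-γ - 1 - 1) = a ^ (-γ - 1) := by
    rw [Real.rpow_sub_one ha.ne' (-γ - 1)]; field_simp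
  push_cast at hp
  have hb : (k : ℝ) + 1 - β = γ + 1 := by rw [hγd]; ring
  rw [hb] at hp
  have h2 := mul_le_mul_of_nonneg_left hsum S.hα.le
  have h3 := mul_le_mul_of_nonneg_left hA2 ha.le
  have h4 : a * (η * (-γ * ((-γ - 1) * a ^ (-γ - 1 - 1)))) = η * γ * (γ + 1) * a ^ (-γ - 1) := by
    rw [← e1]; ring
  have h5 : (γ + 1) * ((g (k + 2) x ζ a).re - η * (-γ * a ^ (-γ - 1)) - δ * (-c)) = 0 := by
    rw [hA1, mul_zero]
  have h6 : a * (g (k + 3) x ζ a).re ≤ η * γ * (γ + 1) * a ^ (-γ - 1) := by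
    rw [← h4]; linarith
  have h7 := mul_lt_mul_of_pos_left hc hδ
  change a * (g (k + 3) x ζ a).re + (γ + 1) * (g (k + 2) x ζ a).re + _ = 0 at hp
  nlinarith

theorem maxBound (S : Sys α β k e d sm Q g) (x : X) : ∃ C c : ℝ, ∀ η δ A : ℝ, 0 < η → 0 < δ → 1 ≤ A →
    ∀ ζ a, 0 < a → a < A →
      (g (k + 1) x ζ a).re - η * a ^ (-(k - β)) - δ * (Q ζ - c * a) ≤ C / A + δ * c * A := by
  have hγ := S.kβ
  obtain ⟨C0, hC0⟩ := S.bd0 ((k - β) / 2) (by linarith) (by linarith) x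
  obtain ⟨C1, hC1⟩ := S.bdInf (k + 1) x
  obtain ⟨C2, hC2⟩ := S.bdInf (k - 1) x
  have hk1 : k - 1 + 2 = k + 1 := by have := S.hk; omega
  rw [hk1] at hC2
  set γ : ℝ := k - β with hγd
  have hγ1 : 0 < γ + 1 := by linarith
  set c : ℝ := (2 * α * Fintype.card ι + 1) / (γ + 1) with hcd
  have hα := S.hα
  have hc0 : 0 ≤ c := by positivity
  have hc : 2 * α * Fintype.card ι < (γ + 1) * c := by
    rw [hcd]; field_simp; linarith
  refine ⟨|C2|, c, fun η δ A hη hδ hA ζ0 a0 ha0 haA => ?_⟩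
  by_contra hcon
  push Not at hcon
  have hbd : ∀ ζ a, 0 < a → (g (k + 1) x ζ a).re ≤ |C0| * a ^ (-(γ / 2)) + |C1| := by
    intro ζ a ha
    refine (Complex.re_le_norm _).trans ?_
    rcases le_total a 1 with h | h
    · refine (hC0 ζ a ⟨ha, h⟩).trans ?_
      have : 0 ≤ a ^ (-(γ / 2)) := by positivity
      nlinarith [le_abs_self C0, abs_nonneg C1]
    · refine (hC1 ζ a h).1.trans ?_
      have : 0 ≤ |C0| * a ^ (-(γ / 2)) := by positivity
      linarith [le_abs_self C1]
  have hA0 : 0 < A := by linarith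
  have hbdA : ∀ ζ a, 1 ≤ a → (g (k + 1) x ζ a).re ≤ |C2| / a := by
    intro ζ a ha
    have h := (hC2 ζ a ha).2
    have ha0 : 0 < a := by linarith
    rw [norm_mul, Complex.norm_real, Real.norm_of_nonneg ha0.le] at h
    refine (Complex.re_le_norm _).trans ?_
    rw [le_div_iff₀ ha0]
    linarith [le_abs_self C2]
  set V : Z × ℝ → ℝ := fun z => (g (k + 1) x z.1 z.2).re - η * z.2 ^ (-γ) - δ * (Q z.1 - c * z.2)
    with hV
  have hV0 : 0 ≤ V (ζ0, a0) := by
    have : 0 ≤ |C2| / A + δ * c * A := by positivity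
    exact this.trans hcon.le
  -- lower bound of a
  obtain ⟨s, hs0, hs⟩ : ∃ s : ℝ, 0 < s ∧ ∀ a, 0 < a → a < s →
      |C0| * a ^ (-(γ / 2)) + (|C1| + δ * c * A) < η * a ^ (-γ) := by
    have lim : Tendsto (fun a : ℝ => |C0| * a ^ (γ / 2) + (|C1| + δ * c * A) * a ^ γ) (𝓝 0) (𝓝 0) := by
      have f1 : ∀ q : ℝ, 0 < q → Tendsto (fun s : ℝ => s ^ q) (𝓝 0) (𝓝 0) := by
        intro q hq0
        have := (Real.continuousAt_rpow_const 0 q (Or.inr hq0.le)).tendsto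
        rwa [Real.zero_rpow hq0.ne'] at this
      have := ((f1 (γ / 2) (by linarith)).const_mul |C0|).add
        ((f1 γ hγ).const_mul (|C1| + δ * c * A))
      simpa using this
    have h1 := lim.eventually (gt_mem_nhds hη)
    obtain ⟨s, hs0, hs⟩ := Metric.eventually_nhds_iff.1 h1
    refine ⟨s, hs0, fun a ha has => ?_⟩
    have h2 := hs (y := a) (by rw [Real.dist_eq, sub_zero, abs_of_pos ha]; exact has)
    have h3 := mul_lt_mul_of_pos_right h2 (Real.rpow_pos_of_pos ha (-γ))
    refine lt_of_le_of_lt (le_of_eq ?_) h3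
    rw [add_mul, mul_assoc |C0|, mul_assoc (|C1| + δ * c * A), ← Real.rpow_add ha, ← Real.rpow_add ha]
    rw [show γ / 2 + -γ = -(γ / 2) by ring]
    simp
  set R : ℝ := (|C0| * s ^ (-(γ / 2)) + |C1| + δ * c * A) / δ with hR
  have hin : ∀ z : Z × ℝ, 0 < z.2 → z.2 ≤ A → V (ζ0, a0) ≤ V z →
      z ∈ {ζ | Q ζ ≤ R} ×ˢ Icc s A := by
    intro z hz hzA hVz
    have h0 : 0 ≤ V z := hV0.trans hVz
    have h1 := hbd z.1 z.2 hz
    have h2 := S.Qn z.1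
    have h3 : δ * c * z.2 ≤ δ * c * A := by gcongr
    have h4 : 0 ≤ δ * Q z.1 := by positivity
    simp only [hV] at h0
    have hsz : s ≤ z.2 := by
      by_contra hlt
      push Not at hlt
      have := hs z.2 hz hlt
      nlinarith
    refine ⟨?_, hsz, hzA⟩
    simp only [mem_ofPred_eq]
    rw [hR, le_div_iff₀ hδ]
    have h5 : z.2 ^ (-(γ / 2)) ≤ s ^ (-(γ / 2)) :=
      Real.rpow_le_rpow_of_nonpos hs0 hsz (by linarith)
    have h6 : |C0| * z.2 ^ (-(γ / 2)) ≤ |C0| * s ^ (-(γ / 2)) := by gcongr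
    have h7 : 0 ≤ η * z.2 ^ (-γ) := by positivity
    nlinarith
  have hcomp : IsCompact ({ζ | Q ζ ≤ R} ×ˢ Icc s A) := (S.Qk R).prod isCompact_Icc
  have hmem0 := hin (ζ0, a0) ha0 haA.le le_rfl
  have hcont : ContinuousOn V ({ζ | Q ζ ≤ R} ×ˢ Icc s A) := by
    have hsub : ({ζ | Q ζ ≤ R} ×ˢ Icc s A) ⊆ {z : Z × ℝ | 0 < z.2} :=
      fun z hz => hs0.trans_le hz.2.1
    refine ((Complex.continuous_re.comp_continuousOn ((S.H6 (k + 1) x).mono hsub)).sub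
      (ContinuousOn.mul continuousOn_const ?_)).sub ?_
    · exact continuous_snd.continuousOn.rpow_const fun z hz => Or.inl (hsub hz).ne'
    · exact (continuous_const.mul ((S.Qc.comp continuous_fst).sub
        (continuous_const.mul continuous_snd))).continuousOn
  obtain ⟨z, hz, hzmax⟩ := hcomp.exists_isMaxOn ⟨_, hmem0⟩ hcont
  have hz0 : V (ζ0, a0) ≤ V z := hzmax hmem0
  have hzpos : 0 < z.2 := hs0.trans_le hz.2.1
  have hzA : z.2 < A := by
    refine lt_of_le_of_ne hz.2.2 fun heq => ?_
    have h1 := hbdA z.1 A hA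
    have h2 : V z ≤ |C2| / A + δ * c * A := by
      simp only [hV, heq]
      have h7 : 0 ≤ η * A ^ (-γ) := by positivity
      have h4 : 0 ≤ δ * Q z.1 := mul_nonneg hδ.le (S.Qn _)
      nlinarith
    have : |C2| / A + δ * c * A < V (ζ0, a0) := hcon
    linarith
  refine S.noMax x η δ c A hδ hc z.1 z.2 hzpos hzA fun ζ' a' ha' haA' => ?_
  change V (ζ', a') ≤ V z
  by_cases h : V (ζ0, a0) ≤ V (ζ', a')
  · exact hzmax (hin (ζ', a') ha' haA'.le h)
  · push Not at h
    exact h.le.trans hz0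

theorem re_le_zero (S : Sys α β k e d sm Q g) (x : X) (ζ : Z) (a : ℝ) (ha : 0 < a) :
    (g (k + 1) x ζ a).re ≤ 0 := by
  obtain ⟨C, c, h⟩ := S.maxBound x
  have h1 : ∀ A : ℝ, 1 ≤ A → a < A → (g (k + 1) x ζ a).re ≤
      a ^ (-(k - β)) * A⁻¹ + (Q ζ - c * a) * (A⁻¹ * A⁻¹) + C * A⁻¹ + c * A⁻¹ := by
    intro A hA haA
    have hA0 : 0 < A := by linarith
    have := h A⁻¹ (A⁻¹ * A⁻¹) A (by positivity) (by positivity) hA ζ a ha haA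
    have e : A⁻¹ * A⁻¹ * c * A = c * A⁻¹ := by field_simp
    rw [e, div_eq_mul_inv] at this
    linarith
  have hi : Tendsto (fun A : ℝ => A⁻¹) atTop (𝓝 0) := tendsto_inv_atTop_zero
  have lim := (((hi.const_mul (a ^ (-(k - β)))).add ((hi.mul hi).const_mul (Q ζ - c * a))).add
    (hi.const_mul C)).add (hi.const_mul c)
  simp only [mul_zero, add_zero] at lim
  refine ge_of_tendsto lim ?_
  filter_upwards [eventually_ge_atTop 1, eventually_gt_atTop a] with A h2 h3 using h1 A h2 h3

theorem top_zero (S : Sys α β k e d sm Q g) (x : X) (ζ : Z) (a : ℝ) (ha : 0 < a) :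
    g (k + 1) x ζ a = 0 := by
  have h := S.re_le_zero (sm (starRingEnd ℂ (g (k + 1) x ζ a)) x) ζ a ha
  rw [S.H7, mul_comm, Complex.mul_conj, Complex.ofReal_re] at h
  exact Complex.normSq_eq_zero.1 (le_antisymm h (Complex.normSq_nonneg _))

theorem const_of_zero {f f' : ℝ → ℂ} (hf : ∀ a, 0 < a → HasDerivAt f (f' a) a)
    (h0 : ∀ a, 0 < a → f' a = 0) (a b : ℝ) (ha : 0 < a) (hb : 0 < b) : f a = f b := by
  have key : ∀ a b, 0 < a → a ≤ b → f b = f a := by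
    intro a b ha hab
    have := s1_fence (f := f) (f' := f') (B := fun _ => 0) (B' := fun _ => 0) hab
      (fun x hx => hf x (ha.trans_le hx.1)) (fun x _ => hasDerivAt_const x 0)
      (fun x hx => by simp [h0 x (ha.trans_le hx.1)])
    simp only [sub_zero, norm_le_zero_iff] at this
    exact sub_eq_zero.1 this
  rcases le_total a b with h | h
  · exact (key a b ha h).symm
  · exact key b a hb h

theorem one_zero (S : Sys α β k e d sm Q g) (x : X) : ∀ (ζ : Z) (a : ℝ), 0 < a →
    g 1 x ζ a = 0 := by
  have key : ∀ j, (∀ (ζ : Z) (a : ℝ), 0 < a → g (j + 2) x ζ a = 0) →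
      ∀ (ζ : Z) (a : ℝ), 0 < a → g (j + 1) x ζ a = 0 := by
    intro j hj ζ a ha
    have hc : ∀ b, 0 < b → g (j + 1) x ζ b = g (j + 1) x ζ a :=
      fun b hb => const_of_zero (S.H1 (j + 1) x ζ) (hj ζ) b a hb ha
    set c := g (j + 1) x ζ a with hcd
    have hlin : ∀ b : ℝ, 0 < b → g j x ζ b - b * c = g j x ζ 1 - ((1 : ℝ) : ℂ) * c := by
      intro b hb
      refine const_of_zero (f := fun b : ℝ => g j x ζ b - b * c)
        (f' := fun b => g (j + 1) x ζ b - ((1 : ℝ) : ℂ) * c)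
        (fun b hb => (S.H1 j x ζ b hb).sub (((hasDerivAt_id b).ofReal_comp).mul_const c))
        (fun b hb => by simp [hc b hb]) b 1 hb one_pos
    obtain ⟨C, hC⟩ := S.bdInf j x
    by_contra hne
    have hpos : 0 < ‖c‖ := norm_pos_iff.2 hne
    have hC1 := (hC ζ 1 le_rfl).1
    have hCn : 0 ≤ C := by have := norm_nonneg (g j x ζ 1); linarith
    set b : ℝ := 1 + (2 * C + 1) / ‖c‖ with hb
    have hb1 : 1 ≤ b := by
      have : 0 ≤ (2 * C + 1) / ‖c‖ := by positivity
      linarith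
    have e1 := hlin b (by linarith)
    have e2 : ((b - 1 : ℝ) : ℂ) * c = g j x ζ b - g j x ζ 1 := by
      push_cast at e1 ⊢; linear_combination -e1
    have e3 := congrArg norm e2
    rw [norm_mul, Complex.norm_real, Real.norm_of_nonneg (by linarith)] at e3
    have e4 : (b - 1) * ‖c‖ = 2 * C + 1 := by rw [hb]; field_simp; ring
    have e5 := norm_sub_le (g j x ζ b) (g j x ζ 1)
    have e6 := (hC ζ b hb1).1
    linarith
  have down : ∀ j, (∀ (ζ : Z) (a : ℝ), 0 < a → g (j + 1) x ζ a = 0) →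
      ∀ (ζ : Z) (a : ℝ), 0 < a → g 1 x ζ a = 0 := by
    intro j
    induction j with
    | zero => intro h; exact h
    | succ j ih => intro h; exact ih (key j h)
  exact down k (S.top_zero x)

theorem lap_zero (S : Sys α β k e d sm Q g) (x : X) (ζ : Z) :
    ∑ i, (g 0 (d i (d i x)) ζ 1).re = 0 := by
  have h2 : g 2 x ζ 1 = 0 := by
    have h := S.H1 1 x ζ 1 one_pos
    have : g 1 x ζ =ᶠ[𝓝 1] fun _ => 0 := by
      filter_upwards [lt_mem_nhds (one_pos : (0 : ℝ) < 1)] with b hb using S.one_zero x ζ b hb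
    exact h.unique ((hasDerivAt_const 1 (0 : ℂ)).congr_of_eventuallyEq this)
  have h := S.H3 x ζ 1 one_pos
  rw [h2, S.one_zero x ζ 1 one_pos] at h
  have h3 : ∑ i, g 0 (d i (d i x)) ζ 1 = 0 := by
    have : (α : ℂ) ≠ 0 := by exact_mod_cast S.hα.ne'
    simpa [this] using h
  rw [← Complex.re_sum, h3, Complex.zero_re]

theorem bern (S : Sys α β k e d sm Q g) (x : X) (i : ι) : ∃ M : ℝ, ∀ l δ : ℝ, 0 < l → 0 < δ → ∀ ζ,
    (g 0 (d i x) ζ 1).re ^ 2 ≤ δ * Fintype.card ι / l + l * M + δ * Q ζ := by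
  obtain ⟨C0, hC0⟩ := S.H4 x
  obtain ⟨C1, hC1⟩ := S.H4 (d i x)
  refine ⟨C0 ^ 2, fun l δ hl hδ ζ0 => ?_⟩
  set v : X → Z → ℝ := fun y ζ => (g 0 y ζ 1).re with hv
  have hcont : ∀ y, Continuous (v y) := by
    intro y
    have h1 : ContinuousOn (fun ζ : Z => g 0 y ζ 1) univ := by
      have := S.H6 0 y
      exact this.comp (f := fun ζ : Z => (ζ, (1 : ℝ))) (by fun_prop) (fun ζ _ => by simp)
    exact Complex.continuous_re.comp (continuousOn_univ.1 h1)
  have hd : ∀ y ζ j t, HasDerivAt (fun t : ℝ => v y (ζ + t • e j)) (v (d j y) (ζ + t • e j)) t :=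
    fun y ζ j t => re_deriv (S.H2' 0 y ζ j 1 one_pos t)
  have sqb : ∀ y C, (∀ ζ (a : ℝ), 0 < a → ‖g 0 y ζ a‖ ≤ C) → ∀ ζ, v y ζ ^ 2 ≤ C ^ 2 := by
    intro y C h ζ
    have h1 := (Complex.abs_re_le_norm (g 0 y ζ 1)).trans (h ζ 1 one_pos)
    exact sq_le_sq.2 (h1.trans (le_abs_self C))
  set P : Z → ℝ := fun ζ => v (d i x) ζ ^ 2 + l * v x ζ ^ 2 - δ * Q ζ with hP
  have hPc : Continuous P := by
    have := S.Qc
    have := hcont x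
    have := hcont (d i x)
    fun_prop
  set R := (C1 ^ 2 + l * C0 ^ 2 - P ζ0) / δ with hR
  have hin : ∀ ζ, P ζ0 ≤ P ζ → Q ζ ≤ R := by
    intro ζ h
    rw [hR, le_div_iff₀ hδ]
    have h1 := sqb _ _ hC0 ζ
    have h2 := sqb _ _ hC1 ζ
    simp only [hP] at h ⊢
    nlinarith
  obtain ⟨z, hz, hzm⟩ := (S.Qk R).exists_isMaxOn ⟨ζ0, hin ζ0 le_rfl⟩ hPc.continuousOn
  have hmax : ∀ ζ, P ζ ≤ P z := by
    intro ζ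
    by_cases h : P ζ0 ≤ P ζ
    · exact hzm (hin ζ h)
    · push Not at h
      exact h.le.trans (hzm (hin ζ0 le_rfl))
  have hj : ∀ j, 2 * v (d j (d i x)) z ^ 2 + 2 * v (d i x) z * v (d j (d j (d i x))) z
      + l * (2 * v (d j x) z ^ 2 + 2 * v x z * v (d j (d j x)) z) - δ * 2 ≤ 0 := by
    intro j
    obtain ⟨b, hb⟩ := S.Qe z j
    refine (s6_second (x := 0) (f := fun t => P (z + t • e j))
      (f' := fun t => 2 * v (d i x) (z + t • e j) * v (d j (d i x)) (z + t • e j)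
        + l * (2 * v x (z + t • e j) * v (d j x) (z + t • e j)) - δ * (b + 2 * t))
      ?_ ?_ ?_).2
    · refine Eventually.of_forall fun t => ?_
      simp only [hP, hb]
      refine HasDerivAt.congr_deriv ((((hd (d i x) z j t).pow 2).add
        (((hd x z j t).pow 2).const_mul l)).sub
        (((((hasDerivAt_id t).mul_const b).const_add (Q z)).add
        ((hasDerivAt_id t).pow 2)).const_mul δ)) ?_
      simp
    · refine HasDerivAt.congr_deriv (((((hd (d i x) z j 0).const_mul 2).mul
        (hd (d j (d i x)) z j 0)).add
        ((((hd x z j 0).const_mul 2).mul (hd (d j x) z j 0)).const_mul l)).sub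
        ((((hasDerivAt_id (0 : ℝ)).const_mul 2).const_add b).const_mul δ)) ?_
      simp
      ring
    · refine Eventually.of_forall fun t => ?_
      simpa using hmax (z + t • e j)
  have hs := Finset.sum_nonpos fun j (_ : j ∈ Finset.univ) => hj j
  have l1 : ∑ j, v (d j (d j (d i x))) z = 0 := S.lap_zero (d i x) z
  have l2 : ∑ j, v (d j (d j x)) z = 0 := S.lap_zero x z
  simp only [Finset.sum_sub_distrib, Finset.sum_add_distrib, ← Finset.mul_sum, l1, l2,
    Finset.sum_const, Finset.card_univ, nsmul_eq_mul] at hs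
  have h3 : v (d i x) z ^ 2 ≤ ∑ j, v (d j x) z ^ 2 :=
    Finset.single_le_sum (f := fun j => v (d j x) z ^ 2) (fun j _ => sq_nonneg _) (Finset.mem_univ i)
  have h4 : 0 ≤ ∑ j, v (d j (d i x)) z ^ 2 := Finset.sum_nonneg fun j _ => sq_nonneg _
  have h5 : v (d i x) z ^ 2 ≤ δ * Fintype.card ι / l := by
    rw [le_div_iff₀ hl]
    nlinarith
  have h6 := hmax ζ0
  simp only [hP] at h6
  have h7 := sqb _ _ hC0 z
  have h8 : 0 ≤ δ * Q z := mul_nonneg hδ.le (S.Qn z)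
  have h9 : 0 ≤ l * v x ζ0 ^ 2 := by positivity
  change v (d i x) ζ0 ^ 2 ≤ _
  nlinarith

theorem dzero_re (S : Sys α β k e d sm Q g) (x : X) (i : ι) (ζ : Z) :
    (g 0 (d i x) ζ 1).re = 0 := by
  obtain ⟨M, h⟩ := S.bern x i
  have h1 : ∀ l : ℝ, 0 < l → (g 0 (d i x) ζ 1).re ^ 2 ≤
      l * Fintype.card ι + l * M + l * l * Q ζ := by
    intro l hl
    have := h l (l * l) hl (by positivity) ζ
    have e : l * l * Fintype.card ι / l = l * Fintype.card ι := by field_simp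
    rwa [e] at this
  have lim : Tendsto (fun l : ℝ => l * Fintype.card ι + l * M + l * l * Q ζ) (𝓝[>] 0) (𝓝 0) := by
    have : Continuous (fun l : ℝ => l * Fintype.card ι + l * M + l * l * Q ζ) := by fun_prop
    have := this.tendsto 0
    simp only [zero_mul, add_zero] at this
    exact this.mono_left nhdsWithin_le_nhds
  have := ge_of_tendsto lim (b := (g 0 (d i x) ζ 1).re ^ 2) (by
    filter_upwards [self_mem_nhdsWithin] with l hl using h1 l hl)
  exact pow_eq_zero_iff (two_ne_zero) |>.1 (le_antisymm this (sq_nonneg _))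

theorem re_const (S : Sys α β k e d sm Q g) (x : X) (ζ ζ' : Z) :
    (g 0 x ζ 1).re = (g 0 x ζ' 1).re := by
  have key : ∀ v ∈ Submodule.span ℝ (range e), ∀ (t : ℝ) ζ,
      (g 0 x (ζ + t • v) 1).re = (g 0 x ζ 1).re := by
    intro v hv
    induction hv using Submodule.span_induction with
    | mem v hv =>
      obtain ⟨i, rfl⟩ := hv
      intro t ζ
      have h := is_const_of_deriv_eq_zero (f := fun t : ℝ => (g 0 x (ζ + t • e i) 1).re)
        (fun t => (re_deriv (S.H2' 0 x ζ i 1 one_pos t)).differentiableAt)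
        (fun t => by rw [(re_deriv (S.H2' 0 x ζ i 1 one_pos t)).deriv, S.dzero_re]) t 0
      simpa using h
    | zero => simp
    | add u w _ _ hu hw =>
      intro t ζ
      rw [smul_add, ← add_assoc, hw, hu]
    | smul c u _ hu =>
      intro t ζ
      rw [smul_smul, hu]
  have := key (ζ - ζ') (by rw [S.span]; trivial) 1 ζ'
  simpa using this

theorem const (S : Sys α β k e d sm Q g) (x : X) (ζ ζ' : Z) (a a' : ℝ) (ha : 0 < a) (ha' : 0 < a') :
    g 0 x ζ a = g 0 x ζ' a' := by
  have h1 : ∀ ζ a, 0 < a → g 0 x ζ a = g 0 x ζ 1 := fun ζ a ha =>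
    const_of_zero (S.H1 0 x ζ) (S.one_zero x ζ) a 1 ha one_pos
  rw [h1 ζ a ha, h1 ζ' a' ha']
  refine Complex.ext (S.re_const x ζ ζ') ?_
  have := S.re_const (sm (-Complex.I) x) ζ ζ'
  simpa [S.H7] using this

end Sys

/-- test functions -/
structure TF (n : ℕ) where
  f : (Fin n → ℂ) → ℂ
  sm : ContDiff ℝ (⊤ : ℕ∞) f
  cs : HasCompactSupport f

namespace TF
variable {n : ℕ}

def dd (v : Fin n → ℂ) (φ : TF n) : TF n where
  f := fun η => -(fderiv ℝ φ.f η v)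
  sm := by
    have h : ContDiff ℝ (⊤ : ℕ∞) (fderiv ℝ φ.f) := φ.sm.fderiv_right (m := (⊤ : ℕ∞)) (by simp)
    exact (h.clm_apply contDiff_const).neg
  cs := by
    have := φ.cs.fderiv_apply (𝕜 := ℝ) v
    exact this.comp_left (g := fun z => -z) (by simp)

def cm (c : ℂ) (φ : TF n) : TF n where
  f := fun η => c * φ.f η
  sm := contDiff_const.mul φ.sm
  cs := φ.cs.mul_left

def tr (ζ : Fin n → ℂ) (φ : TF n) : TF n where
  f := fun η => φ.f (η - ζ)
  sm := φ.sm.comp (contDiff_id.sub contDiff_const)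
  cs := by
    have := φ.cs.comp_homeomorph (Homeomorph.subRight ζ)
    exact this

end TF

def UU (n : ℕ) : Set (Hn n) := {p : Hn n | 0 < p.2}

theorem isOpen_UU (n : ℕ) : IsOpen (UU n) := isOpen_lt continuous_const continuous_snd

theorem dirD_smooth {n : ℕ} {G : Hn n → ℂ} (v : Hn n) (hG : ContDiffOn ℝ (⊤ : ℕ∞) G (UU n)) :
    ContDiffOn ℝ (⊤ : ℕ∞) (dirD v G) (UU n) := by
  have h := hG.fderiv_of_isOpen (isOpen_UU n) (m := (⊤ : ℕ∞)) (by simp)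
  exact h.clm_apply contDiffOn_const

theorem diffAt {n : ℕ} {G : Hn n → ℂ} (hG : ContDiffOn ℝ (⊤ : ℕ∞) G (UU n)) {p : Hn n}
    (hp : 0 < p.2) : DifferentiableAt ℝ G p :=
  (hG.contDiffAt ((isOpen_UU n).mem_nhds hp)).differentiableAt (by simp)

/-- the averaging operator -/
def TT {n : ℕ} (G : Hn n → ℂ) (φ : TF n) (ζ : Fin n → ℂ) (a : ℝ) : ℂ :=
  ∫ η : Fin n → ℂ, G (ζ + η, a) * φ.f η

theorem slice_cont {n : ℕ} {G : Hn n → ℂ} (hG : ContDiffOn ℝ (⊤ : ℕ∞) G (UU n))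
    (ζ : Fin n → ℂ) (a : ℝ) (ha : 0 < a) : Continuous (fun η : Fin n → ℂ => G (ζ + η, a)) := by
  rw [← continuousOn_univ]
  exact hG.continuousOn.comp (f := fun η : Fin n → ℂ => ((ζ + η, a) : Hn n))
    (by fun_prop) (fun η _ => ha)

theorem slice_int {n : ℕ} {G : Hn n → ℂ} (hG : ContDiffOn ℝ (⊤ : ℕ∞) G (UU n))
    (φ : TF n) (ζ : Fin n → ℂ) (a : ℝ) (ha : 0 < a) :
    Integrable (fun η : Fin n → ℂ => G (ζ + η, a) * φ.f η) :=
  ((slice_cont hG ζ a ha).mul φ.sm.continuous).integrable_of_hasCompactSupport φ.cs.mul_left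

theorem TT_cont {n : ℕ} {G : Hn n → ℂ} (hG : ContDiffOn ℝ (⊤ : ℕ∞) G (UU n)) (φ : TF n) :
    ContinuousOn (fun z : (Fin n → ℂ) × ℝ => TT G φ z.1 z.2) {z | 0 < z.2} := by
  refine continuousOn_integral_of_compact_support
    (f := fun (z : (Fin n → ℂ) × ℝ) (η : Fin n → ℂ) => G (z.1 + η, z.2) * φ.f η)
    (k := tsupport φ.f) φ.cs ?_ ?_
  · refine ContinuousOn.mul ?_ (φ.sm.continuous.comp continuous_snd).continuousOn
    exact hG.continuousOn.comp
      (f := fun w : ((Fin n → ℂ) × ℝ) × (Fin n → ℂ) => ((w.1.1 + w.2, w.1.2) : Hn n))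
      (by fun_prop) (fun w hw => hw.1)
  · intro z η _ hη
    rw [image_eq_zero_of_notMem_tsupport hη, mul_zero]

/-- differentiation under the integral along a line -/
theorem TT_deriv {n : ℕ} {G : Hn n → ℂ} (hG : ContDiffOn ℝ (⊤ : ℕ∞) G (UU n)) (φ : TF n)
    (v : Hn n) (ζ : Fin n → ℂ) (a : ℝ) (ha : 0 < a) :
    HasDerivAt (fun t : ℝ => TT G φ (ζ + t • v.1) (a + t * v.2)) (TT (dirD v G) φ ζ a) 0 := by
  have hD := dirD_smooth v hG
  -- neighbourhood
  obtain ⟨r, hr, hrp⟩ : ∃ r : ℝ, 0 < r ∧ ∀ t ∈ Icc (-r) r, 0 < a + t * v.2 := by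
    have hc : ContinuousAt (fun t : ℝ => a + t * v.2) 0 := by fun_prop
    have h1 := hc.eventually (lt_mem_nhds (by simpa using ha : (0 : ℝ) < a + 0 * v.2))
    obtain ⟨r, hr, h⟩ := Metric.eventually_nhds_iff.1 h1
    refine ⟨r / 2, by linarith, fun t ht => h ?_⟩
    rw [Real.dist_eq, sub_zero, abs_lt]
    constructor <;> linarith [ht.1, ht.2]
  have hcomp : IsCompact (Icc (-r) r ×ˢ tsupport φ.f) := isCompact_Icc.prod φ.cs
  have hcont : ContinuousOn (fun w : ℝ × (Fin n → ℂ) =>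
      dirD v G ((ζ + w.1 • v.1) + w.2, a + w.1 * v.2)) (Icc (-r) r ×ˢ tsupport φ.f) := by
    exact hD.continuousOn.comp
      (f := fun w : ℝ × (Fin n → ℂ) => (((ζ + w.1 • v.1) + w.2, a + w.1 * v.2) : Hn n))
      (by fun_prop) (fun w hw => hrp _ hw.1)
  obtain ⟨C, hC⟩ := hcomp.exists_bound_of_continuousOn hcont
  have hs : Icc (-r) r ∈ 𝓝 (0 : ℝ) := Icc_mem_nhds (by linarith) hr
  have key := hasDerivAt_integral_of_dominated_loc_of_deriv_le (μ := volume) (x₀ := (0 : ℝ)) hs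
    (F := fun (t : ℝ) (η : Fin n → ℂ) => G ((ζ + t • v.1) + η, a + t * v.2) * φ.f η)
    (F' := fun (t : ℝ) (η : Fin n → ℂ) => dirD v G ((ζ + t • v.1) + η, a + t * v.2) * φ.f η)
    (bound := fun η => C * ‖φ.f η‖)
    (by
      filter_upwards [hs] with t ht
      exact (slice_int hG φ (ζ + t • v.1) (a + t * v.2) (hrp t ht)).aestronglyMeasurable)
    (slice_int hG φ _ _ (hrp 0 (mem_of_mem_nhds hs)))
    (slice_int hD φ _ _ (hrp 0 (mem_of_mem_nhds hs))).aestronglyMeasurable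
    (by
      refine Eventually.of_forall fun η t ht => ?_
      rw [norm_mul]
      by_cases hη : η ∈ tsupport φ.f
      · gcongr
        exact hC (t, η) ⟨ht, hη⟩
      · simp [image_eq_zero_of_notMem_tsupport hη])
    ((φ.sm.continuous.norm.integrable_of_hasCompactSupport φ.cs.norm).const_mul C)
    (by
      refine Eventually.of_forall fun η t ht => ?_
      refine HasDerivAt.mul_const ?_ _
      have hl : HasDerivAt (fun t : ℝ => (((ζ + t • v.1) + η, a + t * v.2) : Hn n)) v t := by
        have h1 : HasDerivAt (fun t : ℝ => (ζ + t • v.1) + η) v.1 t := by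
          have := (((hasDerivAt_id t).smul_const v.1).const_add ζ).add_const η
          simpa using this
        have h2 : HasDerivAt (fun t : ℝ => a + t * v.2) v.2 t := by
          have := ((hasDerivAt_id t).mul_const v.2).const_add a
          simpa using this
        exact h1.prodMk h2
      exact (diffAt hG (p := ((ζ + t • v.1) + η, a + t * v.2)) (hrp t ht)).hasFDerivAt.comp_hasDerivAt
        t hl)
  have h2 := key.2
  simp only [zero_smul, add_zero, zero_mul] at h2
  exact h2

theorem TT_parts {n : ℕ} {G : Hn n → ℂ} (hG : ContDiffOn ℝ (⊤ : ℕ∞) G (UU n)) (φ : TF n)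
    (v : Fin n → ℂ) (ζ : Fin n → ℂ) (a : ℝ) (ha : 0 < a) :
    TT (dirD ((v, 0) : Hn n) G) φ ζ a = TT G (φ.dd v) ζ a := by
  have hfd : ∀ η, HasFDerivAt (fun η : Fin n → ℂ => G (ζ + η, a))
      ((fderiv ℝ G (ζ + η, a)).comp (ContinuousLinearMap.inl ℝ (Fin n → ℂ) ℝ)) η := by
    intro η
    have h1 : HasFDerivAt (fun η : Fin n → ℂ => ((ζ + η, a) : Hn n))
        (ContinuousLinearMap.inl ℝ (Fin n → ℂ) ℝ) η := by
      have := ((hasFDerivAt_id (𝕜 := ℝ) η).const_add ζ).prodMk (hasFDerivAt_const (𝕜 := ℝ) a η)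
      exact this
    exact (diffAt hG (p := (ζ + η, a)) ha).hasFDerivAt.comp η h1
  have hfe : ∀ η, fderiv ℝ (fun η : Fin n → ℂ => G (ζ + η, a)) η v
      = dirD ((v, 0) : Hn n) G (ζ + η, a) := by
    intro η
    rw [(hfd η).fderiv]
    simp [dirD]
  have h := integral_mul_fderiv_eq_neg_fderiv_mul_of_integrable (μ := volume)
    (f := fun η : Fin n → ℂ => G (ζ + η, a)) (g := φ.f) (v := v)
    (by
      simp only [hfe]
      exact slice_int (dirD_smooth _ hG) φ ζ a ha)
    (by
      have := (slice_int hG (φ.dd v) ζ a ha).neg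
      refine this.congr (Eventually.of_forall fun η => ?_)
      simp [TF.dd])
    (slice_int hG φ ζ a ha)
    (fun η _ => (hfd η).differentiableAt)
    (fun η _ => φ.sm.differentiable (by simp) η)
  simp only [hfe] at h
  simp only [TT, TF.dd, mul_neg, integral_neg]
  rw [h, neg_neg]

def eV (n : ℕ) : Fin n ⊕ Fin n → (Fin n → ℂ)
  | .inl j => (eX n j).1
  | .inr j => (eY n j).1

def QQ (n : ℕ) (ζ : Fin n → ℂ) : ℝ := ∑ j, Complex.normSq (ζ j)

theorem QQ_e (n : ℕ) (ζ : Fin n → ℂ) (i : Fin n ⊕ Fin n) :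
    ∃ b, ∀ t : ℝ, QQ n (ζ + t • eV n i) = QQ n ζ + t * b + t ^ 2 := by
  have gen : ∀ (j : Fin n) (c : ℂ), Complex.normSq c = 1 → ∃ b, ∀ t : ℝ,
      QQ n (ζ + t • (fun i => if i = j then c else 0)) = QQ n ζ + t * b + t ^ 2 := by
    intro j c hc
    refine ⟨2 * ((ζ j).re * c.re + (ζ j).im * c.im), fun t => ?_⟩
    have : ∀ i, Complex.normSq ((ζ + t • (fun i => if i = j then c else 0)) i)
        = Complex.normSq (ζ i) + if i = j then
          (t * (2 * ((ζ j).re * c.re + (ζ j).im * c.im)) + t ^ 2) else 0 := by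
      intro i
      by_cases h : i = j
      · subst h
        simp only [Pi.add_apply, Pi.smul_apply, if_true, Complex.normSq_apply, Complex.add_re,
          Complex.add_im, Complex.real_smul, Complex.re_ofReal_mul, Complex.im_ofReal_mul] at hc ⊢
        linear_combination t ^ 2 * hc
      · simp [h]
    simp only [QQ, this, Finset.sum_add_distrib]
    simp
    ring
  rcases i with j | j
  · exact gen j 1 (by simp)
  · exact gen j Complex.I (by simp)

theorem QQ_cont (n : ℕ) : Continuous (QQ n) := by
  unfold QQ
  exact continuous_finsetSum _ fun j _ => Complex.continuous_normSq.comp (continuous_apply j)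

theorem QQ_compact (n : ℕ) (R : ℝ) : IsCompact {ζ | QQ n ζ ≤ R} := by
  refine Metric.isCompact_of_isClosed_isBounded (isClosed_le (QQ_cont n) continuous_const) ?_
  refine (Metric.isBounded_closedBall (x := (0 : Fin n → ℂ)) (r := Real.sqrt R)).subset ?_
  intro ζ hζ
  rw [mem_closedBall_zero_iff, pi_norm_le_iff_of_nonneg (Real.sqrt_nonneg _)]
  intro j
  refine Real.le_sqrt_of_sq_le ?_
  rw [← Complex.normSq_eq_norm_sq]
  exact (Finset.single_le_sum (f := fun j => Complex.normSq (ζ j))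
    (fun j _ => Complex.normSq_nonneg _) (Finset.mem_univ j)).trans hζ

theorem eV_span (n : ℕ) : Submodule.span ℝ (range (eV n)) = ⊤ := by
  rw [eq_top_iff]
  intro ζ _
  have : ζ = ∑ j, ((ζ j).re • eV n (.inl j) + (ζ j).im • eV n (.inr j)) := by
    funext i
    simp only [Finset.sum_apply, Pi.add_apply, Pi.smul_apply, eV, eX, eY, Complex.real_smul,
      Finset.sum_add_distrib]
    simp
  rw [this]
  refine Submodule.sum_mem _ fun j _ => Submodule.add_mem _ ?_ ?_
  · exact Submodule.smul_mem _ _ (Submodule.subset_span ⟨_, rfl⟩)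
  · exact Submodule.smul_mem _ _ (Submodule.subset_span ⟨_, rfl⟩)

theorem partialA_smooth {n : ℕ} {F : Hn n → ℂ} (hF : ContDiffOn ℝ (⊤ : ℕ∞) F (UU n)) (p : ℕ) :
    ContDiffOn ℝ (⊤ : ℕ∞) ((partialA n)^[p] F) (UU n) := by
  induction p with
  | zero => exact hF
  | succ p ih =>
    rw [Function.iterate_succ_apply']
    exact dirD_smooth (eT n) ih

theorem mkSys (n : ℕ) (hn : 1 ≤ n) (α : ℝ) (hα : 0 < α)
    (k : ℕ) (hk : k = Nat.floor ((n : ℝ) * α) + 1)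
    (F : Hn n → ℂ) (hFbdd : ∃ C, ∀ p : Hn n, 0 < p.2 → ‖F p‖ ≤ C)
    (hF : ContDiffOn ℝ (⊤ : ℕ∞) F (UU n))
    (hFharm : ∀ p : Hn n, 0 < p.2 → LamOp n α F p = 0)
    (hreg : ∀ p : ℕ, p ≤ k + 1 → ∀ φ : SchwartzMap (Fin n → ℂ) ℂ, ∃ C : ℝ,
      ∀ a : ℝ, 0 < a → a ≤ 1 →
        ‖∫ ζ : Fin n → ℂ, ((partialA n)^[p] F) (ζ, a) * φ ζ‖ ≤ C) :
    Sys α (n * α) k (eV n) (fun i φ => TF.dd (eV n i) φ) TF.cm (QQ n)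
      (fun p φ ζ a => TT ((partialA n)^[p] F) φ ζ a) where
  hα := hα
  hβ := by have : (0 : ℝ) < n := by exact_mod_cast hn
           positivity
  hk := hk
  H1 := by
    intro p φ ζ a ha
    have h := TT_deriv (partialA_smooth hF p) φ (eT n) ζ a ha
    simp only [eT, smul_zero, add_zero, mul_one] at h
    have h2 := HasDerivAt.comp_sub_const a a (f := fun t : ℝ => TT ((partialA n)^[p] F) φ ζ (a + t))
      (by simpa using h)
    simp only [add_sub_cancel] at h2
    rw [Function.iterate_succ_apply']
    exact h2
  H2 := by
    intro p φ ζ i a ha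
    have h := TT_deriv (partialA_smooth hF p) φ ((eV n i, 0) : Hn n) ζ a ha
    simp only [mul_zero, add_zero] at h
    rw [TT_parts (partialA_smooth hF p) φ (eV n i) ζ a ha] at h
    exact h
  H3 := by
    intro φ ζ a ha
    have e2 : ∀ i, TT F (TF.dd (eV n i) (TF.dd (eV n i) φ)) ζ a =
        TT (dirD ((eV n i, 0) : Hn n) (dirD ((eV n i, 0) : Hn n) F)) φ ζ a := by
      intro i
      rw [TT_parts (dirD_smooth _ hF) φ _ ζ a ha, TT_parts hF _ _ ζ a ha]
    simp only [Function.iterate_zero, id, Function.iterate_one]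
    have e3 : (partialA n)^[2] F = partialA n (partialA n F) := rfl
    rw [e3]
    simp only [e2]
    have s1 : ∀ v w, ContDiffOn ℝ (⊤ : ℕ∞) (dirD v (dirD w F)) (UU n) :=
      fun v w => dirD_smooth v (dirD_smooth w hF)
    have i1 := slice_int (s1 (eT n) (eT n)) φ ζ a ha
    have i2 := slice_int (dirD_smooth (eT n) hF) φ ζ a ha
    have i3 := fun i => slice_int (s1 ((eV n i, 0) : Hn n) ((eV n i, 0) : Hn n)) φ ζ a ha
    have e4 : ∑ i, TT (dirD ((eV n i, 0) : Hn n) (dirD ((eV n i, 0) : Hn n) F)) φ ζ a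
      = ∫ η, ∑ i, dirD ((eV n i, 0) : Hn n) (dirD ((eV n i, 0) : Hn n) F) (ζ + η, a) * φ.f η := by
      rw [integral_finsetSum _ (fun i _ => i3 i)]; rfl
    have i4 := integrable_finsetSum Finset.univ (fun i _ => i3 i)
    rw [e4]
    simp only [TT]
    have i1' : Integrable fun η => (a : ℂ) * (partialA n (partialA n F) (ζ + η, a) * φ.f η) :=
      i1.const_mul _
    have i2' : Integrable fun η => ((-(n * α) : ℝ) : ℂ) * (partialA n F (ζ + η, a) * φ.f η) :=
      i2.const_mul _
    have i12 : Integrable fun η => (a : ℂ) * (partialA n (partialA n F) (ζ + η, a) * φ.f η)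
        + ((-(n * α) : ℝ) : ℂ) * (partialA n F (ζ + η, a) * φ.f η) := i1'.add i2'
    have i4' : Integrable fun η => (α : ℂ) * ∑ i, dirD ((eV n i, 0) : Hn n)
        (dirD ((eV n i, 0) : Hn n) F) (ζ + η, a) * φ.f η := i4.const_mul _
    rw [← integral_const_mul, ← integral_const_mul, ← integral_const_mul,
      ← integral_add i1' i2', ← integral_add i12 i4']
    refine integral_eq_zero_of_ae (Eventually.of_forall fun η => ?_)
    have h := hFharm (ζ + η, a) ha
    have ha' : (a : ℂ) ≠ 0 := by exact_mod_cast ha.ne'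
    simp only [LamOp, DeltaC] at h
    have e5 : ∑ i, dirD ((eV n i, 0) : Hn n) (dirD ((eV n i, 0) : Hn n) F) (ζ + η, a) * φ.f η
      = (∑ j, (dirD (eX n j) (dirD (eX n j) F) (ζ + η, a)
        + dirD (eY n j) (dirD (eY n j) F) (ζ + η, a))) * φ.f η := by
      rw [Fintype.sum_sum_type, Finset.sum_add_distrib, add_mul, Finset.sum_mul, Finset.sum_mul]
      rfl
    simp only [Pi.zero_apply]
    rw [e5]
    refine mul_left_cancel₀ ha' ?_
    push_cast
    linear_combination φ.f η * h
  H4 := by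
    intro φ
    obtain ⟨C, hC⟩ := hFbdd
    refine ⟨∫ η, C * ‖φ.f η‖, fun ζ a ha => ?_⟩
    refine norm_integral_le_of_norm_le
      ((φ.sm.continuous.norm.integrable_of_hasCompactSupport φ.cs.norm).const_mul C)
      (Eventually.of_forall fun η => ?_)
    rw [norm_mul]
    gcongr
    exact hC (ζ + η, a) ha
  H5 := by
    intro p hp φ ζ
    obtain ⟨C, hC⟩ := hreg p hp ((φ.tr ζ).cs.toSchwartzMap (φ.tr ζ).sm)
    refine ⟨C, fun a ha ha1 => ?_⟩
    have h := hC a ha ha1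
    have e : ∫ η : Fin n → ℂ, ((partialA n)^[p] F) (η, a)
        * ((φ.tr ζ).cs.toSchwartzMap (φ.tr ζ).sm) η = TT ((partialA n)^[p] F) φ ζ a := by
      rw [← integral_add_left_eq_self _ ζ]
      simp [TT, TF.tr]
    rw [e] at h
    exact h
  H6 := fun p φ => TT_cont (partialA_smooth hF p) φ
  H7 := by
    intro p c φ ζ a
    simp only [TT, TF.cm]
    rw [← integral_const_mul]
    congr 1
    funext η
    ring
  Qc := QQ_cont n
  Qn := fun ζ => Finset.sum_nonneg fun j _ => Complex.normSq_nonneg _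
  Qe := QQ_e n
  Qk := QQ_compact n
  span := eV_span n
/-- A bounded smooth `Λ_α`-harmonic function on `ℂ^n × (0,∞)` whose transversal
derivatives `∂_a^p F`, `p = 0, …, k+1` (where `k` is the smallest integer bigger than `nα`),
are bounded against every Schwartz function, is constant. -/
theorem stmt5 (n : ℕ) (hn : 1 ≤ n) (α : ℝ) (hα : 0 < α)
    (k : ℕ) (hk : k = Nat.floor ((n : ℝ) * α) + 1)
    (F : Hn n → ℂ) (hFbdd : ∃ C, ∀ p : Hn n, 0 < p.2 → ‖F p‖ ≤ C)
    (hFsmooth : ContDiffOn ℝ (⊤ : ℕ∞) F {p : Hn n | 0 < p.2})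
    (hFharm : ∀ p : Hn n, 0 < p.2 → LamOp n α F p = 0)
    (hreg : ∀ p : ℕ, p ≤ k + 1 → ∀ φ : SchwartzMap (Fin n → ℂ) ℂ, ∃ C : ℝ,
      ∀ a : ℝ, 0 < a → a ≤ 1 →
        ‖∫ ζ : Fin n → ℂ, ((partialA n)^[p] F) (ζ, a) * φ ζ‖ ≤ C) :
    ∀ p q : Hn n, 0 < p.2 → 0 < q.2 → F p = F q := by
  obtain ⟨k, rfl⟩ : ∃ k', k' = k := ⟨k, rfl⟩
  have hF : ContDiffOn ℝ (⊤ : ℕ∞) F (UU n) := hFsmooth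
  have S := mkSys n hn α hα k hk F hFbdd hF hFharm hreg
  intro p q hp hq
  have c1 := slice_cont hF p.1 p.2 hp
  have c2 := slice_cont hF q.1 q.2 hq
  have hc : Continuous fun η : Fin n → ℂ => F (p.1 + η, p.2) - F (q.1 + η, q.2) := c1.sub c2
  have hae : ∀ᵐ η : Fin n → ℂ, F (p.1 + η, p.2) - F (q.1 + η, q.2) = 0 := by
    refine ae_eq_zero_of_integral_contDiff_smul_eq_zero (μ := volume) hc.locallyIntegrable ?_
    intro g hg hgs
    let φ : TF n := ⟨fun η => (g η : ℂ), Complex.ofRealCLM.contDiff.comp hg,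
      hgs.comp_left (g := fun t : ℝ => (t : ℂ)) (by simp)⟩
    have h : TT F φ p.1 p.2 = TT F φ q.1 q.2 := S.const φ p.1 q.1 p.2 q.2 hp hq
    have h2 := integral_sub (slice_int hF φ p.1 p.2 hp) (slice_int hF φ q.1 q.2 hq)
    have h3 : TT F φ p.1 p.2 - TT F φ q.1 q.2 = 0 := sub_eq_zero.2 h
    rw [← h3]
    simp only [TT]
    rw [← h2]
    congr 1
    funext η
    simp only [Complex.real_smul, φ]
    ring
  have h0 := Continuous.ae_eq_iff_eq volume hc (continuous_const (y := (0 : ℂ))) |>.1 hae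
  have := congrFun h0 0
  simp only [add_zero] at this
  exact sub_eq_zero.1 this
end
end

section
/- Let γ > 0. The function y(x) = e^{-x} is a bounded solution on (0,∞) of the equation x g''(x) - γ g'(x) - (x + γ) g(x) = 0, and every bounded solution on (0,∞) of this equation is a constant multiple of e^{-x}. -/
noncomputable section
open MeasureTheory Set Filter
open scoped Topology

/-- The bounded solution `y(x) = e^{-x} ∫_0^∞ e^{-2xt} t^{β/2-1} (1+t)^{-(γ+β/2)} dt`
of the equation `x g'' - γ g' - (x + γ + β) g = 0`. -/
def ySol (γ β : ℝ) (x : ℝ) : ℝ :=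
  Real.exp (-x) *
    ∫ t in Set.Ioi (0 : ℝ), Real.exp (-2 * x * t) * t ^ (β / 2 - 1) * (1 + t) ^ (-(γ + β / 2))

/-- For `β = 0`, the function `y(x) = e^{-x}` is a bounded solution on `(0,∞)`
of `x g'' - γ g' - (x + γ) g = 0`, and every bounded solution of this equation on `(0,∞)`
is a constant multiple of `e^{-x}`. -/
theorem stmt13 (γ : ℝ) (hγ : 0 < γ) :
    ((∀ x : ℝ, 0 < x →
        x * deriv (deriv (fun y : ℝ => Real.exp (-y))) x
          - γ * deriv (fun y : ℝ => Real.exp (-y)) x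
          - (x + γ) * Real.exp (-x) = 0) ∧
      (∃ C : ℝ, ∀ x : ℝ, 0 < x → |Real.exp (-x)| ≤ C)) ∧
    (∀ g : ℝ → ℝ,
      (∀ x : ℝ, 0 < x → DifferentiableAt ℝ g x) →
      (∀ x : ℝ, 0 < x → DifferentiableAt ℝ (deriv g) x) →
      (∀ x : ℝ, 0 < x →
        x * deriv (deriv g) x - γ * deriv g x - (x + γ) * g x = 0) →
      (∃ C : ℝ, ∀ x : ℝ, 0 < x → |g x| ≤ C) →
      ∃ c : ℝ, ∀ x : ℝ, 0 < x → g x = c * Real.exp (-x)) := by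
  refine ⟨⟨?_, 1, ?_⟩, ?_⟩
  · have h1 : deriv (fun y : ℝ => Real.exp (-y)) = fun y => -Real.exp (-y) := by
      funext y
      have := (hasDerivAt_neg y).exp
      rw [this.deriv]; ring
    intro x hx
    have h2 : deriv (fun y : ℝ => -Real.exp (-y)) x = Real.exp (-x) := by
      have := (hasDerivAt_neg x).exp.neg
      have h3 := this.deriv
      simp only [mul_neg, mul_one, neg_neg] at h3
      exact h3
    rw [h1, h2]; ring
  · intro x hx
    rw [abs_of_pos (Real.exp_pos _)]
    exact Real.exp_le_one_iff.mpr (by linarith)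
  · rintro g hg hg' hode ⟨C, hC⟩
    have const : ∀ u : ℝ → ℝ, (∀ x : ℝ, 0 < x → HasDerivAt u 0 x) →
        ∀ x : ℝ, 0 < x → u x = u 1 := by
      intro u hu x hx
      exact (convex_Ioi (0:ℝ)).is_const_of_fderivWithin_eq_zero (𝕜 := ℝ) (f := u)
        (fun y hy => (hu y hy).differentiableAt.differentiableWithinAt)
        (fun y hy => by
          rw [((hu y hy).hasFDerivAt.hasFDerivWithinAt).fderivWithin
            (isOpen_Ioi.uniqueDiffWithinAt hy)]
          ext; simp) hx (show (1:ℝ) ∈ Set.Ioi 0 by simp)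
    have hu := const (fun x => (deriv g x + g x) * Real.exp (-x) * x ^ (-γ)) (by
      intro x hx
      have a := (((hg' x hx).hasDerivAt.add (hg x hx).hasDerivAt).mul
        (hasDerivAt_neg x).exp).mul (Real.hasDerivAt_rpow_const (p := -γ) (Or.inl hx.ne'))
      refine a.congr_deriv ?_
      have e : x ^ (-γ) = x * x ^ (-γ - 1) := by
        rw [Real.rpow_sub_one hx.ne']; field_simp
      simp only [Pi.add_apply, Pi.mul_apply]
      rw [e]
      have o := hode x hx
      linear_combination (Real.exp (-x) * x ^ (-γ - 1)) * o)
    set k : ℝ := (deriv g 1 + g 1) * Real.exp (-1) * 1 ^ (-γ) with hk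
    have hh : ∀ x : ℝ, 0 < x → deriv g x + g x = k * x ^ γ * Real.exp x := by
      intro x hx
      have h := hu x hx
      rw [← h, Real.rpow_neg hx.le, Real.exp_neg]
      have := Real.rpow_pos_of_pos hx γ
      have := Real.exp_pos x
      field_simp
    have hG : ∀ x : ℝ, 0 < x → HasDerivAt (fun x => g x * Real.exp x)
        (k * x ^ γ * Real.exp x ^ 2) x := by
      intro x hx
      refine ((hg x hx).hasDerivAt.mul (Real.hasDerivAt_exp x)).congr_deriv ?_
      linear_combination Real.exp x * hh x hx
    have hk0 : k = 0 := by
      by_contra hk0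
      have hM : ∀ x : ℝ, 0 < x → HasDerivAt
          (fun x => k * (g x * Real.exp x) - k ^ 2 / 2 * Real.exp x ^ 2)
          (k ^ 2 * (x ^ γ - 1) * Real.exp x ^ 2) x := by
        intro x hx
        refine (((hG x hx).const_mul k).sub
          (((Real.hasDerivAt_exp x).pow 2).const_mul (k ^ 2 / 2))).congr_deriv ?_
        push_cast
        ring
      have mono : MonotoneOn (fun x => k * (g x * Real.exp x) - k ^ 2 / 2 * Real.exp x ^ 2)
          (Set.Ici 1) := by
        apply monotoneOn_of_deriv_nonneg (convex_Ici 1)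
        · intro x hx
          exact (hM x (lt_of_lt_of_le one_pos hx)).continuousAt.continuousWithinAt
        · intro x hx
          rw [interior_Ici] at hx
          exact (hM x (lt_trans one_pos hx)).differentiableAt.differentiableWithinAt
        · intro x hx
          rw [interior_Ici] at hx
          rw [(hM x (lt_trans one_pos hx)).deriv]
          have : 1 ≤ x ^ γ := Real.one_le_rpow (le_of_lt hx) hγ.le
          have : 0 ≤ x ^ γ - 1 := by linarith
          positivity
      set m : ℝ := k * (g 1 * Real.exp 1) - k ^ 2 / 2 * Real.exp 1 ^ 2 with hm
      have hC0 : 0 ≤ C := (abs_nonneg _).trans (hC 1 one_pos)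
      have hkp : 0 < k ^ 2 := by positivity
      set A : ℝ := |k| * C + |m| with hA
      have hA0 : 0 ≤ A := by positivity
      set x : ℝ := 1 + 2 * A / k ^ 2 with hx
      have hx1 : 1 ≤ x := by
        have : 0 ≤ 2 * A / k ^ 2 := by positivity
        linarith
      have h1 : m ≤ k * (g x * Real.exp x) - k ^ 2 / 2 * Real.exp x ^ 2 :=
        mono (Set.mem_Ici.mpr le_rfl) (Set.mem_Ici.mpr hx1) hx1
      have hE : x + 1 ≤ Real.exp x := Real.add_one_le_exp x
      have h2 : k * g x ≤ |k| * C := by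
        refine (le_abs_self _).trans ?_
        rw [abs_mul]
        exact mul_le_mul_of_nonneg_left (hC x (by linarith)) (abs_nonneg _)
      have h3 : k * g x * Real.exp x ≤ |k| * C * Real.exp x :=
        mul_le_mul_of_nonneg_right h2 (Real.exp_pos x).le
      have h4 : |m| ≤ |m| * Real.exp x := le_mul_of_one_le_right (abs_nonneg _) (by linarith)
      have h5 : -|m| ≤ m := neg_abs_le m
      have h6 : k ^ 2 / 2 * Real.exp x * Real.exp x ≤ A * Real.exp x := by
        rw [hA]; nlinarith
      have h7 := le_of_mul_le_mul_right h6 (Real.exp_pos x)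
      have h8 : k ^ 2 / 2 * x = k ^ 2 / 2 + A := by
        rw [hx]; field_simp
      nlinarith
    refine ⟨g 1 * Real.exp 1, fun x hx => ?_⟩
    have h := const (fun x => g x * Real.exp x) (fun x hx => by
      have := hG x hx
      rw [hk0] at this
      simpa using this) x hx
    rw [← h, mul_assoc, ← Real.exp_add]
    simp
end
end

section
/- Let β > 0 and let k = ⌊β⌋ + 1 if β is not an integer and k = β if β is an integer. The function y defined on (0,∞) by y(x) = ∫_0^∞ e^{-xt} e^{-1/t} t^{-(2+β)} dt is well defined, smooth, bounded, not identically zero, solves the equation x g''(x) - β g'(x) - g(x) = 0 on (0,∞), and its derivatives up to order k have finite limits at 0, so that y extends to a C^k function on [0,∞). -/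
noncomputable section
open MeasureTheory Set Filter
open scoped Topology

/-- The bounded solution `y(x) = ∫_0^∞ e^{-xt} e^{-1/t} t^{-(2+β)} dt` of the equation
`x g'' - β g' - g = 0`. -/
def zSol (β : ℝ) (x : ℝ) : ℝ :=
  ∫ t in Set.Ioi (0 : ℝ), Real.exp (-x * t) * Real.exp (-1 / t) * t ^ (-(2 + β))

/-- The integrand with a general exponent. -/
def hInt (s x t : ℝ) : ℝ := Real.exp (-x * t) * Real.exp (-1 / t) * t ^ s

/-- The integral with a general exponent. -/
def fInt (s x : ℝ) : ℝ := ∫ t in Set.Ioi (0 : ℝ), hInt s x t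

lemma hInt_nonneg (s x : ℝ) {t : ℝ} (ht : 0 < t) : 0 ≤ hInt s x t := by
  unfold hInt; positivity

lemma hInt_anti (s : ℝ) {x z t : ℝ} (ht : 0 < t) (hxz : x ≤ z) : hInt s z t ≤ hInt s x t := by
  unfold hInt
  have : Real.exp (-z * t) ≤ Real.exp (-x * t) := Real.exp_le_exp.2 (by nlinarith)
  gcongr

lemma exp_inv_le (m : ℕ) {t : ℝ} (ht : 0 < t) :
    Real.exp (-1 / t) ≤ (m.factorial : ℝ) * t ^ (m : ℝ) := by
  have h := Real.pow_div_factorial_le_exp (x := 1 / t) (by positivity) m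
  rw [show -1 / t = -(1 / t) by ring, Real.exp_neg, Real.rpow_natCast]
  have h2 : (0 : ℝ) < (1 / t) ^ m / m.factorial := by positivity
  calc (Real.exp (1 / t))⁻¹ ≤ ((1 / t) ^ m / m.factorial)⁻¹ := inv_anti₀ h2 h
    _ = _ := by rw [one_div, inv_pow]; field_simp

lemma hInt_le (s x : ℝ) (m : ℕ) {t : ℝ} (ht : 0 < t) :
    hInt s x t ≤ (m.factorial : ℝ) * (t ^ (s + m) * Real.exp (-x * t)) := by
  unfold hInt
  rw [Real.rpow_add ht]
  have h := exp_inv_le m ht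
  calc Real.exp (-x * t) * Real.exp (-1 / t) * t ^ s
      ≤ Real.exp (-x * t) * ((m.factorial : ℝ) * t ^ (m : ℝ)) * t ^ s := by gcongr
    _ = _ := by ring

lemma hInt_contOn (s x : ℝ) : ContinuousOn (hInt s x) (Ioi 0) := by
  intro t ht
  have ht' : t ≠ 0 := ne_of_gt ht
  apply ContinuousAt.continuousWithinAt
  unfold hInt
  refine ContinuousAt.mul (ContinuousAt.mul ?_ ?_) ?_
  · fun_prop
  · exact Real.continuous_exp.continuousAt.comp (continuousAt_const.div continuousAt_id ht')
  · exact Real.continuousAt_rpow_const _ _ (Or.inl ht')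

lemma hInt_meas (s x : ℝ) : AEStronglyMeasurable (hInt s x) (volume.restrict (Ioi 0)) :=
  (hInt_contOn s x).aestronglyMeasurable measurableSet_Ioi

lemma hInt_int (s : ℝ) {x : ℝ} (hx : 0 < x) : IntegrableOn (hInt s x) (Ioi 0) := by
  obtain ⟨m, hm⟩ := exists_nat_gt (-1 - s)
  have h := (integrableOn_rpow_mul_exp_neg_mul_rpow (p := 1) (s := s + m) (b := x)
    (by linarith) one_pos hx).const_mul (m.factorial : ℝ)
  refine Integrable.mono' h (hInt_meas s x) ?_
  filter_upwards [ae_restrict_mem measurableSet_Ioi] with t ht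
  rw [Real.norm_of_nonneg (hInt_nonneg s x ht), Real.rpow_one]
  exact hInt_le s x m ht

lemma hInt_int0 {s : ℝ} (hs : s < -1) : IntegrableOn (hInt s 0) (Ioi 0) := by
  rw [← Ioc_union_Ioi_eq_Ioi (zero_le_one (α := ℝ)), integrableOn_union]
  constructor
  · obtain ⟨m, hm⟩ := exists_nat_gt (- s)
    have h : IntegrableOn (fun _ : ℝ => (m.factorial : ℝ)) (Ioc (0:ℝ) 1) := by
      simp [integrableOn_const_iff]
    refine Integrable.mono' h ((hInt_meas s 0).mono_measure
      (Measure.restrict_mono Ioc_subset_Ioi_self le_rfl)) ?_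
    filter_upwards [ae_restrict_mem measurableSet_Ioc] with t ht
    rw [Real.norm_of_nonneg (hInt_nonneg s 0 ht.1)]
    refine (hInt_le s 0 m ht.1).trans ?_
    have : t ^ (s + m) ≤ 1 := Real.rpow_le_one ht.1.le ht.2 (by linarith)
    simp only [neg_zero, zero_mul, Real.exp_zero, mul_one]
    exact mul_le_of_le_one_right (by positivity) this
  · refine Integrable.mono' (integrableOn_Ioi_rpow_of_lt hs one_pos) ((hInt_meas s 0).mono_measure
      (Measure.restrict_mono (Ioi_subset_Ioi zero_le_one) le_rfl)) ?_
    filter_upwards [ae_restrict_mem measurableSet_Ioi] with t ht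
    have ht0 : 0 < t := lt_trans one_pos ht
    rw [Real.norm_of_nonneg (hInt_nonneg s 0 ht0)]
    have := hInt_le s 0 0 ht0
    simpa using this

lemma fInt_hasDeriv (s : ℝ) {x : ℝ} (hx : 0 < x) :
    HasDerivAt (fInt s) (-(fInt (s + 1) x)) x := by
  have key := hasDerivAt_integral_of_dominated_loc_of_deriv_le
    (μ := volume.restrict (Ioi (0:ℝ))) (F := fun x t => hInt s x t)
    (F' := fun x t => -(hInt (s + 1) x t)) (x₀ := x) (s := Ioi (x / 2))
    (bound := hInt (s + 1) (x / 2)) (Ioi_mem_nhds (by linarith))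
    (Eventually.of_forall fun z => hInt_meas s z) (hInt_int s hx)
    (hInt_meas (s + 1) x).neg ?_ (hInt_int (s + 1) (by linarith)) ?_
  · have := key.2
    rw [integral_neg] at this
    exact this
  · filter_upwards [ae_restrict_mem measurableSet_Ioi] with t ht z hz
    rw [norm_neg, Real.norm_of_nonneg (hInt_nonneg _ _ ht)]
    exact hInt_anti _ ht (le_of_lt hz)
  · filter_upwards [ae_restrict_mem measurableSet_Ioi] with t ht z hz
    unfold hInt
    have h1 : HasDerivAt (fun z : ℝ => -z * t) (-1 * t) z := (hasDerivAt_neg z).mul_const t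
    have h2 := (h1.exp.mul_const (Real.exp (-1 / t))).mul_const (t ^ s)
    refine h2.congr_deriv ?_
    rw [Real.rpow_add ht, Real.rpow_one]; ring

lemma fInt_cont0 {s : ℝ} (hs : s < -1) : ContinuousOn (fInt s) (Ici 0) := by
  intro x hx
  refine continuousWithinAt_of_dominated (F := fun x t => hInt s x t) (bound := hInt s 0)
    (Eventually.of_forall fun z => hInt_meas s z) ?_ (hInt_int0 hs) ?_
  · filter_upwards [self_mem_nhdsWithin] with z hz
    filter_upwards [ae_restrict_mem measurableSet_Ioi] with t ht
    rw [Real.norm_of_nonneg (hInt_nonneg _ _ ht)]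
    exact hInt_anti _ ht hz
  · refine Eventually.of_forall fun t => Continuous.continuousWithinAt ?_
    unfold hInt
    fun_prop

lemma fInt_hasDeriv0 {s : ℝ} (hs : s + 1 < -1) {x : ℝ} (hx : 0 ≤ x) :
    HasDerivWithinAt (fInt s) (-(fInt (s + 1) x)) (Ici 0) x := by
  rcases hx.eq_or_lt with rfl | hx
  · refine hasDerivWithinAt_Ici_of_tendsto_deriv (s := Ioi 0)
      (fun z hz => (fInt_hasDeriv s hz).differentiableAt.differentiableWithinAt)
      ((fInt_cont0 (by linarith) 0 self_mem_Ici).mono Ioi_subset_Ici_self)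
      self_mem_nhdsWithin ?_
    have h : ContinuousWithinAt (fun x => -(fInt (s + 1) x)) (Ioi 0) 0 :=
      ((fInt_cont0 hs 0 self_mem_Ici).mono Ioi_subset_Ici_self).neg
    refine Tendsto.congr' ?_ h
    filter_upwards [self_mem_nhdsWithin] with z hz
    exact (fInt_hasDeriv s hz).deriv.symm
  · exact (fInt_hasDeriv s hx).hasDerivWithinAt

lemma fInt_contDiff0 (n : ℕ) : ∀ {s : ℝ}, s + n < -1 → ContDiffOn ℝ n (fInt s) (Ici 0) := by
  induction n with
  | zero => intro s hs; simpa using fInt_cont0 (by simpa using hs)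
  | succ n ih =>
    intro s hs
    push_cast at hs ⊢
    have hn : (0 : ℝ) ≤ n := n.cast_nonneg
    rw [contDiffOn_succ_iff_derivWithin (uniqueDiffOn_Ici 0)]
    refine ⟨fun z hz => (fInt_hasDeriv0 (by linarith) hz).differentiableWithinAt, by simp, ?_⟩
    refine ((ih (s := s + 1) (by linarith)).neg).congr fun z hz => ?_
    exact (fInt_hasDeriv0 (by linarith) hz).derivWithin (uniqueDiffOn_Ici 0 z hz)

lemma fInt_contDiff (n : ℕ) : ∀ s : ℝ, ContDiffOn ℝ n (fInt s) (Ioi 0) := by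
  induction n with
  | zero =>
    intro s
    have : ContinuousOn (fInt s) (Ioi 0) :=
      fun z hz => (fInt_hasDeriv s hz).continuousAt.continuousWithinAt
    simpa using this
  | succ n ih =>
    intro s
    push_cast
    rw [contDiffOn_succ_iff_deriv_of_isOpen isOpen_Ioi]
    refine ⟨fun z hz => (fInt_hasDeriv s hz).differentiableAt.differentiableWithinAt, by simp, ?_⟩
    exact ((ih (s + 1)).neg).congr fun z hz => (fInt_hasDeriv s hz).deriv

lemma hInt_deriv (s x : ℝ) {t : ℝ} (ht : 0 < t) :
    HasDerivAt (hInt s x) (-x * hInt s x t + hInt (s - 2) x t + s * hInt (s - 1) x t) t := by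
  have h1 : HasDerivAt (fun t : ℝ => -x * t) (-x * 1) t := (hasDerivAt_id t).const_mul (-x)
  have h2 : HasDerivAt (fun t : ℝ => -1 / t) (t ^ (-2 : ℝ)) t := by
    have := (hasDerivAt_inv ht.ne').const_mul (-1 : ℝ)
    have h' : (fun t : ℝ => -1 / t) = fun t => -1 * t⁻¹ := by ext; ring
    rw [h']
    refine this.congr_deriv ?_
    rw [Real.rpow_neg ht.le, Real.rpow_ofNat]; ring
  have h3 := Real.hasDerivAt_rpow_const (x := t) (p := s) (Or.inl ht.ne')
  have h := (h1.exp.mul h2.exp).mul h3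
  unfold hInt
  refine HasDerivAt.congr_deriv (f := fun t => Real.exp (-x * t) * Real.exp (-1 / t) * t ^ s) h ?_
  rw [sub_eq_add_neg s 2, Real.rpow_add ht]
  simp only [Pi.mul_apply]
  ring

lemma fInt_ode {s x : ℝ} (hs : s < 0) (hx : 0 < x) :
    x * fInt s x - s * fInt (s - 1) x - fInt (s - 2) x = 0 := by
  have h00 : hInt s x 0 = 0 := by
    unfold hInt; rw [Real.zero_rpow hs.ne, mul_zero]
  have hc : ContinuousWithinAt (hInt s x) (Ici 0) 0 := by
    rw [← Ioi_insert, continuousWithinAt_insert_self]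
    unfold ContinuousWithinAt
    rw [h00]
    obtain ⟨m, hm⟩ := exists_nat_gt (- s)
    have hb : Tendsto (fun t : ℝ => (m.factorial : ℝ) * (t ^ (s + m) * Real.exp (-x * t)))
        (𝓝[>] 0) (𝓝 0) := by
      have : ContinuousAt
          (fun t : ℝ => (m.factorial : ℝ) * (t ^ (s + m) * Real.exp (-x * t))) 0 := by
        refine continuousAt_const.mul (ContinuousAt.mul ?_ (by fun_prop))
        exact Real.continuousAt_rpow_const _ _ (Or.inr (by linarith))
      have h := this.tendsto
      rw [Real.zero_rpow (by linarith), zero_mul, mul_zero] at h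
      exact h.mono_left nhdsWithin_le_nhds
    refine squeeze_zero' ?_ ?_ hb
    · filter_upwards [self_mem_nhdsWithin] with t ht using hInt_nonneg s x ht
    · filter_upwards [self_mem_nhdsWithin] with t ht using hInt_le s x m ht
  have hinf : Tendsto (hInt s x) atTop (𝓝 0) := by
    have hb : Tendsto (fun t : ℝ => t ^ s) atTop (𝓝 0) := by
      simpa using tendsto_rpow_neg_atTop (y := -s) (by linarith)
    refine squeeze_zero' ?_ ?_ hb
    · filter_upwards [eventually_gt_atTop 0] with t ht using hInt_nonneg s x ht
    · filter_upwards [eventually_gt_atTop 0] with t ht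
      have := (hInt_anti s ht hx.le).trans (hInt_le s 0 0 ht)
      simpa using this
  have i0 := (hInt_int s hx).const_mul (-x)
  have i1 := (hInt_int (s - 1) hx).const_mul s
  have i2 := hInt_int (s - 2) hx
  have key := integral_Ioi_of_hasDerivAt_of_tendsto hc (fun t ht => hInt_deriv s x ht)
    ((i0.add i2).add i1) hinf
  have i02 : Integrable (fun t => -x * hInt s x t + hInt (s - 2) x t)
    (volume.restrict (Ioi 0)) := i0.add i2
  rw [integral_add i02 i1, integral_add i0 i2, integral_const_mul, integral_const_mul,
    h00] at key
  unfold fInt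
  linarith

/-- With `k = ⌊β⌋ + 1` if `β` is not an integer and `k = β` otherwise, the
function `y = zSol β` is well defined, smooth, bounded, not identically zero on `(0,∞)`,
solves `x g'' - β g' - g = 0` there, and extends to a `C^k` function on `[0,∞)`. -/
theorem stmt14 (β : ℝ) (hβ : 0 < β)
    (k : ℕ) (hk1 : (∃ m : ℕ, (m : ℝ) = β) → (k : ℝ) = β)
    (hk2 : (¬ ∃ m : ℕ, (m : ℝ) = β) → k = Nat.floor β + 1) :
    (∀ x : ℝ, 0 < x → IntegrableOn
      (fun t : ℝ => Real.exp (-x * t) * Real.exp (-1 / t) * t ^ (-(2 + β)))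
      (Set.Ioi 0)) ∧
    ContDiffOn ℝ (⊤ : ℕ∞) (zSol β) (Set.Ioi 0) ∧
    (∃ C : ℝ, ∀ x : ℝ, 0 < x → |zSol β x| ≤ C) ∧
    (∃ x : ℝ, 0 < x ∧ zSol β x ≠ 0) ∧
    (∀ x : ℝ, 0 < x →
      x * deriv (deriv (zSol β)) x - β * deriv (zSol β) x - zSol β x = 0) ∧
    (∃ Y : ℝ → ℝ, ContDiffOn ℝ k Y (Set.Ici 0) ∧ ∀ x : ℝ, 0 < x → Y x = zSol β x) := by
  have hz : zSol β = fInt (-(2 + β)) := rfl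
  have hd : ∀ x : ℝ, 0 < x → deriv (fInt (-(2 + β))) x = -(fInt (-(2 + β) + 1) x) :=
    fun x hx => (fInt_hasDeriv _ hx).deriv
  refine ⟨fun x hx => hInt_int _ hx, ?_, ?_, ?_, ?_, ?_⟩
  · rw [hz, contDiffOn_infty]
    exact fun n => fInt_contDiff n _
  · refine ⟨fInt (-(2 + β)) 0, fun x hx => ?_⟩
    have h0 : 0 ≤ fInt (-(2 + β)) x :=
      setIntegral_nonneg measurableSet_Ioi fun t ht => hInt_nonneg _ _ ht
    rw [hz, abs_of_nonneg h0]
    exact setIntegral_mono_on (hInt_int _ hx) (hInt_int0 (by linarith)) measurableSet_Ioi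
      fun t ht => hInt_anti _ ht hx.le
  · refine ⟨1, one_pos, ne_of_gt ?_⟩
    rw [hz]
    unfold fInt
    rw [setIntegral_pos_iff_support_of_nonneg_ae ?_ (hInt_int _ one_pos)]
    · have : Ioi (0 : ℝ) ⊆ Function.support (hInt (-(2 + β)) 1) ∩ Ioi 0 := by
        intro t ht
        have ht' : (0 : ℝ) < t := ht
        refine ⟨?_, ht⟩
        have : 0 < hInt (-(2 + β)) 1 t := by unfold hInt; positivity
        exact this.ne'
      refine lt_of_lt_of_le ?_ (measure_mono this)
      simp
    · filter_upwards [ae_restrict_mem measurableSet_Ioi] with t ht using hInt_nonneg _ _ ht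
  · intro x hx
    have h2 : deriv (deriv (fInt (-(2 + β)))) x = fInt (-(2 + β) + 1 + 1) x := by
      have he : deriv (fInt (-(2 + β))) =ᶠ[𝓝 x] fun x => -(fInt (-(2 + β) + 1) x) := by
        filter_upwards [Ioi_mem_nhds hx] with z hz' using hd z hz'
      rw [he.deriv_eq, (fInt_hasDeriv _ hx).fun_neg.deriv, neg_neg]
    rw [hz, h2, hd x hx]
    have h := fInt_ode (s := -β) (by linarith) hx
    rw [show -(2 + β) + 1 + 1 = -β by ring, show -(2 + β) + 1 = -β - 1 by ring,
      show -(2 + β) = -β - 2 by ring]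
    linarith
  · refine ⟨fInt (-(2 + β)), fInt_contDiff0 k ?_, fun x _ => rfl⟩
    have hk : (k : ℝ) < β + 1 := by
      by_cases h : ∃ m : ℕ, (m : ℝ) = β
      · rw [hk1 h]; linarith
      · rw [hk2 h]
        push_cast
        have h1 := Nat.floor_le hβ.le
        have h3 : (Nat.floor β : ℝ) ≠ β := fun h' => h ⟨_, h'⟩
        have := lt_of_le_of_ne h1 h3
        linarith
    linarith
end
end
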